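/- For every integer n ≥ 36 the following inequalities hold: N2(1,5,5n) < N2(2,5,5n) < N2(0,5,5n); N2(1,5,5n+1) < N2(0,5,5n+1); N2(2,5,5n+2) < N2(1,5,5n+2) < N2(0,5,5n+2); N2(0,5,5n+3) < N2(1,5,5n+3); and N2(2,5,5n+4) < N2(0,5,5n+4) < N2(1,5,5n+4). -/

import Mathlib

open scoped Classical

/-- The M2-rank of a partition: ⌈ℓ/2⌉ − s, where ℓ is the largest part
(0 for the empty partition) and s is the number of parts. -/
def m2Rank {n : ℕ} (P : n.Partition) : ℤ :=
  (((P.parts.sup + 1) / 2 : ℕ) : ℤ) - (Multiset.card P.parts : ℤ)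

/-- A partition has no repeated odd parts. -/
def NoRepeatedOddParts {n : ℕ} (P : n.Partition) : Prop :=
  ∀ j : ℕ, Odd j → P.parts.count j ≤ 1

/-- `N2 r m n` is the number of partitions of `n` without repeated odd parts whose
M2-rank is congruent to `r` modulo `m`. -/
noncomputable def N2 (r : ℤ) (m n : ℕ) : ℕ :=
  Nat.card {P : n.Partition // NoRepeatedOddParts P ∧ m2Rank P ≡ r [ZMOD (m : ℤ)]}

section part_A
open Filter Topology
lemma gauss_summable {Q R : ℝ} (hQ0 : 0 < Q) (hQ1 : Q < 1) (hR : 0 < R) :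
    Summable fun n : ℤ => Q ^ (n * (n - 1)) * R ^ n := by
  have key : ∀ (u : ℕ → ℝ) (c : ℝ), 0 < c → (∀ n, 0 < u n) →
      (∀ n : ℕ, u (n + 1) = u n * ((Q ^ 2) ^ n * c)) → Summable u := by
    intro u c hc hu h
    refine summable_of_ratio_test_tendsto_lt_one (l := 0) zero_lt_one
      (Eventually.of_forall fun n => (hu n).ne') ?_
    have : (fun n => ‖u (n + 1)‖ / ‖u n‖) = fun n => (Q ^ 2) ^ n * c := by
      funext n
      rw [h n, norm_mul, mul_comm, mul_div_assoc, div_self, mul_one, Real.norm_of_nonneg]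
      · positivity
      · exact (norm_pos_iff.2 (hu n).ne').ne'
    rw [this]
    have h2 : Q ^ 2 < 1 := by nlinarith
    simpa using (tendsto_pow_atTop_nhds_zero_of_lt_one (by positivity) h2).mul_const c
  refine Summable.of_nat_of_neg ?_ ?_
  · refine key _ R hR (fun n => by positivity) fun n => ?_
    have h1 : (((n + 1 : ℕ) : ℤ) * (((n + 1 : ℕ) : ℤ) - 1)) = (n : ℤ) * ((n : ℤ) - 1) + 2 * n := by
      push_cast; ring
    rw [h1, zpow_add₀ hQ0.ne', zpow_mul, Nat.cast_succ, zpow_add_one₀ hR.ne', zpow_natCast _ n]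
    norm_cast
    ring
  · refine key _ (Q ^ 2 * R⁻¹) (by positivity) (fun n => by positivity) fun n => ?_
    have h1 : ((-((n + 1 : ℕ) : ℤ)) * ((-((n + 1 : ℕ) : ℤ)) - 1))
        = (-(n : ℤ)) * (-(n : ℤ) - 1) + 2 * n + 2 := by
      push_cast; ring
    have h2 : (-((n + 1 : ℕ) : ℤ)) = -(n : ℤ) - 1 := by push_cast; ring
    rw [h1, h2, zpow_add₀ hQ0.ne', zpow_add₀ hQ0.ne', zpow_mul Q 2, zpow_sub_one₀ hR.ne',
      zpow_natCast _ n]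
    have h3 : Q ^ (2 : ℤ) = Q ^ 2 := by norm_cast
    rw [h3]
    ring

/-- theta function -/
noncomputable def jt (q : ℝ) (z : ℂ) : ℂ := ∑' n : ℤ, (-1) ^ n * (q : ℂ) ^ (n * (n - 1)) * z ^ n

lemma zpow_le_add {a b x : ℝ} (ha : 0 < a) (h1 : a ≤ x) (h2 : x ≤ b) (n : ℤ) :
    x ^ n ≤ a ^ n + b ^ n := by
  have hx : 0 < x := lt_of_lt_of_le ha h1
  rcases le_total 0 n with h | h
  · have := zpow_le_zpow_left₀ h hx.le h2
    have : 0 < a ^ n := by positivity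
    linarith
  · obtain ⟨m, rfl⟩ : ∃ m : ℕ, n = -m := ⟨n.natAbs, by omega⟩
    have h3 : 0 < b := hx.trans_le h2
    have : x ^ (-(m : ℤ)) ≤ a ^ (-(m : ℤ)) := by
      rw [zpow_neg, zpow_neg, zpow_natCast, zpow_natCast]
      exact inv_anti₀ (by positivity) (pow_le_pow_left₀ ha.le h1 m)
    have : 0 < b ^ (-(m : ℤ)) := by positivity
    linarith

lemma norm_neg_one_zpow (n : ℤ) : ‖(-1 : ℂ) ^ n‖ = 1 := by simp

lemma jt_term_norm {q : ℝ} (hq0 : 0 < q) (z : ℂ) (n : ℤ) :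
    ‖(-1) ^ n * (q : ℂ) ^ (n * (n - 1)) * z ^ n‖ = q ^ (n * (n - 1)) * ‖z‖ ^ n := by
  rw [norm_mul, norm_mul, norm_neg_one_zpow, norm_zpow, norm_zpow, Complex.norm_real,
    Real.norm_of_nonneg hq0.le, one_mul]

lemma jt_summable {q : ℝ} (hq0 : 0 < q) (hq1 : q < 1) {z : ℂ} (hz : z ≠ 0) :
    Summable fun n : ℤ => (-1) ^ n * (q : ℂ) ^ (n * (n - 1)) * z ^ n := by
  refine Summable.of_norm ?_
  simp_rw [jt_term_norm hq0]
  exact gauss_summable hq0 hq1 (norm_pos_iff.2 hz)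

def ann (a b : ℝ) : Set ℂ := {z | a < ‖z‖ ∧ ‖z‖ < b}

lemma isOpen_ann (a b : ℝ) : IsOpen (ann a b) :=
  (isOpen_lt continuous_const continuous_norm).inter (isOpen_lt continuous_norm continuous_const)

lemma ann_ne_zero {a b : ℝ} (ha : 0 ≤ a) {z : ℂ} (hz : z ∈ ann a b) : z ≠ 0 := by
  rintro rfl
  have := hz.1
  simp at this
  linarith

lemma diff_zpow {z : ℂ} (hz : z ≠ 0) (n : ℤ) : DifferentiableAt ℂ (fun z : ℂ => z ^ n) z :=
  differentiableAt_zpow.2 (Or.inl hz)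

lemma jt_diffOn {q : ℝ} (hq0 : 0 < q) (hq1 : q < 1) {a b : ℝ} (ha : 0 < a) (hb : 0 < b) :
    DifferentiableOn ℂ (jt q) (ann a b) := by
  refine Complex.differentiableOn_tsum_of_summable_norm
    (u := fun n : ℤ => q ^ (n * (n - 1)) * a ^ n + q ^ (n * (n - 1)) * b ^ n) ?_ ?_ (isOpen_ann a b) ?_
  · exact (gauss_summable hq0 hq1 ha).add (gauss_summable hq0 hq1 hb)
  · intro n z hz
    exact ((diff_zpow (ann_ne_zero ha.le hz) n).const_mul _).differentiableWithinAt
  · intro n z hz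
    rw [jt_term_norm hq0, ← mul_add]
    exact mul_le_mul_of_nonneg_left (zpow_le_add ha hz.1.le hz.2.le n) (by positivity)

lemma jt_diffAt {q : ℝ} (hq0 : 0 < q) (hq1 : q < 1) {z : ℂ} (hz : z ≠ 0) :
    DifferentiableAt ℂ (jt q) z := by
  have h : 0 < ‖z‖ := norm_pos_iff.2 hz
  refine (jt_diffOn hq0 hq1 (a := ‖z‖ / 2) (b := 2 * ‖z‖) (by positivity) (by positivity)).differentiableAt
    ((isOpen_ann _ _).mem_nhds ⟨by linarith, by linarith⟩)

lemma jt_deriv_hasSum {q : ℝ} (hq0 : 0 < q) (hq1 : q < 1) :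
    HasSum (fun n : ℤ => (-1) ^ n * (q : ℂ) ^ (n * (n - 1)) * n) (deriv (jt q) 1) := by
  have h := Complex.hasSum_deriv_of_summable_norm
    (F := fun (n : ℤ) (z : ℂ) => (-1) ^ n * (q : ℂ) ^ (n * (n - 1)) * z ^ n)
    (u := fun n : ℤ => q ^ (n * (n - 1)) * (1 / 2) ^ n + q ^ (n * (n - 1)) * 2 ^ n)
    (U := ann (1 / 2) 2) (z := 1)
    ((gauss_summable hq0 hq1 (by norm_num)).add (gauss_summable hq0 hq1 (by norm_num)))
    (fun n z hz => ((diff_zpow (ann_ne_zero (by norm_num) hz) n).const_mul _).differentiableWithinAt)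
    (isOpen_ann _ _)
    (fun n z hz => by
      rw [jt_term_norm hq0, ← mul_add]
      exact mul_le_mul_of_nonneg_left (zpow_le_add (by norm_num) hz.1.le hz.2.le n) (by positivity))
    (by simp [ann]; norm_num)
  have e : (fun i : ℤ => deriv (fun z : ℂ => (-1) ^ i * (q : ℂ) ^ (i * (i - 1)) * z ^ i) 1)
      = fun n : ℤ => (-1) ^ n * (q : ℂ) ^ (n * (n - 1)) * n := by
    funext n
    rw [deriv_const_mul _ (diff_zpow one_ne_zero n)]
    simp
  rw [e] at h
  exact h

lemma jt_shift {q : ℝ} (hq0 : 0 < q) {z : ℂ} (hz : z ≠ 0) :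
    jt q ((q : ℂ) ^ 2 * z) = - z⁻¹ * jt q z := by
  have hq : (q : ℂ) ≠ 0 := by exact_mod_cast hq0.ne'
  unfold jt
  rw [← (Equiv.addRight (-1 : ℤ)).tsum_eq, ← tsum_mul_left]
  refine tsum_congr fun n => ?_
  simp only [Equiv.coe_addRight]
  have h1 : (n + -1) * (n + -1 - 1) = n * (n - 1) - 2 * (n - 1) := by ring
  have h0 : (q : ℂ) ^ 2 = (q : ℂ) ^ (2 : ℤ) := by norm_cast
  have h3 : (q : ℂ) ^ (2 * (n - 1)) ≠ 0 := zpow_ne_zero _ hq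
  rw [h1, mul_zpow, h0, ← zpow_mul, zpow_sub₀ hq, ← sub_eq_add_neg, zpow_sub_one₀ hz,
    zpow_sub_one₀ (by norm_num : (-1 : ℂ) ≠ 0)]
  field_simp

lemma jt_inv {q : ℝ} {z : ℂ} (hz : z ≠ 0) : jt q z⁻¹ = - z⁻¹ * jt q z := by
  unfold jt
  rw [← (Equiv.subLeft (1 : ℤ)).tsum_eq, ← tsum_mul_left]
  refine tsum_congr fun n => ?_
  simp only [Equiv.subLeft_apply]
  have h1 : (1 - n) * (1 - n - 1) = n * (n - 1) := by ring
  rw [h1, zpow_sub₀ (inv_ne_zero hz), zpow_sub₀ (by norm_num : (-1 : ℂ) ≠ 0), inv_zpow z n, zpow_one,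
    zpow_one]
  have : (-1 : ℂ) ^ n * (-1) ^ n = 1 := by rw [← mul_zpow]; norm_num
  have h2 : ((-1 : ℂ) ^ n)⁻¹ = (-1) ^ n := by rw [← inv_zpow]; norm_num
  have h4 : z ^ n ≠ 0 := zpow_ne_zero _ hz
  rw [div_eq_mul_inv, h2, div_inv_eq_mul]
  field_simp

lemma jt_one {q : ℝ} : jt q 1 = 0 := by
  have := jt_inv (q := q) one_ne_zero
  simp at this
  linear_combination this / 2

lemma jt_neg_div {q : ℝ} (hq0 : 0 < q) {z : ℂ} (hz : z ≠ 0) :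
    jt q (-z / q) = z / q * jt q (-q * z) := by
  have hq : (q : ℂ) ≠ 0 := by exact_mod_cast hq0.ne'
  have h := jt_shift hq0 (z := -z / q) (by simp [hz, hq])
  have : (q : ℂ) ^ 2 * (-z / q) = -q * z := by field_simp
  rw [this] at h
  rw [h]; field_simp
end part_A

section part_B
open Filter Topology
noncomputable def lcoef (H : ℂ → ℂ) (n : ℤ) (r : ℝ) : ℂ :=
  ∫ θ in (0 : ℝ)..(2 * Real.pi), (circleMap 0 r θ) ^ (-n) * H (circleMap 0 r θ)

lemma lcoef_circle (H : ℂ → ℂ) (n : ℤ) {r : ℝ} (hr : 0 < r) :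
    (∮ z in C(0, r), (z - 0)⁻¹ • (z ^ (-n) * H z)) = Complex.I * lcoef H n r := by
  unfold lcoef circleIntegral
  rw [← intervalIntegral.integral_const_mul]
  refine intervalIntegral.integral_congr fun θ _ => ?_
  have : circleMap 0 r θ ≠ 0 := circleMap_ne_center hr.ne'
  simp only [deriv_circleMap, sub_zero, smul_eq_mul]
  field_simp

lemma lcoef_indep {a b : ℝ} (ha : 0 < a) {H : ℂ → ℂ} (hH : DifferentiableOn ℂ H (ann a b))
    (n : ℤ) {r R : ℝ} (har : a < r) (hrR : r ≤ R) (hRb : R < b) : lcoef H n r = lcoef H n R := by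
  have hr : 0 < r := ha.trans har
  have hsub : Metric.closedBall (0 : ℂ) R \ Metric.ball 0 r ⊆ ann a b := by
    intro z hz
    simp at hz
    exact ⟨by linarith, by linarith⟩
  have hd : DifferentiableOn ℂ (fun z => z ^ (-n) * H z) (ann a b) := by
    intro z hz
    exact ((diff_zpow (ann_ne_zero ha.le hz) _).differentiableWithinAt).mul (hH z hz)
  have h := Complex.circleIntegral_sub_center_inv_smul_eq_of_differentiable_on_annulus_off_countable
    (c := 0) (f := fun z => z ^ (-n) * H z) hr hrR Set.countable_empty (hd.continuousOn.mono hsub)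
    (fun z hz => by
      refine hd.differentiableAt ((isOpen_ann _ _).mem_nhds ?_)
      simp at hz
      exact ⟨by linarith, by linarith⟩)
  rw [lcoef_circle H n hr, lcoef_circle H n (hr.trans_le hrR)] at h
  exact (mul_left_cancel₀ Complex.I_ne_zero h).symm

lemma lcoef_rec {q : ℝ} (hq0 : 0 < q) {H : ℂ → ℂ} {c : ℂ} 
    (hf : ∀ z : ℂ, ‖z‖ = 1 / q → H ((q : ℂ) ^ 2 * z) = c / z * H z) (n : ℤ) :
    lcoef H n q = c * (q : ℂ) ^ (-2 * n) * lcoef H (n + 1) (1 / q) := by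
  have hq : (q : ℂ) ≠ 0 := by exact_mod_cast hq0.ne'
  unfold lcoef
  rw [← intervalIntegral.integral_const_mul]
  refine intervalIntegral.integral_congr fun θ _ => ?_
  have h1 : circleMap 0 q θ = (q : ℂ) ^ 2 * circleMap 0 (1 / q) θ := by
    simp [circleMap]; field_simp
  have h2 : circleMap 0 (1 / q) θ ≠ 0 := circleMap_ne_center (by positivity)
  have h0 : (q : ℂ) ^ 2 = (q : ℂ) ^ (2 : ℤ) := by norm_cast
  rw [h1, hf _ (by rw [norm_circleMap_zero, abs_of_pos (by positivity)]), mul_zpow, h0, ← zpow_mul,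
    neg_add, zpow_add₀ h2, zpow_neg_one]
  have e : (2 : ℤ) * -n = -2 * n := by ring
  rw [e]
  field_simp

lemma lcoef_closed {q : ℝ} (hq0 : 0 < q) {c : ℂ} (hc : c ≠ 0) {x : ℤ → ℂ}
    (h : ∀ n, x n = c * (q : ℂ) ^ (-2 * n) * x (n + 1)) (n : ℤ) :
    x n = x 0 * (c⁻¹ ^ n * (q : ℂ) ^ (n * (n - 1))) := by
  have hq : (q : ℂ) ≠ 0 := by exact_mod_cast hq0.ne'
  induction n with
  | zero => simp
  | succ n ih =>
    have h1 := h n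
    rw [ih] at h1
    have e : ((n : ℤ) + 1) * ((n : ℤ) + 1 - 1) = n * (n - 1) - (-2 * n) := by ring
    rw [e, zpow_add_one₀ (inv_ne_zero hc), zpow_sub₀ hq]
    have : (q : ℂ) ^ (-2 * (n : ℤ)) ≠ 0 := zpow_ne_zero _ hq
    generalize c⁻¹ ^ (n : ℤ) = u at *
    field_simp
    linear_combination -h1
  | pred n ih =>
    have h1 := h (-n - 1)
    rw [sub_add_cancel, ih] at h1
    have e : (-(n : ℤ) - 1) * (-(n : ℤ) - 1 - 1) = -n * (-n - 1) + (-2 * (-n - 1)) := by ring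
    rw [e, zpow_sub_one₀ (inv_ne_zero hc), zpow_add₀ hq, h1]
    field_simp

lemma laurent {H : ℂ → ℂ} {r : ℝ} (hr : 0 < r) 
    (hc : ContinuousOn H (Metric.sphere 0 r)) 
    (hs : Summable fun n : ℤ => ‖lcoef H n r‖ * r ^ n) {z : ℂ} (hz : ‖z‖ = r) :
    HasSum (fun n : ℤ => (2 * Real.pi : ℂ)⁻¹ * lcoef H n r * z ^ n) (H z) := by
  have : Fact (0 < 2 * Real.pi) := ⟨by positivity⟩
  have hrc : (r : ℂ) ≠ 0 := by exact_mod_cast hr.ne'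
  let f : C(AddCircle (2 * Real.pi), ℂ) :=
    ⟨fun x => H (r * (AddCircle.toCircle x : ℂ)), by
      refine hc.comp_continuous (by fun_prop) fun x => ?_
      rw [mem_sphere_zero_iff_norm, norm_mul, Complex.norm_real, Real.norm_of_nonneg hr.le, Circle.norm_coe, mul_one]⟩
  have hmap : ∀ θ : ℝ, (r : ℂ) * (AddCircle.toCircle (θ : AddCircle (2 * Real.pi)) : ℂ)
      = circleMap 0 r θ := by
    intro θ
    rw [AddCircle.toCircle_apply_mk, Circle.coe_exp]
    simp only [circleMap, zero_add]
    congr 3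
    have : (Real.pi : ℝ) ≠ 0 := Real.pi_ne_zero
    push_cast
    field_simp
  have hfou : ∀ (n : ℤ) (x : AddCircle (2 * Real.pi)), fourier n x = (AddCircle.toCircle x : ℂ) ^ n := by
    intro n x
    rw [fourier_apply, AddCircle.toCircle_zsmul, Circle.coe_zpow]
  have hco : ∀ n : ℤ, fourierCoeff f n = (2 * Real.pi : ℂ)⁻¹ * lcoef H n r * (r : ℂ) ^ n := by
    intro n
    rw [fourierCoeff_eq_intervalIntegral f n 0, zero_add, lcoef, mul_assoc, ← intervalIntegral.integral_mul_const]
    simp only [one_div, Complex.real_smul]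
    push_cast
    congr 1
    refine intervalIntegral.integral_congr fun θ _ => ?_
    simp only [smul_eq_mul, hfou, f, ContinuousMap.coe_mk]
    rw [← hmap θ, mul_zpow, zpow_neg (r : ℂ)]
    field_simp
  have hsum : Summable (fourierCoeff f) := by
    refine Summable.of_norm ?_
    have := hs.mul_left ((2 * Real.pi)⁻¹)
    refine this.congr fun n => ?_
    rw [hco, norm_mul, norm_mul, norm_zpow, Complex.norm_real, Real.norm_of_nonneg hr.le]
    simp [abs_of_pos Real.pi_pos]
    ring
  obtain ⟨x, hx⟩ : ∃ x : AddCircle (2 * Real.pi), (r : ℂ) * (AddCircle.toCircle x : ℂ) = z := by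
    refine ⟨((Complex.arg z : ℝ) : AddCircle (2 * Real.pi)), ?_⟩
    rw [hmap, circleMap, zero_add, ← hz]
    exact Complex.norm_mul_exp_arg_mul_I z
  have h := has_pointwise_sum_fourier_series_of_summable hsum x
  have h2 : f x = H z := by simp [f, hx]
  rw [h2] at h
  convert h using 2 with n
  rw [hco, hfou, ← hx, mul_zpow, smul_eq_mul]
  ring

lemma uniq {q : ℝ} (hq0 : 0 < q) (hq1 : q < 1) {a : ℝ} (ha0 : 0 < a) (ha : a < q) {H : ℂ → ℂ}
    (hH : DifferentiableOn ℂ H (ann a (1 / a))) {c : ℂ} (hc : c ≠ 0)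
    (hf : ∀ z : ℂ, ‖z‖ = 1 / q → H ((q : ℂ) ^ 2 * z) = c / z * H z) :
    ∃ h : ℂ, ∀ z : ℂ, q ≤ ‖z‖ → ‖z‖ ≤ 1 / q → H z = h * jt q (- z / c) := by
  have hq : (q : ℂ) ≠ 0 := by exact_mod_cast hq0.ne'
  have h1a : 1 / q < 1 / a := one_div_lt_one_div_of_lt ha0 ha
  have hqq : q ≤ 1 / q := by rw [le_div_iff₀ hq0]; nlinarith
  have hrec : ∀ n, lcoef H n q = c * (q : ℂ) ^ (-2 * n) * lcoef H (n + 1) q := by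
    intro n
    rw [lcoef_rec hq0 hf n, ← lcoef_indep ha0 hH (n + 1) ha hqq h1a]
  have hcl := lcoef_closed hq0 hc hrec
  refine ⟨(2 * Real.pi : ℂ)⁻¹ * lcoef H 0 q, fun z hz1 hz2 => ?_⟩
  have hz0 : 0 < ‖z‖ := hq0.trans_le hz1
  have hi : ∀ n, lcoef H n ‖z‖ = lcoef H 0 q * (c⁻¹ ^ n * (q : ℂ) ^ (n * (n - 1))) := by
    intro n
    rw [← hcl n, lcoef_indep ha0 hH n ha hz1 (by linarith)]
  have hl := laurent (H := H) hz0 (hH.continuousOn.mono (fun w hw => by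
      simp at hw
      exact ⟨by linarith, by linarith⟩)) (by
      have := (gauss_summable hq0 hq1 (R := ‖c‖⁻¹ * ‖z‖) (by positivity)).mul_left ‖lcoef H 0 q‖
      refine this.congr fun n => ?_
      rw [hi, norm_mul, norm_mul, norm_zpow, norm_zpow, norm_inv, Complex.norm_real,
        Real.norm_of_nonneg hq0.le, mul_zpow]
      ring) (z := z) rfl
  rw [← hl.tsum_eq, jt, ← tsum_mul_left]
  refine tsum_congr fun n => ?_
  have e : (-1 : ℂ) ^ n * (-z / c) ^ n = c⁻¹ ^ n * z ^ n := by
    rw [← mul_zpow, ← mul_zpow]; congr 1; field_simp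
  rw [hi]
  linear_combination (-(2 * Real.pi : ℂ)⁻¹ * lcoef H 0 q * (q : ℂ) ^ (n * (n - 1))) * e
end part_B

section part_C
open Filter Topology
/-- Appell-Lerch type sums -/
noncomputable def Lam (q : ℝ) (u : ℤ → ℂ) (z : ℂ) : ℂ := ∑' n : ℤ, u n / (1 - z * (q : ℂ) ^ (2 * n))
noncomputable def LamS (q : ℝ) (u : ℤ → ℂ) (z : ℂ) : ℂ :=
  ∑' n : ℤ, if n = 0 then 0 else u n / (1 - z * (q : ℂ) ^ (2 * n))
def Adm (q : ℝ) (u : ℤ → ℂ) : Prop := Summable fun n : ℤ => ‖u n‖ * min 1 (q ^ (-2 * n))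
noncomputable def kt (q : ℝ) (z : ℂ) : ℂ := - dslope (jt q) 1 z
noncomputable def Mt (q : ℝ) (u : ℤ → ℂ) (z : ℂ) : ℂ := kt q z + jt q z * LamS q u z

lemma den_bound {q : ℝ} (hq0 : 0 < q) (hq1 : q < 1) {a : ℝ} (ha : q ^ 2 < a) (ha1 : a < 1)
    {z : ℂ} (hz : z ∈ ann a (1 / a)) {n : ℤ} (hn : n ≠ 0) :
    (1 - q ^ 2 / a) * a ≤ ‖1 - z * (q : ℂ) ^ (2 * n)‖ * min 1 (q ^ (-2 * n)) := by
  have ha0 : 0 < a := by nlinarith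
  obtain ⟨h1, h2⟩ := hz
  have hnorm : ‖z * (q : ℂ) ^ (2 * n)‖ = ‖z‖ * q ^ (2 * n) := by
    rw [norm_mul, norm_zpow, Complex.norm_real, Real.norm_of_nonneg hq0.le]
  have hδ : 0 < 1 - q ^ 2 / a := by
    rw [sub_pos, div_lt_one ha0]; exact ha
  have hpos : 0 < q ^ (2 * n) := by positivity
  have hinv : q ^ (-2 * n) = (q ^ (2 * n))⁻¹ := by rw [← zpow_neg]; congr 1; ring
  rcases lt_or_gt_of_ne hn with h | h
  · have h3 : q ^ (-2 * n) ≤ q ^ 2 := by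
      have : q ^ (-2 * n) ≤ q ^ (2 : ℤ) := zpow_le_zpow_right_of_le_one₀ hq0 hq1.le (by omega)
      exact_mod_cast this
    have h4 : min 1 (q ^ (-2 * n)) = q ^ (-2 * n) := min_eq_right (by nlinarith)
    rw [h4]
    have h5 : ‖z‖ * q ^ (2 * n) - 1 ≤ ‖1 - z * (q : ℂ) ^ (2 * n)‖ := by
      have := norm_sub_norm_le (z * (q : ℂ) ^ (2 * n)) 1
      rw [hnorm, norm_one] at this
      rw [norm_sub_rev]; exact this
    have hpos' : 0 < q ^ (-2 * n) := by positivity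
    have h6 : q ^ (2 * n) * q ^ (-2 * n) = 1 := by rw [hinv]; field_simp
    calc (1 - q ^ 2 / a) * a = a - q ^ 2 := by field_simp
      _ ≤ ‖z‖ - q ^ (-2 * n) := by linarith
      _ = (‖z‖ * q ^ (2 * n) - 1) * q ^ (-2 * n) := by linear_combination -‖z‖ * h6
      _ ≤ _ := mul_le_mul_of_nonneg_right h5 hpos'.le
  · have h3 : q ^ (2 * n) ≤ q ^ 2 := by
      have : q ^ (2 * n) ≤ q ^ (2 : ℤ) := zpow_le_zpow_right_of_le_one₀ hq0 hq1.le (by omega)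
      exact_mod_cast this
    have h4 : min 1 (q ^ (-2 * n)) = 1 := by
      refine min_eq_left ?_
      rw [hinv]
      exact (one_le_inv₀ hpos).2 (by nlinarith)
    rw [h4, mul_one]
    have h5 : 1 - ‖z‖ * q ^ (2 * n) ≤ ‖1 - z * (q : ℂ) ^ (2 * n)‖ := by
      have := norm_sub_norm_le 1 (z * (q : ℂ) ^ (2 * n))
      rw [hnorm, norm_one] at this
      exact this
    have h6 : ‖z‖ * q ^ (2 * n) ≤ 1 / a * q ^ 2 := mul_le_mul h2.le h3 hpos.le (by positivity)
    have h7 : 1 / a * q ^ 2 = q ^ 2 / a := by ring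
    have h8 : (1 - q ^ 2 / a) * a ≤ (1 - q ^ 2 / a) * 1 := mul_le_mul_of_nonneg_left ha1.le hδ.le
    linarith

lemma den_ne {q : ℝ} (hq0 : 0 < q) (hq1 : q < 1) {a : ℝ} (ha : q ^ 2 < a) (ha1 : a < 1)
    {z : ℂ} (hz : z ∈ ann a (1 / a)) {n : ℤ} (hn : n ≠ 0) : 1 - z * (q : ℂ) ^ (2 * n) ≠ 0 := by
  intro h
  have := den_bound hq0 hq1 ha ha1 hz hn
  rw [h, norm_zero, zero_mul] at this
  have ha0 : 0 < a := by nlinarith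
  have hδ : 0 < 1 - q ^ 2 / a := by
    rw [sub_pos, div_lt_one ha0]; exact ha
  nlinarith [mul_pos hδ ha0]

lemma term_bound {q : ℝ} (hq0 : 0 < q) (hq1 : q < 1) {a : ℝ} (ha : q ^ 2 < a) (ha1 : a < 1)
    {z : ℂ} (hz : z ∈ ann a (1 / a)) (u : ℤ → ℂ) (n : ℤ) :
    ‖if n = 0 then 0 else u n / (1 - z * (q : ℂ) ^ (2 * n))‖
      ≤ ((1 - q ^ 2 / a) * a)⁻¹ * (‖u n‖ * min 1 (q ^ (-2 * n))) := by
  have ha0 : 0 < a := by nlinarith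
  have hδ : 0 < 1 - q ^ 2 / a := by
    rw [sub_pos, div_lt_one ha0]; exact ha
  have hmin : 0 < min 1 (q ^ (-2 * n)) := lt_min one_pos (by positivity)
  by_cases hn : n = 0
  · rw [if_pos hn, norm_zero]; positivity
  · rw [if_neg hn, norm_div]
    have h1 := den_bound hq0 hq1 ha ha1 hz hn
    have h2 : 0 < ‖1 - z * (q : ℂ) ^ (2 * n)‖ := norm_pos_iff.2 (den_ne hq0 hq1 ha ha1 hz hn)
    rw [inv_mul_eq_div, div_le_div_iff₀ h2 (by positivity)]
    calc ‖u n‖ * ((1 - q ^ 2 / a) * a) ≤ ‖u n‖ * (‖1 - z * (q : ℂ) ^ (2 * n)‖ * min 1 (q ^ (-2 * n))) :=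
          mul_le_mul_of_nonneg_left h1 (norm_nonneg _)
      _ = _ := by ring

lemma LamS_diffOn {q : ℝ} (hq0 : 0 < q) (hq1 : q < 1) {a : ℝ} (ha : q ^ 2 < a) (ha1 : a < 1)
    {u : ℤ → ℂ} (hu : Adm q u) : DifferentiableOn ℂ (LamS q u) (ann a (1 / a)) := by
  refine Complex.differentiableOn_tsum_of_summable_norm (hu.mul_left ((1 - q ^ 2 / a) * a)⁻¹) ?_
    (isOpen_ann _ _) (fun n z hz => term_bound hq0 hq1 ha ha1 hz u n)
  intro n
  by_cases hn : n = 0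
  · simp [hn]
  · simp only [hn, if_false]
    intro z hz
    refine DifferentiableAt.differentiableWithinAt ?_
    refine DifferentiableAt.div (by fun_prop) (by fun_prop) (den_ne hq0 hq1 ha ha1 hz hn)

lemma LamS_summable {q : ℝ} (hq0 : 0 < q) (hq1 : q < 1) {a : ℝ} (ha : q ^ 2 < a) (ha1 : a < 1)
    {u : ℤ → ℂ} (hu : Adm q u) {z : ℂ} (hz : z ∈ ann a (1 / a)) :
    Summable fun n : ℤ => if n = 0 then 0 else u n / (1 - z * (q : ℂ) ^ (2 * n)) :=
  Summable.of_norm_bounded (hu.mul_left ((1 - q ^ 2 / a) * a)⁻¹) fun n => term_bound hq0 hq1 ha ha1 hz u n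

lemma Lam_hasSum {q : ℝ} (hq0 : 0 < q) (hq1 : q < 1) {a : ℝ} (ha : q ^ 2 < a) (ha1 : a < 1)
    {u : ℤ → ℂ} (hu : Adm q u) {z : ℂ} (hz : z ∈ ann a (1 / a)) :
    HasSum (fun n : ℤ => u n / (1 - z * (q : ℂ) ^ (2 * n))) (u 0 / (1 - z) + LamS q u z) := by
  have h := (LamS_summable hq0 hq1 ha ha1 hu hz).hasSum
  have h2 := (hasSum_ite_eq (0 : ℤ) (u 0 / (1 - z))).add h
  convert h2 using 2 with n
  · by_cases hn : n = 0
    · subst hn; simp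
    · simp [hn]
  · rfl

lemma Lam_eq {q : ℝ} (hq0 : 0 < q) (hq1 : q < 1) {a : ℝ} (ha : q ^ 2 < a) (ha1 : a < 1)
    {u : ℤ → ℂ} (hu : Adm q u) {z : ℂ} (hz : z ∈ ann a (1 / a)) :
    Lam q u z = u 0 / (1 - z) + LamS q u z := (Lam_hasSum hq0 hq1 ha ha1 hu hz).tsum_eq

lemma kt_ne {q : ℝ} {z : ℂ} (hz : z ≠ 1) : kt q z = jt q z / (1 - z) := by
  have h1 : z - 1 ≠ 0 := sub_ne_zero.2 hz
  have h2 : 1 - z ≠ 0 := sub_ne_zero.2 hz.symm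
  rw [kt, dslope_of_ne _ hz, slope_def_field, jt_one, sub_zero, ← neg_sub z 1, div_neg]

lemma kt_one {q : ℝ} : kt q 1 = - deriv (jt q) 1 := by simp [kt]

lemma kt_diffOn {q : ℝ} (hq0 : 0 < q) (hq1 : q < 1) {a : ℝ} (ha0 : 0 < a) (ha1 : a < 1) :
    DifferentiableOn ℂ (kt q) (ann a (1 / a)) := by
  refine DifferentiableOn.neg ?_
  refine (Complex.differentiableOn_dslope ((isOpen_ann _ _).mem_nhds ?_)).2
    (jt_diffOn hq0 hq1 ha0 (by positivity))
  refine ⟨by simpa using ha1, ?_⟩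
  rw [norm_one, lt_div_iff₀ ha0]; linarith

lemma kt_inv {q : ℝ} {z : ℂ} (hz : z ≠ 0) : kt q z⁻¹ = kt q z := by
  by_cases h : z = 1
  · simp [h]
  · have h2 : 1 - z ≠ 0 := sub_ne_zero.2 (Ne.symm h)
    have h3 : 1 - z⁻¹ ≠ 0 := by
      rw [sub_ne_zero]; intro e; apply h; exact (inv_eq_one.1 e.symm)
    rw [kt_ne h, kt_ne (by simpa using h), jt_inv hz, div_eq_div_iff h3 h2]
    field_simp
    ring

lemma kt_diffAt {q : ℝ} (hq0 : 0 < q) (hq1 : q < 1) : DifferentiableAt ℂ (kt q) 1 := by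
  refine (kt_diffOn hq0 hq1 (a := 1 / 2) (by norm_num) (by norm_num)).differentiableAt
    ((isOpen_ann _ _).mem_nhds ?_)
  simp [ann]; norm_num

lemma kt_deriv_one {q : ℝ} (hq0 : 0 < q) (hq1 : q < 1) : deriv (kt q) 1 = 0 := by
  have hd := (kt_diffAt hq0 hq1).hasDerivAt
  have h1 : HasDerivAt (fun z => kt q z⁻¹) (deriv (kt q) 1 * (-1)) 1 := by
    have hi : HasDerivAt (fun z : ℂ => z⁻¹) (-1) 1 := by
      simpa using hasDerivAt_inv (one_ne_zero : (1 : ℂ) ≠ 0)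
    have hd' : HasDerivAt (kt q) (deriv (kt q) 1) ((1 : ℂ)⁻¹) := by simpa using hd
    exact hd'.comp 1 hi
  have h2 : (fun z => kt q z⁻¹) =ᶠ[𝓝 1] kt q := by
    filter_upwards [isOpen_ne.mem_nhds (one_ne_zero : (1 : ℂ) ≠ 0)] with z hz
    exact kt_inv hz
  have h3 := (h1.congr_of_eventuallyEq h2.symm).unique hd
  linear_combination -h3 / 2

lemma Mt_eq {q : ℝ} (hq0 : 0 < q) (hq1 : q < 1) {a : ℝ} (ha : q ^ 2 < a) (ha1 : a < 1)
    {u : ℤ → ℂ} (hu : Adm q u) (h0 : u 0 = 1) {z : ℂ} (hz : z ∈ ann a (1 / a)) (h1 : z ≠ 1) :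
    Mt q u z = jt q z * Lam q u z := by
  rw [Mt, Lam_eq hq0 hq1 ha ha1 hu hz, kt_ne h1, h0]
  ring

lemma Mt_one {q : ℝ} {u : ℤ → ℂ} : Mt q u 1 = - deriv (jt q) 1 := by
  rw [Mt, jt_one, kt_one]; ring

lemma Mt_diffOn {q : ℝ} (hq0 : 0 < q) (hq1 : q < 1) {a : ℝ} (ha : q ^ 2 < a) (ha1 : a < 1)
    {u : ℤ → ℂ} (hu : Adm q u) : DifferentiableOn ℂ (Mt q u) (ann a (1 / a)) := by
  have ha0 : 0 < a := by nlinarith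
  exact (kt_diffOn hq0 hq1 ha0 ha1).add
    ((jt_diffOn hq0 hq1 ha0 (by positivity)).mul (LamS_diffOn hq0 hq1 ha ha1 hu))

lemma one_mem_ann {a : ℝ} (ha0 : 0 < a) (ha1 : a < 1) : (1 : ℂ) ∈ ann a (1 / a) := by
  refine ⟨by simpa using ha1, ?_⟩
  rw [norm_one, lt_div_iff₀ ha0]; linarith

lemma Mt_hasDerivAt_one {q : ℝ} (hq0 : 0 < q) (hq1 : q < 1) {u : ℤ → ℂ} (hu : Adm q u) :
    HasDerivAt (Mt q u) (deriv (jt q) 1 * LamS q u 1) 1 := by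
  obtain ⟨a, ha, ha1⟩ : ∃ a, q ^ 2 < a ∧ a < 1 := exists_between (by nlinarith)
  have ha0 : 0 < a := by nlinarith
  have h1 := (kt_diffAt hq0 hq1).hasDerivAt
  rw [kt_deriv_one hq0 hq1] at h1
  have h2 := (jt_diffAt hq0 hq1 (one_ne_zero)).hasDerivAt
  have h3 := ((LamS_diffOn hq0 hq1 ha ha1 hu).differentiableAt
    ((isOpen_ann _ _).mem_nhds (one_mem_ann ha0 ha1))).hasDerivAt
  have := h1.add (h2.mul h3)
  rw [jt_one, zero_mul, add_zero, zero_add] at this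
  exact this
end part_C

section part_D
open Filter Topology
noncomputable def ut (q : ℝ) (β : ℂ) (n : ℤ) : ℂ := (-1) ^ n * (q : ℂ) ^ (2 * n ^ 2 + n) * β ^ n
noncomputable def vth (q : ℝ) (β : ℂ) : ℂ := ∑' n : ℤ, ut q β n
noncomputable def Tt (q : ℝ) (z β : ℂ) : ℂ := Lam q (ut q β) z

lemma ut_summable_gen {q : ℝ} (hq0 : 0 < q) (hq1 : q < 1) (R : ℝ) (hR : 0 < R) :
    Summable fun n : ℤ => q ^ (2 * n ^ 2 + n) * R ^ n := by
  have h := gauss_summable (Q := q ^ 2) (R := q ^ 3 * R) (by positivity) (by nlinarith) (by positivity)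
  refine h.congr fun n => ?_
  have e : (2 * n ^ 2 + n) = 2 * (n * (n - 1)) + 3 * n := by ring
  have e2 : q ^ (2 : ℤ) = q ^ 2 := by norm_cast
  have e3 : q ^ (3 : ℤ) = q ^ 3 := by norm_cast
  rw [e, zpow_add₀ hq0.ne', zpow_mul q 2, zpow_mul q 3, mul_zpow, e2, e3]
  ring

lemma q_shift {q : ℝ} (hq0 : 0 < q) (z : ℂ) (n : ℤ) :
    (q : ℂ) ^ 2 * z * (q : ℂ) ^ (2 * (n - 1)) = z * (q : ℂ) ^ (2 * n) := by
  have hq : (q : ℂ) ≠ 0 := by exact_mod_cast hq0.ne'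
  have e : 2 * n = 2 + 2 * (n - 1) := by ring
  have e2 : (q : ℂ) ^ (2 : ℤ) = (q : ℂ) ^ 2 := by norm_cast
  rw [e, zpow_add₀ hq, e2]
  ring

lemma ut_norm {q : ℝ} (hq0 : 0 < q) (β : ℂ) (n : ℤ) : ‖ut q β n‖ = q ^ (2 * n ^ 2 + n) * ‖β‖ ^ n := by
  rw [ut, norm_mul, norm_mul, norm_neg_one_zpow, norm_zpow, norm_zpow, Complex.norm_real,
    Real.norm_of_nonneg hq0.le, one_mul]

lemma ut_summable {q : ℝ} (hq0 : 0 < q) (hq1 : q < 1) {β : ℂ} (hβ : β ≠ 0) : Summable (ut q β) := by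
  refine Summable.of_norm ?_
  simp_rw [ut_norm hq0]
  exact ut_summable_gen hq0 hq1 _ (norm_pos_iff.2 hβ)

lemma ut_adm {q : ℝ} (hq0 : 0 < q) (hq1 : q < 1) {β : ℂ} (hβ : β ≠ 0) : Adm q (ut q β) := by
  refine Summable.of_nonneg_of_le (fun n => ?_) (fun n => ?_)
    (ut_summable_gen hq0 hq1 _ (norm_pos_iff.2 hβ))
  · have : 0 < min 1 (q ^ (-2 * n)) := lt_min one_pos (by positivity)
    positivity
  · rw [← ut_norm hq0]
    exact mul_le_of_le_one_right (norm_nonneg _) (min_le_left _ _)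

lemma ut_zero {q : ℝ} {β : ℂ} : ut q β 0 = 1 := by simp [ut]

lemma mid_a {q : ℝ} (hq0 : 0 < q) (hq1 : q < 1) : ∃ a, q ^ 2 < a ∧ a < q ∧ 0 < a ∧ a < 1 := by
  obtain ⟨a, ha, ha1⟩ : ∃ a, q ^ 2 < a ∧ a < q := exists_between (by nlinarith)
  exact ⟨a, ha, ha1, by nlinarith, by linarith⟩

lemma mem_ann_of {q a : ℝ} (ha0 : 0 < a) (ha : a < q) {z : ℂ} (h1 : q ≤ ‖z‖)
    (h2 : ‖z‖ ≤ 1 / q) : z ∈ ann a (1 / a) :=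
  ⟨by linarith, lt_of_le_of_lt h2 (one_div_lt_one_div_of_lt ha0 ha)⟩

lemma ut_shift {q : ℝ} (hq0 : 0 < q) {β : ℂ} (hβ : β ≠ 0) (n : ℤ) :
    ut q β (n - 1) = - (q * β⁻¹ * (q : ℂ) ^ (-4 * n)) * ut q β n := by
  have hq : (q : ℂ) ≠ 0 := by exact_mod_cast hq0.ne'
  unfold ut
  have e : 2 * (n - 1) ^ 2 + (n - 1) = (2 * n ^ 2 + n) + (-4 * n) + 1 := by ring
  rw [e, zpow_add₀ hq, zpow_add₀ hq, zpow_one, zpow_sub_one₀ hβ, zpow_sub_one₀ (by norm_num : (-1 : ℂ) ≠ 0)]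
  norm_num
  ring

lemma shift_alg (q b x A B U : ℂ) (h : A * B = 1) (hden : 1 - x * A ≠ 0) :
    -(q * b * B ^ 2) * U / (1 - x * A)
      = -q * b * x ^ 2 * (U / (1 - x * A)) + -(q * b * B ^ 2) * U - q * b * x * (B * U) := by
  obtain ⟨V, rfl⟩ : ∃ V, U = V * (1 - x * A) := ⟨U / (1 - x * A), by field_simp⟩
  rw [mul_div_assoc, mul_div_assoc, div_self hden]
  linear_combination (-q * b * V * (x ^ 2 + x * B)) * h

/-- functional equation of T -/
lemma Tt_shift {q : ℝ} (hq0 : 0 < q) (hq1 : q < 1) {β : ℂ} (hβ : β ≠ 0) {x : ℂ} (hx : ‖x‖ = 1 / q) :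
    Tt q ((q : ℂ) ^ 2 * x) β
      = - q * β⁻¹ * x ^ 2 * Tt q x β + vth q β - q * β⁻¹ * x * vth q β⁻¹ := by
  have hq : (q : ℂ) ≠ 0 := by exact_mod_cast hq0.ne'
  obtain ⟨a, ha, haq, ha0, ha1⟩ := mid_a hq0 hq1
  have hqq : q ≤ 1 / q := by rw [le_div_iff₀ hq0]; nlinarith
  have hxm : x ∈ ann a (1 / a) := mem_ann_of ha0 haq (by rw [hx]; exact hqq) hx.le
  have hx1 : x ≠ 1 := by
    rintro rfl
    rw [norm_one, eq_div_iff hq0.ne'] at hx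
    linarith
  have hs1 := Lam_hasSum hq0 hq1 ha ha1 (ut_adm hq0 hq1 hβ) hxm
  rw [← Lam_eq hq0 hq1 ha ha1 (ut_adm hq0 hq1 hβ) hxm] at hs1
  have hs2 : HasSum (fun n : ℤ => ut q β (n - 1)) (vth q β) := by
    have := (Equiv.subRight (1 : ℤ)).hasSum_iff.2 (ut_summable hq0 hq1 hβ).hasSum
    exact this
  have hs3 : HasSum (fun n : ℤ => ut q β⁻¹ (-n)) (vth q β⁻¹) := by
    have := (Equiv.neg ℤ).hasSum_iff.2 (ut_summable hq0 hq1 (inv_ne_zero hβ)).hasSum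
    exact this
  have hs := ((hs1.mul_left (- q * β⁻¹ * x ^ 2)).add hs2).sub (hs3.mul_left (q * β⁻¹ * x))
  rw [← Tt] at hs
  rw [← hs.tsum_eq, Tt, Lam, ← (Equiv.subRight (1 : ℤ)).tsum_eq]
  refine tsum_congr fun n => ?_
  simp only [Equiv.subRight_apply]
  have hden : 1 - x * (q : ℂ) ^ (2 * n) ≠ 0 := by
    by_cases hn : n = 0
    · simp [hn, sub_ne_zero, hx1.symm]
    · exact den_ne hq0 hq1 ha ha1 hxm hn
  have e2 : ut q β⁻¹ (-n) = (q : ℂ) ^ (-2 * n) * ut q β n := by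
    unfold ut
    have : 2 * (-n) ^ 2 + -n = -2 * n + (2 * n ^ 2 + n) := by ring
    rw [this, zpow_add₀ hq, inv_zpow, zpow_neg β, inv_inv]
    have : (-1 : ℂ) ^ (-n) = (-1) ^ n := by rw [zpow_neg, ← inv_zpow]; norm_num
    rw [this]; ring
  have e3 : (q : ℂ) ^ (-4 * n) = ((q : ℂ) ^ (-2 * n)) ^ 2 := by
    rw [← zpow_natCast, ← zpow_mul]; congr 1; push_cast; ring
  have e4 : (q : ℂ) ^ (2 * n) * (q : ℂ) ^ (-2 * n) = 1 := by
    rw [← zpow_add₀ hq]; simp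
  rw [q_shift hq0, ut_shift hq0 hβ, e2, e3]
  exact shift_alg _ _ _ _ _ _ e4 hden

noncomputable def Comb (q : ℝ) (α : ℂ) : ℂ := vth q (α⁻¹ ^ 2) + α * vth q (α ^ 2)

noncomputable def Gf (q : ℝ) (α z : ℂ) : ℂ :=
  Mt q (ut q 1) z * Comb q α * (jt q (z * α) * jt q (z * α⁻¹))
    - vth q 1 * (Mt q (ut q (α⁻¹ ^ 2)) (z * α⁻¹) * (jt q z * jt q (z * α))
      + α * Mt q (ut q (α ^ 2)) (z * α) * (jt q z * jt q (z * α⁻¹)))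

lemma norm_q2z {q : ℝ} (hq0 : 0 < q) {z : ℂ} (hz : ‖z‖ = 1 / q) : ‖(q : ℂ) ^ 2 * z‖ = q := by
  rw [norm_mul, norm_pow, Complex.norm_real, Real.norm_of_nonneg hq0.le, hz]; field_simp

lemma Mt_shift {q : ℝ} (hq0 : 0 < q) (hq1 : q < 1) {β : ℂ} (hβ : β ≠ 0) {x : ℂ} (hx : ‖x‖ = 1 / q) :
    Mt q (ut q β) ((q : ℂ) ^ 2 * x) = - x⁻¹ * jt q x * (- q * β⁻¹ * x ^ 2 * Tt q x β + vth q β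
      - q * β⁻¹ * x * vth q β⁻¹) ∧ Mt q (ut q β) x = jt q x * Tt q x β := by
  obtain ⟨a, ha, haq, ha0, ha1⟩ := mid_a hq0 hq1
  have hqq : q < 1 / q := by rw [lt_div_iff₀ hq0]; nlinarith
  have hxm : x ∈ ann a (1 / a) := mem_ann_of ha0 haq (by rw [hx]; exact hqq.le) hx.le
  have hn := norm_q2z hq0 hx
  have hxm2 : (q : ℂ) ^ 2 * x ∈ ann a (1 / a) :=
    mem_ann_of ha0 haq (by rw [hn]) (by rw [hn]; exact hqq.le)
  have hx1 : x ≠ 1 := by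
    rintro rfl
    rw [norm_one, eq_div_iff hq0.ne'] at hx
    linarith
  have hx0 : x ≠ 0 := ann_ne_zero ha0.le hxm
  have hx2 : (q : ℂ) ^ 2 * x ≠ 1 := by
    intro h; rw [h, norm_one] at hn; linarith
  refine ⟨?_, Mt_eq hq0 hq1 ha ha1 (ut_adm hq0 hq1 hβ) ut_zero hxm hx1⟩
  rw [Mt_eq hq0 hq1 ha ha1 (ut_adm hq0 hq1 hβ) ut_zero hxm2 hx2, jt_shift hq0 hx0, ← Tt_shift hq0 hq1 hβ hx]
  rfl

lemma Gf_shift {q : ℝ} (hq0 : 0 < q) (hq1 : q < 1) {α : ℂ} (hα : ‖α‖ = 1) {z : ℂ} (hz : ‖z‖ = 1 / q) :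
    Gf q α ((q : ℂ) ^ 2 * z) = q / z * Gf q α z := by
  have hα0 : α ≠ 0 := by rintro rfl; simp at hα
  have hz0 : z ≠ 0 := by rintro rfl; simp at hz; exact hq0.ne hz
  obtain ⟨h1, h1'⟩ := Mt_shift hq0 hq1 one_ne_zero hz
  obtain ⟨h2, h2'⟩ := Mt_shift hq0 hq1 (β := α⁻¹ ^ 2) (by positivity) (x := z * α⁻¹)
    (by rw [norm_mul, hz, norm_inv, hα]; simp)
  obtain ⟨h3, h3'⟩ := Mt_shift hq0 hq1 (β := α ^ 2) (by positivity) (x := z * α)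
    (by rw [norm_mul, hz, hα]; simp)
  unfold Gf Comb
  rw [mul_assoc _ z, mul_assoc _ z, h1, h2, h3, h1', h2', h3', jt_shift hq0 hz0,
    jt_shift hq0 (mul_ne_zero hz0 hα0), jt_shift hq0 (mul_ne_zero hz0 (inv_ne_zero hα0))]
  rw [inv_one, inv_pow, inv_inv]
  field_simp
  ring

lemma Gf_diffOn {q : ℝ} (hq0 : 0 < q) (hq1 : q < 1) {a : ℝ} (ha : q ^ 2 < a) (ha1 : a < 1)
    {α : ℂ} (hα : ‖α‖ = 1) : DifferentiableOn ℂ (Gf q α) (ann a (1 / a)) := by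
  have hα0 : α ≠ 0 := by rintro rfl; simp at hα
  have ha0 : 0 < a := by nlinarith
  have hm1 : Set.MapsTo (fun z => z * α) (ann a (1 / a)) (ann a (1 / a)) := by
    intro z hz
    simpa [ann, hα] using hz
  have hm2 : Set.MapsTo (fun z => z * α⁻¹) (ann a (1 / a)) (ann a (1 / a)) := by
    intro z hz
    simpa [ann, hα] using hz
  have hd1 : DifferentiableOn ℂ (fun z => z * α) (ann a (1 / a)) := by fun_prop
  have hd2 : DifferentiableOn ℂ (fun z => z * α⁻¹) (ann a (1 / a)) := by fun_prop
  have hj := jt_diffOn hq0 hq1 ha0 (b := 1 / a) (by positivity)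
  have hj1 := hj.comp hd1 hm1
  have hj2 := hj.comp hd2 hm2
  have hM := Mt_diffOn hq0 hq1 ha ha1 (ut_adm hq0 hq1 one_ne_zero)
  have hM1 := (Mt_diffOn hq0 hq1 ha ha1 (ut_adm hq0 hq1 (pow_ne_zero 2 hα0))).comp hd1 hm1
  have hM2 := (Mt_diffOn hq0 hq1 ha ha1 (ut_adm hq0 hq1 (pow_ne_zero 2 (inv_ne_zero hα0)))).comp hd2 hm2
  exact ((hM.mul_const _).mul (hj1.mul hj2)).sub
    (((hM2.mul (hj.mul hj1)).add ((hM1.const_mul _).mul (hj.mul hj2))).const_mul _)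

lemma Gf_A {q : ℝ} (hq0 : 0 < q) (hq1 : q < 1) {α : ℂ} (hα : ‖α‖ = 1) :
    ∃ h : ℂ, (∀ z : ℂ, q ≤ ‖z‖ → ‖z‖ ≤ 1 / q → Gf q α z = h * (z * jt q (- q * z))) := by
  obtain ⟨a, ha, haq, ha0, ha1⟩ := mid_a hq0 hq1
  have hq : (q : ℂ) ≠ 0 := by exact_mod_cast hq0.ne'
  obtain ⟨h, hh⟩ := uniq hq0 hq1 ha0 haq (Gf_diffOn hq0 hq1 ha ha1 hα) hq
    (fun z hz => Gf_shift hq0 hq1 hα hz)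
  refine ⟨h / q, fun z h1 h2 => ?_⟩
  rw [hh z h1 h2, jt_neg_div hq0 (norm_pos_iff.1 (hq0.trans_le h1))]
  field_simp

lemma T3 {q : ℝ} (hq0 : 0 < q) (hq1 : q < 1) {x : ℂ} (hx0 : q ^ 2 < ‖x‖) (hx1 : ‖x‖ < 1) :
    Adm q (fun n => x ^ n) ∧ ∀ y : ℂ, q ≤ ‖y‖ → ‖y‖ ≤ 1 / q →
      Mt q (fun n => x ^ n) y * jt q x = - deriv (jt q) 1 * jt q (x * y) := by
  have hx : x ≠ 0 := by
    rintro rfl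
    rw [norm_zero] at hx0
    nlinarith
  obtain ⟨a, ha, haq, ha0, ha1⟩ := mid_a hq0 hq1
  have hadm : Adm q (fun n => x ^ n) := by
    refine Summable.of_nat_of_neg ?_ ?_
    · refine Summable.of_nonneg_of_le (fun n => by positivity) (fun n => ?_)
        (summable_geometric_of_lt_one (norm_nonneg x) hx1)
      rw [norm_zpow, zpow_natCast]
      exact mul_le_of_le_one_right (by positivity) (min_le_left _ _)
    · have hlt : q ^ 2 / ‖x‖ < 1 := by rw [div_lt_one (by positivity)]; exact hx0
      refine Summable.of_nonneg_of_le (fun n => by positivity) (fun n => ?_)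
        (summable_geometric_of_lt_one (by positivity) hlt)
      rw [norm_zpow, zpow_neg, zpow_natCast, div_pow, div_eq_inv_mul]
      refine mul_le_mul_of_nonneg_left ((min_le_right _ _).trans (le_of_eq ?_)) (by positivity)
      rw [← pow_mul, neg_mul_neg]
      norm_cast
  refine ⟨hadm, ?_⟩
  have hqq : q < 1 / q := by rw [lt_div_iff₀ hq0]; nlinarith
  obtain ⟨h, hh⟩ := uniq hq0 hq1 ha0 haq (Mt_diffOn hq0 hq1 ha ha1 hadm) (c := - x⁻¹) (by simpa using hx)
    (fun z hz => by
      have hxm : z ∈ ann a (1 / a) := mem_ann_of ha0 haq (by rw [hz]; exact hqq.le) hz.le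
      have hn := norm_q2z hq0 hz
      have hxm2 : (q : ℂ) ^ 2 * z ∈ ann a (1 / a) :=
        mem_ann_of ha0 haq (by rw [hn]) (by rw [hn]; exact hqq.le)
      have hx1 : z ≠ 1 := by
        rintro rfl
        rw [norm_one, eq_div_iff hq0.ne'] at hz
        linarith
      have hz0 : z ≠ 0 := ann_ne_zero ha0.le hxm
      have hx2 : (q : ℂ) ^ 2 * z ≠ 1 := by
        intro h; rw [h, norm_one] at hn; linarith
      have hq : (q : ℂ) ≠ 0 := by exact_mod_cast hq0.ne'
      rw [Mt_eq hq0 hq1 ha ha1 hadm (by simp) hxm hx1, Mt_eq hq0 hq1 ha ha1 hadm (by simp) hxm2 hx2,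
        jt_shift hq0 hz0]
      have : Lam q (fun n => x ^ n) ((q : ℂ) ^ 2 * z) = x⁻¹ * Lam q (fun n => x ^ n) z := by
        unfold Lam
        rw [← (Equiv.subRight (1 : ℤ)).tsum_eq, ← tsum_mul_left]
        refine tsum_congr fun n => ?_
        simp only [Equiv.subRight_apply]
        rw [q_shift hq0, zpow_sub_one₀ hx]; ring
      rw [this]
      field_simp)
  have h1 := hh 1 (by simpa using hq1.le) (by rw [norm_one, le_div_iff₀ hq0]; linarith)
  rw [Mt_one] at h1
  intro y hy1 hy2
  rw [hh y hy1 hy2, h1]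
  have e1 : -(1 : ℂ) / (-x⁻¹) = x := by field_simp
  have e2 : -y / (-x⁻¹) = x * y := by field_simp
  rw [e1, e2]
  ring
end part_D

section part_E
open Filter Topology
lemma lim_gen (e : ℤ → ℤ) (w : ℤ → ℂ) (s : Finset ℤ) (hs : ∀ n ∈ s, e n = 0)
    (hs' : ∀ n, n ∉ s → 0 < e n) (hb : Summable fun n : ℤ => (1 / 2 : ℝ) ^ (e n) * ‖w n‖) :
    Tendsto (fun q : ℝ => ∑' n : ℤ, (q : ℂ) ^ (e n) * w n) (𝓝[>] 0) (𝓝 (∑ n ∈ s, w n)) := by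
  have h1 : ∑ n ∈ s, w n = ∑' n : ℤ, (if n ∈ s then w n else 0) := by
    rw [tsum_eq_sum (s := s) (fun n hn => by simp [hn])]
    exact Finset.sum_congr rfl fun n hn => by simp [hn]
  rw [h1]
  have he : ∀ n, 0 ≤ e n := fun n => by
    by_cases h : n ∈ s
    · rw [hs n h]
    · exact (hs' n h).le
  refine tendsto_tsum_of_dominated_convergence hb (fun n => ?_) ?_
  · by_cases h : n ∈ s
    · simp [h, hs n h]
    · obtain ⟨k, hk⟩ : ∃ k : ℕ, e n = k := ⟨(e n).toNat, by have := he n; omega⟩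
      have hk0 : k ≠ 0 := by have := hs' n h; omega
      simp only [h, if_false, hk, zpow_natCast]
      have : Tendsto (fun q : ℝ => (q : ℂ) ^ k * w n) (𝓝 0) (𝓝 (((0 : ℝ) : ℂ) ^ k * w n)) :=
        Continuous.tendsto (by fun_prop) 0
      rw [Complex.ofReal_zero, zero_pow hk0, zero_mul] at this
      exact this.mono_left nhdsWithin_le_nhds
  · have h2 : ∀ᶠ q : ℝ in 𝓝[>] 0, q ∈ Set.Ioo (0 : ℝ) (1 / 2) :=
      Ioo_mem_nhdsGT (by norm_num)
    filter_upwards [h2] with q hq n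
    rw [norm_mul, norm_zpow, Complex.norm_real, Real.norm_of_nonneg hq.1.le]
    exact mul_le_mul_of_nonneg_right (zpow_le_zpow_left₀ (he n) hq.1.le hq.2.le) (norm_nonneg _)

lemma ev_jt_ne {y : ℂ} (hy : ‖y‖ = 1) (hy1 : y ≠ 1) : ∀ᶠ q : ℝ in 𝓝[>] 0, jt q y ≠ 0 := by
  have h := lim_gen (fun n => n * (n - 1)) (fun n => (-1) ^ n * y ^ n) {0, 1} (by simp)
    (by
      intro n hn
      simp at hn
      rcases lt_or_gt_of_ne hn.1 with h | h
      · nlinarith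
      · have : 1 < n := by omega
        nlinarith)
    ((gauss_summable (Q := 1 / 2) (by norm_num) (by norm_num) (one_pos)).congr fun n => by simp [hy])
  have h2 : ∑ n ∈ ({0, 1} : Finset ℤ), (-1 : ℂ) ^ n * y ^ n = 1 - y := by simp; ring
  rw [h2] at h
  have h3 := h.eventually_ne (sub_ne_zero.2 hy1.symm)
  filter_upwards [h3] with q hq
  convert hq using 1
  exact tsum_congr fun n => by ring

lemma ev_jt_neg_ne {y : ℂ} (hy : ‖y‖ = 1) : ∀ᶠ q : ℝ in 𝓝[>] 0, jt q (-q * y) ≠ 0 := by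
  have h := lim_gen (fun n => n ^ 2) (fun n => y ^ n) {0} (by simp)
    (by
      intro n hn
      simp at hn
      positivity)
    ((gauss_summable (Q := 1 / 2) (R := 1 / 2) (by norm_num) (by norm_num) (by norm_num)).congr fun n => by
      rw [norm_zpow, hy, one_zpow, mul_one, ← zpow_add₀ (by norm_num)]; congr 1; ring)
  simp only [Finset.sum_singleton, zpow_zero] at h
  have h3 := h.eventually_ne one_ne_zero
  filter_upwards [h3, self_mem_nhdsWithin] with q hq hq0
  convert hq using 1
  have hq' : (q : ℂ) ≠ 0 := by exact_mod_cast (ne_of_gt hq0)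
  refine tsum_congr fun n => ?_
  have e : n ^ 2 = n * (n - 1) + n := by ring
  have e2 : (-1 : ℂ) ^ n * (-q * y) ^ n = (q : ℂ) ^ n * y ^ n := by
    rw [← mul_zpow, ← mul_zpow]; congr 1; ring
  rw [e, zpow_add₀ hq']
  linear_combination (q : ℂ) ^ (n * (n - 1)) * e2

lemma ev_deriv_ne : ∀ᶠ q : ℝ in 𝓝[>] 0, deriv (jt q) 1 ≠ 0 := by
  have hn1 : ∀ n : ℤ, |(n : ℝ)| ≤ (1 / 2) ^ n + 2 ^ n := by
    intro n
    have hk : ∀ k : ℕ, (k : ℝ) ≤ 2 ^ k := fun k => by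
      exact_mod_cast Nat.lt_two_pow_self.le
    have hp : (0 : ℝ) < (1 / 2) ^ n := by positivity
    have hp' : (0 : ℝ) < 2 ^ n := by positivity
    rcases le_total 0 n with h | h
    · obtain ⟨k, rfl⟩ := Int.eq_ofNat_of_zero_le h
      have := hk k
      simp only [zpow_natCast, Int.cast_natCast, Nat.abs_cast] at *
      linarith
    · obtain ⟨k, rfl⟩ : ∃ k : ℕ, n = -k := ⟨n.natAbs, by omega⟩
      have := hk k
      have e : (1 / 2 : ℝ) ^ (-(k : ℤ)) = 2 ^ k := by simp
      rw [e] at *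
      simp only [Int.cast_neg, Int.cast_natCast, abs_neg, Nat.abs_cast] at *
      linarith
  have h := lim_gen (fun n => n * (n - 1)) (fun n => (-1) ^ n * n) {0, 1} (by simp)
    (by
      intro n hn
      simp at hn
      rcases lt_or_gt_of_ne hn.1 with h | h
      · nlinarith
      · have : 1 < n := by omega
        nlinarith)
    (by
      refine Summable.of_nonneg_of_le (fun n => by positivity) (fun n => ?_)
        ((gauss_summable (Q := 1 / 2) (R := 1 / 2) (by norm_num) (by norm_num) (by norm_num)).add
        (gauss_summable (Q := 1 / 2) (R := 2) (by norm_num) (by norm_num) (by norm_num)))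
      rw [← mul_add, norm_mul, norm_neg_one_zpow, one_mul, Complex.norm_intCast]
      exact mul_le_mul_of_nonneg_left (hn1 n) (by positivity))
  have h2 : ∑ n ∈ ({0, 1} : Finset ℤ), (-1 : ℂ) ^ n * n = -1 := by simp
  rw [h2] at h
  have h3 := h.eventually_ne (show (-1 : ℂ) ≠ 0 by norm_num)
  filter_upwards [h3, Ioo_mem_nhdsGT (show (0 : ℝ) < 1 by norm_num)] with q hq hq0
  rw [← (jt_deriv_hasSum hq0.1 hq0.2).tsum_eq]
  convert hq using 1
  exact tsum_congr fun n => by ring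

lemma jt_deriv_contAt {q : ℝ} (hq0 : 0 < q) (hq1 : q < 1) {z : ℂ} (hz : z ≠ 0) :
    ContinuousAt (deriv (jt q)) z := by
  have h : 0 < ‖z‖ := norm_pos_iff.2 hz
  have := ((jt_diffOn hq0 hq1 (a := ‖z‖ / 2) (b := 2 * ‖z‖) (by positivity) (by positivity)).deriv
    (isOpen_ann _ _)).continuousOn
  exact this.continuousAt ((isOpen_ann _ _).mem_nhds ⟨by linarith, by linarith⟩)

lemma rho_in {q : ℝ} (hq0 : 0 < q) (hq1 : q < 1) (hk : deriv (jt q) 1 ≠ 0) {x : ℂ}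
    (hx0 : q ^ 2 < ‖x‖) (hx1 : ‖x‖ < 1) :
    x * deriv (jt q) x = - LamS q (fun n => x ^ n) 1 * jt q x := by
  obtain ⟨hadm, h3⟩ := T3 hq0 hq1 hx0 hx1
  have hx : x ≠ 0 := by
    rintro rfl
    rw [norm_zero] at hx0
    nlinarith
  obtain ⟨a, ha, haq, ha0, ha1⟩ := mid_a hq0 hq1
  have h1 := (Mt_hasDerivAt_one hq0 hq1 hadm).mul_const (jt q x)
  have h2 : HasDerivAt (fun y => - deriv (jt q) 1 * jt q (x * y)) (- deriv (jt q) 1 * (deriv (jt q) x * x)) 1 := by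
    have hj : HasDerivAt (jt q) (deriv (jt q) x) (x * 1) := by
      rw [mul_one]; exact (jt_diffAt hq0 hq1 hx).hasDerivAt
    have hm : HasDerivAt (fun y : ℂ => x * y) x 1 := by simpa using (hasDerivAt_id (1 : ℂ)).const_mul x
    exact (hj.comp 1 hm).const_mul _
  have hev : (fun y => Mt q (fun n => x ^ n) y * jt q x) =ᶠ[𝓝 1] fun y => - deriv (jt q) 1 * jt q (x * y) := by
    filter_upwards [(isOpen_ann q (1 / q)).mem_nhds (one_mem_ann hq0 hq1)] with y hy
    exact h3 y hy.1.le hy.2.le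
  have h4 := (h1.congr_of_eventuallyEq hev.symm).unique h2
  have h5 : deriv (jt q) 1 * (x * deriv (jt q) x) = deriv (jt q) 1 * (- LamS q (fun n => x ^ n) 1 * jt q x) := by
    linear_combination h4
  exact mul_left_cancel₀ hk h5

noncomputable def Lmb (q : ℝ) (x : ℂ) : ℂ :=
  ∑' n : ℕ, (x ^ (n + 1) - x⁻¹ ^ (n + 1)) * (((q : ℂ) ^ 2) ^ (n + 1) / (1 - ((q : ℂ) ^ 2) ^ (n + 1)))

lemma q2_den {q : ℝ} (hq0 : 0 < q) (hq1 : q < 1) (n : ℕ) : (1 - ((q : ℂ) ^ 2) ^ (n + 1)) ≠ 0 := by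
  rw [sub_ne_zero]
  intro h
  have h2 : ‖((q : ℂ) ^ 2) ^ (n + 1)‖ < 1 := by
    rw [norm_pow, norm_pow, Complex.norm_real, Real.norm_of_nonneg hq0.le]
    exact pow_lt_one₀ (by positivity) (by nlinarith) (by omega)
  rw [← h, norm_one] at h2
  exact lt_irrefl _ h2

lemma Lmb_bound {q : ℝ} (hq0 : 0 < q) (hq1 : q < 1) {x : ℂ} (h1 : q ≤ ‖x‖) (h2 : ‖x‖ ≤ 1 / q) (n : ℕ) :
    ‖(x ^ (n + 1) - x⁻¹ ^ (n + 1)) * (((q : ℂ) ^ 2) ^ (n + 1) / (1 - ((q : ℂ) ^ 2) ^ (n + 1)))‖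
      ≤ 2 * (1 - q ^ 2)⁻¹ * q * q ^ n := by
  have hqq : q ^ 2 < 1 := by nlinarith
  have hnq : ‖(q : ℂ)‖ = q := by rw [Complex.norm_real, Real.norm_of_nonneg hq0.le]
  have hx : 0 < ‖x‖ := hq0.trans_le h1
  have hinv : ‖x‖⁻¹ ≤ 1 / q := by rw [one_div]; exact inv_anti₀ hq0 h1
  have hA : ‖x ^ (n + 1) - x⁻¹ ^ (n + 1)‖ ≤ 2 * (1 / q) ^ (n + 1) := by
    refine (norm_sub_le _ _).trans ?_
    rw [norm_pow, norm_pow, norm_inv]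
    have := pow_le_pow_left₀ hx.le h2 (n + 1)
    have := pow_le_pow_left₀ (by positivity) hinv (n + 1)
    linarith
  have hB : 1 - q ^ 2 ≤ ‖1 - ((q : ℂ) ^ 2) ^ (n + 1)‖ := by
    have h3 := norm_sub_norm_le 1 (((q : ℂ) ^ 2) ^ (n + 1))
    rw [norm_one, norm_pow, norm_pow, hnq] at h3
    have h4 : (q ^ 2) ^ (n + 1) ≤ q ^ 2 := pow_le_of_le_one (by positivity) hqq.le (by omega)
    linarith
  have hC : ‖((q : ℂ) ^ 2) ^ (n + 1) / (1 - ((q : ℂ) ^ 2) ^ (n + 1))‖ ≤ (q ^ 2) ^ (n + 1) * (1 - q ^ 2)⁻¹ := by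
    rw [norm_div, norm_pow, norm_pow, hnq, div_eq_mul_inv]
    exact mul_le_mul_of_nonneg_left (inv_anti₀ (by linarith) hB) (by positivity)
  rw [norm_mul]
  refine (mul_le_mul hA hC (norm_nonneg _) (by positivity)).trans (le_of_eq ?_)
  have : (1 / q) ^ (n + 1) * (q ^ 2) ^ (n + 1) = q * q ^ n := by
    rw [← mul_pow, pow_succ]; field_simp
  linear_combination 2 * (1 - q ^ 2)⁻¹ * this

lemma Lmb_summable {q : ℝ} (hq0 : 0 < q) (hq1 : q < 1) {x : ℂ} (h1 : q ≤ ‖x‖) (h2 : ‖x‖ ≤ 1 / q) :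
    Summable fun n : ℕ => (x ^ (n + 1) - x⁻¹ ^ (n + 1)) * (((q : ℂ) ^ 2) ^ (n + 1) / (1 - ((q : ℂ) ^ 2) ^ (n + 1))) :=
  Summable.of_norm_bounded ((summable_geometric_of_lt_one hq0.le hq1).mul_left _) (Lmb_bound hq0 hq1 h1 h2)

lemma Lmb_contOn {q : ℝ} (hq0 : 0 < q) (hq1 : q < 1) : ContinuousOn (Lmb q) (ann q (1 / q)) := by
  refine continuousOn_tsum (u := fun n : ℕ => 2 * (1 - q ^ 2)⁻¹ * q * q ^ n) (fun n => ?_)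
    ((summable_geometric_of_lt_one hq0.le hq1).mul_left _)
    (fun n x hx => Lmb_bound hq0 hq1 hx.1.le hx.2.le n)
  refine ContinuousOn.mul (ContinuousOn.sub (by fun_prop) ?_) continuousOn_const
  exact ContinuousOn.pow (continuousOn_id.inv₀ fun x hx => ann_ne_zero hq0.le hx) _

lemma hasSum_congr' {ι : Type*} {f g : ι → ℂ} {a : ℂ} (h : ∀ i, f i = g i) : HasSum f a ↔ HasSum g a := by
  rw [funext h]

lemma LamS_nat {q : ℝ} (hq0 : 0 < q) (hq1 : q < 1) {a : ℝ} (ha : q ^ 2 < a) (ha1 : a < 1)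
    {u : ℤ → ℂ} (hu : Adm q u) {z : ℂ} (hz : z ∈ ann a (1 / a)) :
    HasSum (fun n : ℕ => u ((n + 1 : ℕ) : ℤ) / (1 - z * ((q : ℂ) ^ 2) ^ (n + 1))
      - u (-((n + 1 : ℕ) : ℤ)) * (z⁻¹ * ((q : ℂ) ^ 2) ^ (n + 1) / (1 - z⁻¹ * ((q : ℂ) ^ 2) ^ (n + 1))))
      (LamS q u z) := by
  have hq : (q : ℂ) ≠ 0 := by exact_mod_cast hq0.ne'
  have ha0 : 0 < a := by nlinarith
  have hz0 : z ≠ 0 := ann_ne_zero ha0.le hz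
  have h := (LamS_summable hq0 hq1 ha ha1 hu hz).hasSum.nat_add_neg
  rw [if_pos rfl, add_zero] at h
  rw [← hasSum_nat_add_iff' 1] at h
  simp only [Finset.sum_range_one, Nat.cast_zero, neg_zero, if_true, add_zero, sub_zero] at h
  refine (hasSum_congr' fun n => ?_).2 h
  · have h1 : ((n + 1 : ℕ) : ℤ) ≠ 0 := by omega
    have h2 : -((n + 1 : ℕ) : ℤ) ≠ 0 := by omega
    rw [if_neg h1, if_neg h2]
    have e1 : (q : ℂ) ^ (2 * ((n + 1 : ℕ) : ℤ)) = ((q : ℂ) ^ 2) ^ (n + 1) := by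
      rw [zpow_mul, zpow_natCast]; norm_cast
    have e2 : (q : ℂ) ^ (2 * -((n + 1 : ℕ) : ℤ)) = (((q : ℂ) ^ 2) ^ (n + 1))⁻¹ := by
      rw [mul_neg, zpow_neg, e1]
    have h3 := den_ne hq0 hq1 ha ha1 hz h2
    rw [e2] at h3
    rw [e1, e2]
    have h4 : ((q : ℂ) ^ 2) ^ (n + 1) ≠ 0 := by positivity
    generalize ((q : ℂ) ^ 2) ^ (n + 1) = A at *
    have h5 : A - z ≠ 0 := by
      intro h; apply h3; field_simp; rw [h, mul_zero]
    have h6 : 1 - z * A⁻¹ = (A - z) / A := by field_simp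
    have h7 : 1 - z⁻¹ * A = -((A - z) / z) := by field_simp; ring
    rw [sub_eq_add_neg, h6, h7]
    congr 1
    field_simp

lemma LamS_pow_one {q : ℝ} (hq0 : 0 < q) (hq1 : q < 1) {x : ℂ} (h1 : q ≤ ‖x‖) (h2 : ‖x‖ < 1) :
    LamS q (fun n => x ^ n) 1 = x / (1 - x) + Lmb q x := by
  have hx : x ≠ 0 := norm_pos_iff.1 (hq0.trans_le h1)
  obtain ⟨hadm, -⟩ := T3 hq0 hq1 (x := x) (by nlinarith) h2
  obtain ⟨a, ha, haq, ha0, ha1⟩ := mid_a hq0 hq1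
  have hs := LamS_nat hq0 hq1 ha ha1 hadm (one_mem_ann ha0 ha1)
  have hqq : 1 ≤ 1 / q := by rw [le_div_iff₀ hq0]; linarith
  have hl := (Lmb_summable hq0 hq1 h1 (h2.le.trans hqq)).hasSum
  have hg : HasSum (fun n : ℕ => x ^ (n + 1)) (x / (1 - x)) := by
    have := (hasSum_geometric_of_norm_lt_one h2).mul_left x
    rw [← div_eq_mul_inv] at this
    refine (hasSum_congr' fun n => ?_).2 this
    rw [pow_succ]; ring
  refine hs.unique ?_
  refine (hasSum_congr' fun n => ?_).2 (hg.add hl)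
  · have h3 := q2_den hq0 hq1 n
    rw [inv_one, one_mul, zpow_neg, zpow_natCast, inv_pow]
    generalize ((q : ℂ) ^ 2) ^ (n + 1) = A at *
    field_simp
    ring

lemma rho_on {q : ℝ} (hq0 : 0 < q) (hq1 : q < 1) (hk : deriv (jt q) 1 ≠ 0) {y : ℂ}
    (hy : ‖y‖ = 1) (hy1 : y ≠ 1) :
    y * deriv (jt q) y = - (y / (1 - y) + Lmb q y) * jt q y := by
  have hy0 : y ≠ 0 := by rintro rfl; simp at hy
  have hmem : y ∈ ann q (1 / q) := by
    refine ⟨by rw [hy]; exact hq1, ?_⟩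
    rw [hy, lt_div_iff₀ hq0]; linarith
  have hm : Tendsto (fun r : ℝ => (r : ℂ) * y) (𝓝[<] 1) (𝓝 y) := by
    have : Tendsto (fun r : ℝ => (r : ℂ) * y) (𝓝 1) (𝓝 (((1 : ℝ) : ℂ) * y)) :=
      Continuous.tendsto (by fun_prop) 1
    rw [Complex.ofReal_one, one_mul] at this
    exact this.mono_left nhdsWithin_le_nhds
  have c1 : ContinuousAt (fun x => x * deriv (jt q) x) y :=
    continuousAt_id.mul (jt_deriv_contAt hq0 hq1 hy0)
  have c2 : ContinuousAt (fun x => - (x / (1 - x) + Lmb q x) * jt q x) y := by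
    refine ContinuousAt.mul (ContinuousAt.neg (ContinuousAt.add ?_ ?_)) (jt_diffAt hq0 hq1 hy0).continuousAt
    · exact continuousAt_id.div (by fun_prop) (sub_ne_zero.2 hy1.symm)
    · exact (Lmb_contOn hq0 hq1).continuousAt ((isOpen_ann _ _).mem_nhds hmem)
  refine tendsto_nhds_unique (c1.tendsto.comp hm) ((c2.tendsto.comp hm).congr' ?_)
  have hev : ∀ᶠ r : ℝ in 𝓝[<] 1, r ∈ Set.Ioo q 1 := Ioo_mem_nhdsLT hq1
  filter_upwards [hev] with r hr
  have hn : ‖(r : ℂ) * y‖ = r := by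
    rw [norm_mul, hy, mul_one, Complex.norm_real, Real.norm_of_nonneg (by linarith [hr.1])]
  have h1 := rho_in hq0 hq1 hk (x := (r : ℂ) * y) (by rw [hn]; nlinarith [hr.1]) (by rw [hn]; exact hr.2)
  rw [LamS_pow_one hq0 hq1 (by rw [hn]; exact hr.1.le) (by rw [hn]; exact hr.2)] at h1
  simp only [Function.comp]
  exact h1.symm
end part_E

section part_F
open Filter Topology
lemma unit_bd {q : ℝ} (hq0 : 0 < q) (hq1 : q < 1) {z : ℂ} (hz : ‖z‖ = 1) : q ≤ ‖z‖ ∧ ‖z‖ ≤ 1 / q := by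
  rw [hz]; exact ⟨hq1.le, by rw [le_div_iff₀ hq0]; linarith⟩

lemma unit_Mt {q : ℝ} (hq0 : 0 < q) (hq1 : q < 1) {u : ℤ → ℂ} (hu : Adm q u) (h0 : u 0 = 1) {z : ℂ}
    (hz : ‖z‖ = 1) (h1 : z ≠ 1) : Mt q u z = jt q z * Lam q u z := by
  obtain ⟨a, ha, haq, ha0, ha1⟩ := mid_a hq0 hq1
  exact Mt_eq hq0 hq1 ha ha1 hu h0 (mem_ann_of ha0 haq (unit_bd hq0 hq1 hz).1 (unit_bd hq0 hq1 hz).2) h1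

lemma Tt_Mt {q : ℝ} (hq0 : 0 < q) (hq1 : q < 1) {β : ℂ} (hβ : β ≠ 0) {z : ℂ}
    (hz : ‖z‖ = 1) (h1 : z ≠ 1) : Mt q (ut q β) z = jt q z * Tt q z β :=
  unit_Mt hq0 hq1 (ut_adm hq0 hq1 hβ) ut_zero hz h1

section zeta
variable {ζ : ℂ}

lemma zeta_norm (h5 : ζ ^ 5 = 1) : ‖ζ‖ = 1 := Complex.norm_eq_one_of_pow_eq_one h5 (by norm_num)
lemma zeta_ne0 (h5 : ζ ^ 5 = 1) : ζ ≠ 0 := by rintro rfl; norm_num at h5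
lemma zeta_pow_ne {k : ℕ} (hk : k.Coprime 5) (h5 : ζ ^ 5 = 1) (h1 : ζ ≠ 1) : ζ ^ k ≠ 1 := by
  intro h
  have := (pow_gcd_eq_one (a := ζ)).2 ⟨h, h5⟩
  rw [hk, pow_one] at this
  exact h1 this

lemma ident1 {q : ℝ} (hq0 : 0 < q) (hq1 : q < 1) (h5 : ζ ^ 5 = 1) (h1 : ζ ≠ 1)
    (hj1 : jt q ζ ≠ 0) (hj2 : jt q (ζ ^ 2) ≠ 0) (hn : jt q (-q * ζ ^ 2) ≠ 0) :
    Tt q ζ 1 * Comb q (ζ ^ 2) = vth q 1 * (Tt q (ζ ^ 4) ζ + ζ ^ 2 * Tt q (ζ ^ 3) (ζ ^ 4)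
      - Lam q (fun n => (-q * ζ ^ 2) ^ n) (ζ ^ 4)) := by
  have hz0 := zeta_ne0 h5
  have hno := zeta_norm h5
  have hnp : ∀ k : ℕ, ‖ζ ^ k‖ = 1 := fun k => by rw [norm_pow, hno, one_pow]
  have e3 : (ζ ^ 2)⁻¹ = ζ ^ 3 := inv_eq_of_mul_eq_one_right (by linear_combination h5)
  have e4 : ζ⁻¹ = ζ ^ 4 := inv_eq_of_mul_eq_one_right (by linear_combination h5)
  have J4 : jt q (ζ ^ 4) = - ζ ^ 4 * jt q ζ := by rw [← e4, jt_inv hz0]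
  have J3 : jt q (ζ ^ 3) = - ζ ^ 3 * jt q (ζ ^ 2) := by rw [← e3, jt_inv (by positivity)]
  have n3 := zeta_pow_ne (k := 3) (by norm_num) h5 h1
  have n4 := zeta_pow_ne (k := 4) (by norm_num) h5 h1
  obtain ⟨h, hh⟩ := Gf_A hq0 hq1 (α := ζ ^ 2) (hnp 2)
  have g1 := hh ζ (unit_bd hq0 hq1 hno).1 (unit_bd hq0 hq1 hno).2
  have g2 := hh (ζ ^ 2) (unit_bd hq0 hq1 (hnp 2)).1 (unit_bd hq0 hq1 (hnp 2)).2
  have a1 : ζ * ζ ^ 2 = ζ ^ 3 := by ring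
  have a2 : ζ * ζ ^ 3 = ζ ^ 4 := by ring
  have a3 : ζ ^ 2 * ζ ^ 2 = ζ ^ 4 := by ring
  have a4 : ζ ^ 2 * ζ ^ 3 = 1 := by linear_combination h5
  have b1 : (ζ ^ 3) ^ 2 = ζ := by linear_combination ζ * h5
  have b2 : (ζ ^ 2) ^ 2 = ζ ^ 4 := by ring
  rw [Gf, e3, a1, a2, b1, b2, Tt_Mt hq0 hq1 one_ne_zero hno h1, Tt_Mt hq0 hq1 hz0 (hnp 4) n4,
    Tt_Mt hq0 hq1 (pow_ne_zero _ hz0) (hnp 3) n3] at g1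
  rw [Gf, e3, a3, a4, b1, b2, jt_one, Mt_one] at g2
  have hxn : ‖(-q * ζ ^ 2 : ℂ)‖ = q := by
    rw [norm_mul, hnp, norm_neg, Complex.norm_real, Real.norm_of_nonneg hq0.le, mul_one]
  obtain ⟨ad, t3⟩ := T3 hq0 hq1 (x := -q * ζ ^ 2) (by rw [hxn]; nlinarith) (by rw [hxn]; exact hq1)
  have t3 := t3 (ζ ^ 4) (unit_bd hq0 hq1 (hnp 4)).1 (unit_bd hq0 hq1 (hnp 4)).2
  have a5 : -(q:ℂ) * ζ ^ 2 * ζ ^ 4 = -q * ζ := by linear_combination -(q:ℂ) * ζ * h5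
  rw [unit_Mt hq0 hq1 ad (by simp) (hnp 4) n4, a5] at t3
  rw [J3, J4] at g1
  rw [J4] at g2 t3
  have key : ζ ^ 5 * ζ ^ 4 * (jt q ζ ^ 2 * jt q (ζ ^ 2) * jt q (-q * ζ ^ 2)) * (Tt q ζ 1 * Comb q (ζ ^ 2)) =
    ζ ^ 5 * ζ ^ 4 * (jt q ζ ^ 2 * jt q (ζ ^ 2) * jt q (-q * ζ ^ 2)) * (vth q 1 * (Tt q (ζ ^ 4) ζ + ζ ^ 2 * Tt q (ζ ^ 3) (ζ ^ 4)
      - Lam q (fun n => (-q * ζ ^ 2) ^ n) (ζ ^ 4))) := by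
    linear_combination ζ ^ 2 * jt q (-q * ζ ^ 2) * g1 - ζ * jt q (-q * ζ) * g2
      - ζ ^ 5 * vth q 1 * jt q (ζ ^ 2) * jt q ζ * t3
  exact mul_left_cancel₀ (by positivity) key

lemma ident2 {q : ℝ} (hq0 : 0 < q) (hq1 : q < 1) (h5 : ζ ^ 5 = 1) (h1 : ζ ≠ 1)
    (hj1 : jt q ζ ≠ 0) (hj2 : jt q (ζ ^ 2) ≠ 0) (hk : deriv (jt q) 1 ≠ 0) :
    Tt q ζ 1 * Comb q (ζ ^ 4) = vth q 1 * (Tt q (ζ ^ 2) (ζ ^ 2) + ζ ^ 4 * (LamS q (ut q (ζ ^ 3)) 1 + 1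
      + (ζ / (1 - ζ) + Lmb q ζ) + (ζ ^ 2 / (1 - ζ ^ 2) + Lmb q (ζ ^ 2))
      - LamS q (fun n => (-q * ζ) ^ n) 1)) := by
  have hz0 := zeta_ne0 h5
  have hno := zeta_norm h5
  have hq : (q : ℂ) ≠ 0 := by exact_mod_cast hq0.ne'
  have hnp : ∀ k : ℕ, ‖ζ ^ k‖ = 1 := fun k => by rw [norm_pow, hno, one_pow]
  have e4 : (ζ ^ 4)⁻¹ = ζ := inv_eq_of_mul_eq_one_right (by linear_combination h5)
  have n2 := zeta_pow_ne (k := 2) (by norm_num) h5 h1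
  obtain ⟨h, hh⟩ := Gf_A hq0 hq1 (α := ζ ^ 4) (hnp 4)
  have g1 := hh ζ (unit_bd hq0 hq1 hno).1 (unit_bd hq0 hq1 hno).2
  have a1 : ζ * ζ ^ 4 = 1 := by linear_combination h5
  have a2 : ζ * ζ = ζ ^ 2 := by ring
  have b1 : (ζ ^ 4) ^ 2 = ζ ^ 3 := by linear_combination ζ ^ 3 * h5
  rw [Gf, e4, a1, a2, b1, Mt_one, jt_one] at g1
  obtain ⟨a, ha, haq, ha0, ha1⟩ := mid_a hq0 hq1
  have hmem : ∀ k : ℕ, ann a (1 / a) ∈ 𝓝 (ζ ^ k) := fun k =>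
    (isOpen_ann _ _).mem_nhds (mem_ann_of ha0 haq (unit_bd hq0 hq1 (hnp k)).1 (unit_bd hq0 hq1 (hnp k)).2)
  have dM1 := ((Mt_diffOn hq0 hq1 ha ha1 (ut_adm hq0 hq1 one_ne_zero)).differentiableAt
    (by simpa using hmem 1 : ann a (1 / a) ∈ 𝓝 ζ)).hasDerivAt
  have dM2 := ((Mt_diffOn hq0 hq1 ha ha1 (ut_adm hq0 hq1 (pow_ne_zero 2 hz0))).differentiableAt (hmem 2)).hasDerivAt
  have dM3 := Mt_hasDerivAt_one hq0 hq1 (ut_adm hq0 hq1 (pow_ne_zero 3 hz0))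
  have dj1 := (jt_diffAt hq0 hq1 hz0).hasDerivAt
  have dj2 := (jt_diffAt hq0 hq1 (pow_ne_zero 2 hz0)).hasDerivAt
  have dj0 := (jt_diffAt hq0 hq1 one_ne_zero).hasDerivAt
  have dx := (jt_diffAt hq0 hq1 (mul_ne_zero (neg_ne_zero.2 hq) hz0)).hasDerivAt
  have l1 : HasDerivAt (fun z : ℂ => z * ζ) ζ ζ := by simpa using (hasDerivAt_id ζ).mul_const ζ
  have l4 : HasDerivAt (fun z : ℂ => z * ζ ^ 4) (ζ ^ 4) ζ := by simpa using (hasDerivAt_id ζ).mul_const (ζ ^ 4)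
  have lq : HasDerivAt (fun z : ℂ => -(q:ℂ) * z) (-(q:ℂ)) ζ := by simpa using (hasDerivAt_id ζ).const_mul (-(q:ℂ))
  have cM2 := HasDerivAt.comp ζ (by rw [a2]; exact dM2) l1
  have cM3 := HasDerivAt.comp ζ (by rw [a1]; exact dM3) l4
  have cj2 := HasDerivAt.comp ζ (by rw [a2]; exact dj2) l1
  have cj0 := HasDerivAt.comp ζ (by rw [a1]; exact dj0) l4
  have cx := HasDerivAt.comp ζ dx lq
  have hG := ((dM1.mul_const (Comb q (ζ ^ 4))).mul (cj0.mul cj2)).sub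
    (((cM2.mul (dj1.mul cj0)).add ((cM3.const_mul (ζ ^ 4)).mul (dj1.mul cj2))).const_mul (vth q 1))
  have hR := ((hasDerivAt_id ζ).mul cx).const_mul h
  have hev : (Gf q (ζ ^ 4)) =ᶠ[𝓝 ζ] fun z => h * (z * jt q (- q * z)) := by
    have hm : ann q (1 / q) ∈ 𝓝 ζ := (isOpen_ann _ _).mem_nhds
      ⟨by rw [hno]; exact hq1, by rw [hno, lt_div_iff₀ hq0]; linarith⟩
    filter_upwards [hm] with y hy
    exact hh y hy.1.le hy.2.le
  have hG' : HasDerivAt (Gf q (ζ ^ 4)) _ ζ := hG.congr_of_eventuallyEq (by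
    refine Eventually.of_forall fun z => ?_
    simp only [Gf, e4, b1, Function.comp, Pi.mul_apply, Pi.sub_apply, Pi.add_apply])
  have hu := (hG'.congr_of_eventuallyEq hev.symm).unique hR
  simp only [Pi.mul_apply, Function.comp, a1, a2, jt_one, Mt_one, id] at hu
  rw [Tt_Mt hq0 hq1 one_ne_zero hno h1, Tt_Mt hq0 hq1 (pow_ne_zero _ hz0) (hnp 2) n2] at hu
  have r1 := rho_on hq0 hq1 hk hno h1
  have r2 := rho_on hq0 hq1 hk (hnp 2) n2
  have hxn : ‖(-q * ζ : ℂ)‖ = q := by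
    rw [norm_mul, hno, norm_neg, Complex.norm_real, Real.norm_of_nonneg hq0.le, mul_one]
  have rx := rho_in hq0 hq1 hk (x := -q * ζ) (by rw [hxn]; nlinarith) (by rw [hxn]; exact hq1)
  generalize ζ / (1 - ζ) + Lmb q ζ = R1 at *
  generalize ζ ^ 2 / (1 - ζ ^ 2) + Lmb q (ζ ^ 2) = R2 at *
  generalize LamS q (fun n => (-q * ζ) ^ n) 1 = Lx at *
  have key : (deriv (jt q) 1 * jt q ζ * jt q (ζ ^ 2)) * (ζ ^ 5 * (Tt q ζ 1 * Comb q (ζ ^ 4))) =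
    (deriv (jt q) 1 * jt q ζ * jt q (ζ ^ 2)) * (vth q 1 * (ζ ^ 5 * Tt q (ζ ^ 2) (ζ ^ 2) + ζ ^ 4 * (ζ ^ 5 * LamS q (ut q (ζ ^ 3)) 1 + 1
      + R1 + R2 - Lx))) := by
    linear_combination ζ * hu + h * ζ * rx - (1 - Lx) * g1
      - vth q 1 * ζ ^ 4 * deriv (jt q) 1 * (jt q (ζ ^ 2) * r1 + jt q ζ * r2)
  have key2 := mul_left_cancel₀ (mul_ne_zero (mul_ne_zero hk hj1) hj2) key
  rw [h5] at key2
  linear_combination key2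

end zeta
end part_F

section part_G
open Filter Topology
def RepAt (q : ℝ) (p : PowerSeries ℂ) (s : ℂ) : Prop :=
  Summable (fun n => ‖PowerSeries.coeff n p‖ * q ^ n) ∧
    HasSum (fun n => PowerSeries.coeff n p * (q : ℂ) ^ n) s

lemma RepAt.norm {q : ℝ} (hq : 0 < q) {p : PowerSeries ℂ} {s : ℂ} (h : RepAt q p s) :
    Summable (fun n => ‖PowerSeries.coeff n p * (q : ℂ) ^ n‖) := by
  refine h.1.congr fun n => ?_
  rw [norm_mul, norm_pow, Complex.norm_real, Real.norm_of_nonneg hq.le]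

lemma repAt_of {q : ℝ} (hq : 0 < q) {p : PowerSeries ℂ} {s : ℂ}
    (h : HasSum (fun n => PowerSeries.coeff n p * (q : ℂ) ^ n) s) : RepAt q p s := by
  refine ⟨?_, h⟩
  have := h.summable.norm
  refine this.congr fun n => ?_
  rw [norm_mul, norm_pow, Complex.norm_real, Real.norm_of_nonneg hq.le]

lemma RepAt.add {q : ℝ} (hq : 0 < q) {p p' : PowerSeries ℂ} {s s' : ℂ} (h : RepAt q p s) (h' : RepAt q p' s') :
    RepAt q (p + p') (s + s') := by
  refine repAt_of hq ?_
  have := h.2.add h'.2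
  simpa [add_mul] using this

lemma RepAt.sub {q : ℝ} (hq : 0 < q) {p p' : PowerSeries ℂ} {s s' : ℂ} (h : RepAt q p s) (h' : RepAt q p' s') :
    RepAt q (p - p') (s - s') := by
  refine repAt_of hq ?_
  have := h.2.sub h'.2
  simpa [sub_mul] using this

lemma repAt_C (q : ℝ) (hq : 0 < q) (c : ℂ) : RepAt q (PowerSeries.C c) c := by
  refine repAt_of hq ?_
  have := hasSum_ite_eq (0 : ℕ) c
  refine (hasSum_congr' fun n => ?_).2 this
  rw [PowerSeries.coeff_C]
  split_ifs with h
  · simp [h]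
  · simp

lemma repAt_X (q : ℝ) (hq : 0 < q) (k : ℕ) : RepAt q (PowerSeries.X ^ k) ((q : ℂ) ^ k) := by
  refine repAt_of hq ?_
  have := hasSum_ite_eq k ((q : ℂ) ^ k)
  refine (hasSum_congr' fun n => ?_).2 this
  rw [PowerSeries.coeff_X_pow]
  split_ifs with h
  · simp [h]
  · simp

lemma RepAt.mul {q : ℝ} (hq : 0 < q) {p p' : PowerSeries ℂ} {s s' : ℂ} (h : RepAt q p s) (h' : RepAt q p' s') :
    RepAt q (p * p') (s * s') := by
  refine repAt_of hq ?_
  have h1 := summable_norm_sum_mul_antidiagonal_of_summable_norm (h.norm hq) (h'.norm hq)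
  have h2 := tsum_mul_tsum_eq_tsum_sum_antidiagonal_of_summable_norm (h.norm hq) (h'.norm hq)
  rw [h.2.tsum_eq, h'.2.tsum_eq] at h2
  rw [h2]
  refine (hasSum_congr' fun n => ?_).2 h1.of_norm.hasSum
  rw [PowerSeries.coeff_mul, Finset.sum_mul]
  refine Finset.sum_congr rfl fun x hx => ?_
  rw [Finset.HasAntidiagonal.mem_antidiagonal] at hx
  rw [← hx, pow_add]; ring

lemma repAt_zero {p : PowerSeries ℂ} (h : ∀ᶠ q : ℝ in 𝓝[>] 0, RepAt q p 0) : p = 0 := by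
  ext n
  rw [map_zero]
  obtain ⟨q0, hq0, hq0'⟩ : ∃ q0 : ℝ, 0 < q0 ∧ ∀ q ∈ Set.Ioo 0 q0, RepAt q p 0 := by
    have := (mem_nhdsGT_iff_exists_Ioo_subset (a := (0:ℝ))).1 h
    obtain ⟨u, hu, hs⟩ := this
    exact ⟨u, hu, fun q hq => hs hq⟩
  have hh0 := (hq0' (q0 / 2) ⟨by positivity, by linarith⟩).1
  generalize hq1d : q0 / 2 = q1 at *
  have hq1 : 0 < q1 := by rw [← hq1d]; positivity
  induction n using Nat.strong_induction_on with
  | _ n ih =>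
  have hs1 : Summable fun m => ‖PowerSeries.coeff (m + (n + 1)) p‖ * q1 ^ m := by
    have := (summable_nat_add_iff (n + 1)).2 hh0
    refine (this.mul_left (q1 ^ (n + 1))⁻¹).congr fun m => ?_
    rw [pow_add]; field_simp; ring
  have bd : ∀ q : ℝ, 0 < q → q ≤ q1 → ‖PowerSeries.coeff n p‖ ≤ (∑' m, ‖PowerSeries.coeff (m + (n + 1)) p‖ * q1 ^ m) * q := by
    intro q hq hqq
    have hr := hq0' q ⟨hq, by linarith⟩
    have h2 := (hasSum_nat_add_iff' (n + 1)).2 hr.2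
    rw [Finset.sum_range_succ, Finset.sum_eq_zero (fun i hi => by rw [ih i (Finset.mem_range.1 hi), zero_mul])] at h2
    have hle : ‖0 - (0 + PowerSeries.coeff n p * (q:ℂ) ^ n)‖ ≤ q ^ (n + 1) * ∑' m, ‖PowerSeries.coeff (m + (n + 1)) p‖ * q1 ^ m := by
      rw [← h2.tsum_eq]
      refine tsum_of_norm_bounded (hs1.hasSum.mul_left (q ^ (n + 1))) fun m => ?_
      rw [norm_mul, norm_pow, Complex.norm_real, Real.norm_of_nonneg hq.le, pow_add]
      have : q ^ m ≤ q1 ^ m := pow_le_pow_left₀ hq.le hqq m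
      calc _ = q ^ (n + 1) * (‖PowerSeries.coeff (m + (n + 1)) p‖ * q ^ m) := by ring
        _ ≤ _ := by gcongr
    rw [zero_add, zero_sub, norm_neg, norm_mul, norm_pow, Complex.norm_real, Real.norm_of_nonneg hq.le] at hle
    have hp : 0 < q ^ n := by positivity
    refine le_of_mul_le_mul_right (hle.trans (le_of_eq ?_)) hp
    ring
  set C := ∑' m, ‖PowerSeries.coeff (m + (n + 1)) p‖ * q1 ^ m with hC
  have hC0 : 0 ≤ C := tsum_nonneg fun m => by positivity
  have : ‖PowerSeries.coeff n p‖ ≤ 0 := by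
    refine le_of_forall_pos_le_add fun ε hε => ?_
    have hb := bd (min q1 (ε / (C + 1))) (lt_min hq1 (by positivity)) (min_le_left _ _)
    refine hb.trans ?_
    rw [zero_add]
    calc C * min q1 (ε / (C + 1)) ≤ C * (ε / (C + 1)) := by gcongr; exact min_le_right _ _
      _ ≤ ε := by
        rw [← mul_div_assoc, div_le_iff₀ (by positivity)]; nlinarith
  exact norm_le_zero_iff.1 this

noncomputable def lamb (w : ℕ → ℕ → ℂ) : PowerSeries ℂ :=
  PowerSeries.mk fun N => ∑ x ∈ N.divisorsAntidiagonal, w x.1 x.2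

lemma prod_summable {q : ℝ} (hq0 : 0 < q) (hq1 : q < 1) :
    Summable fun x : ℕ+ × ℕ+ => q ^ ((x.1 : ℕ) * (x.2 : ℕ)) := by
  have := summable_prod_mul_pow (𝕜 := ℝ) 0 (r := q) (by rw [Real.norm_of_nonneg hq0.le]; exact hq1)
  refine this.congr fun x => ?_
  rw [pow_zero, one_mul]

lemma lamb_rep {q : ℝ} (hq0 : 0 < q) (hq1 : q < 1) {w : ℕ → ℕ → ℂ} {C : ℝ} (hw : ∀ n m, ‖w n m‖ ≤ C)
    {g : ℕ+ → ℂ} {s : ℂ} (hg : ∀ n : ℕ+, HasSum (fun M : ℕ+ => w n M * (q : ℂ) ^ ((n : ℕ) * (M : ℕ))) (g n))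
    (hs : HasSum g s) : RepAt q (lamb w) s := by
  have hsum : Summable fun x : ℕ+ × ℕ+ => w x.1 x.2 * (q : ℂ) ^ ((x.1 : ℕ) * (x.2 : ℕ)) := by
    refine Summable.of_norm_bounded ((prod_summable hq0 hq1).mul_left C) fun x => ?_
    rw [norm_mul, norm_pow, Complex.norm_real, Real.norm_of_nonneg hq0.le]
    gcongr
    exact hw _ _
  have h1 := hsum.hasSum
  rw [(h1.prod_fiberwise hg).unique hs] at h1
  refine repAt_of hq0 ?_
  rw [← sigmaAntidiagonalEquivProd.hasSum_iff] at h1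
  have h2 := h1.sigma (g := fun n : ℕ+ => PowerSeries.coeff (n : ℕ) (lamb w) * (q : ℂ) ^ (n : ℕ)) (by
    intro n
    rw [lamb, PowerSeries.coeff_mk, Finset.sum_mul, ← Finset.sum_coe_sort]
    refine (hasSum_congr' fun x => ?_).2 (hasSum_fintype _)
    have := (Nat.mem_divisorsAntidiagonal.1 x.2).1
    simp only [Function.comp, sigmaAntidiagonalEquivProd, divisorsAntidiagonalFactors, Equiv.coe_fn_mk, PNat.mk_coe]
    rw [this])
  have hinj : Function.Injective (fun n : ℕ+ => (n : ℕ)) := PNat.coe_injective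
  refine (hinj.hasSum_iff ?_).1 h2
  intro n hn
  have : n = 0 := by
    by_contra h0
    exact hn ⟨⟨n, Nat.pos_of_ne_zero h0⟩, rfl⟩
  subst this
  simp [lamb]
end part_G

section part_H
open Filter Topology
lemma lamb_rep_nat {q : ℝ} (hq0 : 0 < q) (hq1 : q < 1) {w : ℕ → ℕ → ℂ} {C : ℝ} (hw : ∀ n m, ‖w n m‖ ≤ C)
    {g : ℕ → ℂ} {s : ℂ}
    (hg : ∀ n : ℕ, HasSum (fun M : ℕ+ => w (n + 1) M * (q : ℂ) ^ ((n + 1) * (M : ℕ))) (g n))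
    (hs : HasSum g s) : RepAt q (lamb w) s := by
  refine lamb_rep hq0 hq1 hw (g := fun n : ℕ+ => g n.natPred) (fun n => ?_) ?_
  · have := hg n.natPred
    rw [PNat.natPred_add_one] at this
    exact this
  · exact (Equiv.pnatEquivNat.hasSum_iff (f := g)).2 hs

noncomputable def wT (ζ : ℂ) (s : ℕ → ℕ) (b c : ℤ) (n M : ℕ) : ℂ :=
  if M % 2 = 1 ∧ s n ≤ M / 2 then
    (-1) ^ n * (ζ ^ (b * n + c * ((M / 2 - s n : ℕ) : ℤ)) - ζ ^ (- b * n - c * (1 + ((M / 2 - s n : ℕ) : ℤ))))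
  else 0

noncomputable def wL (ζ : ℂ) (c : ℤ) (n M : ℕ) : ℂ :=
  if M % 2 = 0 then ζ ^ (c * n) - ζ ^ (- c * n) else 0

lemma norm_zpow_one {ζ : ℂ} (h : ‖ζ‖ = 1) (k : ℤ) : ‖ζ ^ k‖ = 1 := by rw [norm_zpow, h, one_zpow]

lemma wT_bd {ζ : ℂ} (h : ‖ζ‖ = 1) (s : ℕ → ℕ) (b c : ℤ) (n M : ℕ) : ‖wT ζ s b c n M‖ ≤ 2 := by
  unfold wT
  split_ifs
  · rw [norm_mul, norm_pow, norm_neg, norm_one, one_pow, one_mul]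
    refine (norm_sub_le _ _).trans ?_
    rw [norm_zpow_one h, norm_zpow_one h]; norm_num
  · simp

lemma wL_bd {ζ : ℂ} (h : ‖ζ‖ = 1) (c : ℤ) (n M : ℕ) : ‖wL ζ c n M‖ ≤ 2 := by
  unfold wL
  split_ifs
  · refine (norm_sub_le _ _).trans ?_
    rw [norm_zpow_one h, norm_zpow_one h]; norm_num
  · simp

lemma geo_unit {q : ℝ} (hq0 : 0 < q) (hq1 : q < 1) {z : ℂ} (hz : ‖z‖ = 1) (n : ℕ) :
    HasSum (fun m : ℕ => (z * ((q : ℂ) ^ 2) ^ (n + 1)) ^ m) (1 - z * ((q : ℂ) ^ 2) ^ (n + 1))⁻¹ := by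
  refine hasSum_geometric_of_norm_lt_one ?_
  rw [norm_mul, hz, one_mul, norm_pow, norm_pow, Complex.norm_real, Real.norm_of_nonneg hq0.le]
  exact pow_lt_one₀ (by positivity) (by nlinarith) (by omega)

lemma row_T {q : ℝ} (hq0 : 0 < q) (hq1 : q < 1) {ζ : ℂ} (h : ‖ζ‖ = 1) (s : ℕ → ℕ) (b c : ℤ) (n : ℕ) :
    HasSum (fun M : ℕ+ => wT ζ s b c (n + 1) M * (q : ℂ) ^ ((n + 1) * (M : ℕ)))
      ((-1) ^ (n + 1) * (q : ℂ) ^ ((n + 1) * (2 * s (n + 1) + 1)) *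
        (ζ ^ (b * (n + 1 : ℕ)) / (1 - ζ ^ c * ((q : ℂ) ^ 2) ^ (n + 1)) -
          ζ ^ (- b * (n + 1 : ℕ)) * (ζ ^ c)⁻¹ / (1 - (ζ ^ c)⁻¹ * ((q : ℂ) ^ 2) ^ (n + 1)))) := by
  have hz0 : ζ ≠ 0 := by rintro rfl; simp at h
  have hi : Function.Injective (fun m : ℕ => (⟨2 * (s (n + 1) + m) + 1, by omega⟩ : ℕ+)) := by
    intro a b hab
    have := congrArg (fun x : ℕ+ => (x : ℕ)) hab
    simp at this
    exact this
  refine (hi.hasSum_iff ?_).1 ?_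
  · intro M hM
    rw [wT, if_neg, zero_mul]
    rintro ⟨h1, h2⟩
    apply hM
    refine ⟨(M : ℕ) / 2 - s (n + 1), ?_⟩
    apply PNat.coe_injective
    have key : ∀ M' : ℕ, M' % 2 = 1 → s (n + 1) ≤ M' / 2 → 2 * (s (n + 1) + (M' / 2 - s (n + 1))) + 1 = M' := by
      intro M' _ _; omega
    exact key _ h1 h2
  · have h1 := (geo_unit hq0 hq1 (norm_zpow_one h c) n).mul_left (ζ ^ (b * (n + 1 : ℕ)))
    have h2 := (geo_unit hq0 hq1 (z := (ζ ^ c)⁻¹) (by rw [norm_inv, norm_zpow_one h, inv_one]) n).mul_left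
      (ζ ^ (- b * (n + 1 : ℕ)) * (ζ ^ c)⁻¹)
    have h3 := (h1.sub h2).mul_left ((-1) ^ (n + 1) * (q : ℂ) ^ ((n + 1) * (2 * s (n + 1) + 1)))
    simp only [div_eq_mul_inv]
    refine (hasSum_congr' fun m => ?_).2 h3
    simp only [Function.comp, PNat.mk_coe]
    have e0 : (2 * (s (n + 1) + m) + 1) / 2 = s (n + 1) + m := by omega
    rw [wT, e0, if_pos ⟨by omega, by omega⟩, Nat.add_sub_cancel_left, zpow_add₀ hz0, sub_eq_add_neg (-b * _),
      zpow_add₀ hz0, mul_add c, neg_add, zpow_add₀ hz0, mul_pow, mul_pow, mul_one,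
      zpow_neg, zpow_neg, zpow_mul ζ c, zpow_natCast, inv_pow]
    have e1 : (n + 1) * (2 * (s (n + 1) + m) + 1) = (n + 1) * (2 * s (n + 1) + 1) + 2 * (n + 1) * m := by ring
    rw [e1, pow_add (q : ℂ), pow_mul (q : ℂ) (2 * (n + 1)) m, pow_mul (q : ℂ) 2 (n + 1)]
    ring

lemma row_L {q : ℝ} (hq0 : 0 < q) (hq1 : q < 1) {ζ : ℂ} (h : ‖ζ‖ = 1) (c : ℤ) (n : ℕ) :
    HasSum (fun M : ℕ+ => wL ζ c (n + 1) M * (q : ℂ) ^ ((n + 1) * (M : ℕ)))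
      (((ζ ^ c) ^ (n + 1) - (ζ ^ c)⁻¹ ^ (n + 1)) * (((q : ℂ) ^ 2) ^ (n + 1) / (1 - ((q : ℂ) ^ 2) ^ (n + 1)))) := by
  have hi : Function.Injective (fun m : ℕ => (⟨2 * (m + 1), by omega⟩ : ℕ+)) := by
    intro a b hab
    have := congrArg (fun x : ℕ+ => (x : ℕ)) hab
    simp at this
    exact this
  refine (hi.hasSum_iff ?_).1 ?_
  · intro M hM
    rw [wL, if_neg, zero_mul]
    intro h1
    apply hM
    refine ⟨(M : ℕ) / 2 - 1, ?_⟩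
    apply PNat.coe_injective
    have key : ∀ M' : ℕ, 0 < M' → M' % 2 = 0 → 2 * (M' / 2 - 1 + 1) = M' := by
      intro M' _ _; omega
    exact key _ (PNat.pos M) h1
  · have h1 := ((geo_unit hq0 hq1 (norm_one (α := ℂ)) n).mul_left (((q : ℂ) ^ 2) ^ (n + 1))).mul_left
      ((ζ ^ c) ^ (n + 1) - (ζ ^ c)⁻¹ ^ (n + 1))
    rw [one_mul] at h1
    rw [div_eq_mul_inv]
    refine (hasSum_congr' fun m => ?_).2 h1
    simp only [Function.comp, PNat.mk_coe]
    rw [wL, if_pos (by omega), neg_mul, zpow_neg, zpow_mul, zpow_natCast, inv_pow]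
    have e1 : (n + 1) * (2 * (m + 1)) = 2 * (n + 1) * m + 2 * (n + 1) := by ring
    rw [e1, pow_add (q : ℂ), pow_mul (q : ℂ) (2 * (n + 1)) m, pow_mul (q : ℂ) 2 (n + 1)]
    ring

lemma LamS_rep {q : ℝ} (hq0 : 0 < q) (hq1 : q < 1) {ζ : ℂ} (h : ‖ζ‖ = 1) (s : ℕ → ℕ) (b c : ℤ)
    {u : ℤ → ℂ} (hu : Adm q u)
    (hu1 : ∀ n : ℕ, u ((n + 1 : ℕ) : ℤ) = (-1) ^ (n + 1) * (q : ℂ) ^ ((n + 1) * (2 * s (n + 1) + 1)) * ζ ^ (b * (n + 1 : ℕ)))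
    (hu2 : ∀ n : ℕ, u (-((n + 1 : ℕ) : ℤ)) * ((q : ℂ) ^ 2) ^ (n + 1)
      = (-1) ^ (n + 1) * (q : ℂ) ^ ((n + 1) * (2 * s (n + 1) + 1)) * ζ ^ (-b * (n + 1 : ℕ))) :
    RepAt q (lamb (wT ζ s b c)) (LamS q u (ζ ^ c)) := by
  refine lamb_rep_nat hq0 hq1 (wT_bd h s b c) (row_T hq0 hq1 h s b c) ?_
  obtain ⟨a, ha, haq, ha0, ha1⟩ := mid_a hq0 hq1
  have hn := norm_zpow_one h c
  have := LamS_nat hq0 hq1 ha ha1 hu (mem_ann_of ha0 haq (unit_bd hq0 hq1 hn).1 (unit_bd hq0 hq1 hn).2)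
  refine (hasSum_congr' fun n => ?_).2 this
  have e := hu2 n
  rw [hu1]
  linear_combination ((ζ ^ c)⁻¹ / (1 - (ζ ^ c)⁻¹ * ((q : ℂ) ^ 2) ^ (n + 1))) * e

lemma LamS_ut_rep {q : ℝ} (hq0 : 0 < q) (hq1 : q < 1) {ζ : ℂ} (h : ‖ζ‖ = 1) (b c : ℤ) :
    RepAt q (lamb (wT ζ (fun n => n) b c)) (LamS q (ut q (ζ ^ b)) (ζ ^ c)) := by
  have hz0 : ζ ≠ 0 := by rintro rfl; simp at h
  have hq : (q : ℂ) ≠ 0 := by exact_mod_cast hq0.ne'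
  refine LamS_rep hq0 hq1 h _ b c (ut_adm hq0 hq1 (zpow_ne_zero _ hz0)) (fun n => ?_) (fun n => ?_)
  · rw [ut, zpow_natCast, zpow_natCast, zpow_mul, zpow_natCast]
    congr 2
    rw [← zpow_natCast]
    congr 1
    push_cast; ring
  · rw [ut, zpow_neg, zpow_natCast, zpow_neg, zpow_natCast, neg_mul, zpow_neg ζ, zpow_mul, zpow_natCast]
    have e1 : ((-1 : ℂ) ^ (n + 1))⁻¹ = (-1) ^ (n + 1) := by
      rw [← inv_pow]; norm_num
    rw [e1]
    have e2 : (q : ℂ) ^ (2 * (-((n + 1 : ℕ) : ℤ)) ^ 2 + -((n + 1 : ℕ) : ℤ)) * ((q : ℂ) ^ 2) ^ (n + 1)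
        = (q : ℂ) ^ ((n + 1) * (2 * (n + 1) + 1)) := by
      rw [← pow_mul, ← zpow_natCast, ← zpow_natCast, ← zpow_add₀ hq]
      congr 1
      push_cast; ring
    rw [← e2]; ring

lemma LamS_x_rep {q : ℝ} (hq0 : 0 < q) (hq1 : q < 1) {ζ : ℂ} (h : ‖ζ‖ = 1) (b c : ℤ) :
    RepAt q (lamb (wT ζ (fun _ => 0) b c)) (LamS q (fun n => (-q * ζ ^ b) ^ n) (ζ ^ c)) := by
  have hz0 : ζ ≠ 0 := by rintro rfl; simp at h
  have hq : (q : ℂ) ≠ 0 := by exact_mod_cast hq0.ne'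
  have hxn : ‖(-q * ζ ^ b : ℂ)‖ = q := by
    rw [norm_mul, norm_zpow_one h, norm_neg, Complex.norm_real, Real.norm_of_nonneg hq0.le, mul_one]
  obtain ⟨ad, -⟩ := T3 hq0 hq1 (x := -q * ζ ^ b) (by rw [hxn]; nlinarith) (by rw [hxn]; exact hq1)
  refine LamS_rep hq0 hq1 h _ b c ad (fun n => ?_) (fun n => ?_)
  · rw [zpow_natCast, zpow_mul, zpow_natCast, neg_mul, neg_pow, mul_pow, mul_zero, zero_add, mul_one, mul_assoc]
  · rw [zpow_neg, zpow_natCast, neg_mul b, zpow_neg ζ, zpow_mul, zpow_natCast, neg_mul, neg_pow, mul_pow, mul_zero, zero_add, mul_one]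
    have e1 : ((-1 : ℂ) ^ (n + 1))⁻¹ = (-1) ^ (n + 1) := by
      rw [← inv_pow]; norm_num
    rw [mul_inv, mul_inv, e1, ← pow_mul, mul_comm 2, pow_mul, sq]
    have : (q : ℂ) ^ (n + 1) ≠ 0 := pow_ne_zero _ hq
    field_simp

lemma Lmb_rep {q : ℝ} (hq0 : 0 < q) (hq1 : q < 1) {ζ : ℂ} (h : ‖ζ‖ = 1) (c : ℤ) :
    RepAt q (lamb (wL ζ c)) (Lmb q (ζ ^ c)) := by
  have hn := norm_zpow_one h c
  exact lamb_rep_nat hq0 hq1 (wL_bd h c) (row_L hq0 hq1 h c)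
    (Lmb_summable hq0 hq1 (unit_bd hq0 hq1 hn).1 (unit_bd hq0 hq1 hn).2).hasSum
end part_H

section part_K1
open Filter Topology
noncomputable def fs (c : ℕ → ℤ) (e : ℕ → ℕ) : PowerSeries ℤ :=
  PowerSeries.mk fun N => ∑ n ∈ Finset.range (N + 1), if e n = N then c n else 0

noncomputable def Zs (m : ℕ) : PowerSeries ℤ := fs (fun k => (-1) ^ k) (fun k => 2 * k ^ 2 + 3 * k + 1 + 2 * m * (k + 1))
noncomputable def psi : PowerSeries ℤ := 1 - Zs 1 - Zs 0
noncomputable def toC : PowerSeries ℤ →+* PowerSeries ℂ := PowerSeries.map (Int.castRingHom ℂ)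

lemma coeff_toC (n : ℕ) (p : PowerSeries ℤ) : PowerSeries.coeff n (toC p) = ((PowerSeries.coeff n p : ℤ) : ℂ) := by
  simp [toC]

lemma fs_rep {q : ℝ} (hq0 : 0 < q) {c : ℕ → ℤ} {e : ℕ → ℕ} (he : StrictMono e) {s : ℂ}
    (h : HasSum (fun n => (c n : ℂ) * (q : ℂ) ^ (e n)) s) : RepAt q (toC (fs c e)) s := by
  refine repAt_of hq0 ?_
  refine (he.injective.hasSum_iff ?_).1 ?_
  · intro N hN
    rw [coeff_toC, fs, PowerSeries.coeff_mk, Finset.sum_eq_zero, Int.cast_zero, zero_mul]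
    intro n _
    rw [if_neg]
    rintro rfl
    exact hN ⟨n, rfl⟩
  · refine (hasSum_congr' fun n => ?_).2 h
    simp only [Function.comp]
    rw [coeff_toC, fs, PowerSeries.coeff_mk, Finset.sum_eq_single n]
    · simp
    · intro b _ hb
      rw [if_neg]
      exact fun h => hb (he.injective h)
    · intro hn
      exact absurd (Finset.mem_range.2 (Nat.lt_succ_of_le he.le_apply)) hn

lemma quad_mono (m : ℕ) : StrictMono (fun k : ℕ => 2 * k ^ 2 + 3 * k + 1 + 2 * m * (k + 1)) := by
  refine strictMono_nat_of_lt_succ fun k => ?_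
  ring_nf
  nlinarith

lemma Zs_rep {q : ℝ} (hq0 : 0 < q) (hq1 : q < 1) (m : ℕ) :
    RepAt q (toC (Zs m)) (∑' k : ℕ, (-1) ^ k * (q : ℂ) ^ (2 * k ^ 2 + 3 * k + 1 + 2 * m * (k + 1))) := by
  refine fs_rep hq0 (quad_mono m) ?_
  have hs : Summable fun k : ℕ => (-1 : ℂ) ^ k * (q : ℂ) ^ (2 * k ^ 2 + 3 * k + 1 + 2 * m * (k + 1)) := by
    refine Summable.of_norm_bounded (summable_geometric_of_lt_one hq0.le hq1) fun k => ?_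
    rw [norm_mul, norm_pow, norm_neg, norm_one, one_pow, one_mul, norm_pow, Complex.norm_real, Real.norm_of_nonneg hq0.le]
    exact pow_le_pow_of_le_one hq0.le hq1.le ((quad_mono m).le_apply)
  refine (hasSum_congr' fun n => ?_).2 hs.hasSum
  push_cast; rfl

lemma psi_rep {q : ℝ} (hq0 : 0 < q) (hq1 : q < 1) : RepAt q (toC psi) (vth q 1) := by
  have h1 := (repAt_C q hq0 1).sub hq0 (Zs_rep hq0 hq1 1) |>.sub hq0 (Zs_rep hq0 hq1 0)
  have e : toC psi = PowerSeries.C 1 - toC (Zs 1) - toC (Zs 0) := by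
    rw [psi, map_sub, map_sub, map_one, map_one]
  rw [e]
  convert h1 using 1
  have h := (ut_summable hq0 hq1 one_ne_zero).hasSum.nat_add_neg
  rw [← hasSum_nat_add_iff' 1] at h
  simp only [Finset.sum_range_one, Nat.cast_zero, neg_zero, ut_zero] at h
  have h2 := ((Zs_rep hq0 hq1 1).2).add ((Zs_rep hq0 hq1 0).2)
  have s1 : ∀ m : ℕ, Summable fun k : ℕ => (-1 : ℂ) ^ k * (q : ℂ) ^ (2 * k ^ 2 + 3 * k + 1 + 2 * m * (k + 1)) := by
    intro m
    refine Summable.of_norm_bounded (summable_geometric_of_lt_one hq0.le hq1) fun k => ?_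
    rw [norm_mul, norm_pow, norm_neg, norm_one, one_pow, one_mul, norm_pow, Complex.norm_real, Real.norm_of_nonneg hq0.le]
    exact pow_le_pow_of_le_one hq0.le hq1.le ((quad_mono m).le_apply)
  have h3 := ((s1 1).hasSum.add (s1 0).hasSum).neg
  have h4 : HasSum (fun n : ℕ => ut q 1 ((n + 1 : ℕ) : ℤ) + ut q 1 (-((n + 1 : ℕ) : ℤ)))
      (-(∑' k : ℕ, (-1 : ℂ) ^ k * (q : ℂ) ^ (2 * k ^ 2 + 3 * k + 1 + 2 * 1 * (k + 1))
        + ∑' k : ℕ, (-1 : ℂ) ^ k * (q : ℂ) ^ (2 * k ^ 2 + 3 * k + 1 + 2 * 0 * (k + 1)))) := by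
    refine (hasSum_congr' fun n => ?_).2 h3
    rw [ut, ut, one_zpow, one_zpow, mul_one, mul_one]
    have e0 : (-1 : ℂ) ^ (-((n + 1 : ℕ) : ℤ)) = (-1) ^ (n + 1) := by
      rw [zpow_neg, zpow_natCast, ← inv_pow]; norm_num
    have e1 : (q : ℂ) ^ (2 * ((n + 1 : ℕ) : ℤ) ^ 2 + ((n + 1 : ℕ) : ℤ)) = (q : ℂ) ^ (2 * n ^ 2 + 3 * n + 1 + 2 * 1 * (n + 1)) := by
      rw [← zpow_natCast]; congr 1; push_cast; ring
    have e2 : (q : ℂ) ^ (2 * (-((n + 1 : ℕ) : ℤ)) ^ 2 + -((n + 1 : ℕ) : ℤ)) = (q : ℂ) ^ (2 * n ^ 2 + 3 * n + 1 + 2 * 0 * (n + 1)) := by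
      rw [← zpow_natCast]; congr 1; push_cast; ring
    rw [e0, e1, e2, zpow_natCast]
    ring
  have := h.unique h4
  rw [vth]
  linear_combination this

lemma expand_rep {q : ℝ} (hq0 : 0 < q) {k : ℕ} (hk : k ≠ 0) {p : PowerSeries ℂ} {s : ℂ} (h : RepAt (q ^ k) p s) :
    RepAt q (PowerSeries.expand k hk p) s := by
  refine repAt_of hq0 ?_
  have hi : Function.Injective (fun n : ℕ => k * n) := fun a b hab => Nat.eq_of_mul_eq_mul_left (Nat.pos_of_ne_zero hk) hab
  refine (hi.hasSum_iff ?_).1 ?_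
  · intro N hN
    rw [PowerSeries.coeff_expand, if_neg, zero_mul]
    rintro ⟨d, rfl⟩
    exact hN ⟨d, rfl⟩
  · refine (hasSum_congr' fun n => ?_).2 h.2
    simp only [Function.comp]
    rw [PowerSeries.coeff_expand, if_pos (dvd_mul_right _ _), Nat.mul_div_cancel_left _ (Nat.pos_of_ne_zero hk), pow_mul]
    push_cast; rfl

lemma zeta_zpow_mod {ζ : ℂ} (h5 : ζ ^ 5 = 1) (k : ℤ) : ζ ^ k = ζ ^ ((k % 5).toNat) := by
  have hz0 := zeta_ne0 h5
  have e : k = 5 * (k / 5) + k % 5 := by omega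
  have e2 : k % 5 = (((k % 5).toNat : ℕ) : ℤ) := by omega
  have h5' : ζ ^ (5 : ℤ) = 1 := by exact_mod_cast h5
  conv_lhs => rw [e, zpow_add₀ hz0, zpow_mul, h5', one_zpow, one_mul, e2, zpow_natCast]

lemma zeta_zpow_one {ζ : ℂ} (h5 : ζ ^ 5 = 1) (h1 : ζ ≠ 1) {k : ℤ} (h : ζ ^ k = 1) : (5 : ℤ) ∣ k := by
  rw [zeta_zpow_mod h5] at h
  by_contra hk
  have hr : (k % 5).toNat < 5 := by omega
  have hr0 : 0 < (k % 5).toNat := by omega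
  refine zeta_pow_ne (k := (k % 5).toNat) ?_ h5 h1 h
  generalize (k % 5).toNat = r at *
  interval_cases r <;> norm_num

lemma ident3 {ζ : ℂ} {q : ℝ} (hq0 : 0 < q) (hq1 : q < 1) (h5 : ζ ^ 5 = 1) (h1 : ζ ≠ 1) :
    vth q 1 + ζ ^ 4 * Comb q (ζ ^ 2) + ζ ^ 3 * Comb q (ζ ^ 4) = -5 * (q : ℂ) ^ 3 * vth (q ^ 25) 1 := by
  have hz0 := zeta_ne0 h5
  have hq : (q : ℂ) ≠ 0 := by exact_mod_cast hq0.ne'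
  have hs : ∀ k : ℕ, HasSum (ut q (ζ ^ k)) (vth q (ζ ^ k)) := fun k => (ut_summable hq0 hq1 (pow_ne_zero k hz0)).hasSum
  have e1 : ((ζ ^ 2)⁻¹) ^ 2 = ζ ^ 1 := by
    have : (ζ ^ 2)⁻¹ = ζ ^ 3 := inv_eq_of_mul_eq_one_right (by linear_combination h5)
    rw [this]; linear_combination ζ * h5
  have e2 : ((ζ ^ 4)⁻¹) ^ 2 = ζ ^ 2 := by
    have : (ζ ^ 4)⁻¹ = ζ := inv_eq_of_mul_eq_one_right (by linear_combination h5)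
    rw [this]
  have e3 : (ζ ^ 4) ^ 2 = ζ ^ 3 := by linear_combination ζ ^ 3 * h5
  have e4 : (ζ ^ 2) ^ 2 = ζ ^ 4 := by ring
  have e0 : (1 : ℂ) = ζ ^ 0 := by simp
  rw [Comb, Comb, e1, e2, e3, e4]
  have hs0 := hs 0
  rw [pow_zero] at hs0
  have H := ((hs0.add (((hs 1).add ((hs 4).mul_left (ζ ^ 2))).mul_left (ζ ^ 4))).add
    (((hs 2).add ((hs 3).mul_left (ζ ^ 4))).mul_left (ζ ^ 3)))
  refine H.unique ?_
  have hi : Function.Injective (fun m : ℤ => 5 * m + 1) := fun a b hab => by simpa using hab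
  have hterm : ∀ n : ℤ, (ut q 1 n + ζ ^ 4 * (ut q (ζ ^ 1) n + ζ ^ 2 * ut q (ζ ^ 4) n)
      + ζ ^ 3 * (ut q (ζ ^ 2) n + ζ ^ 4 * ut q (ζ ^ 3) n)) = ut q 1 n *
        (1 + ζ ^ (n - 1) + (ζ ^ (n - 1)) ^ 2 + (ζ ^ (n - 1)) ^ 3 + (ζ ^ (n - 1)) ^ 4) := by
    intro n
    have hn : ζ ^ n = ζ ^ (n - 1) * ζ := by rw [← zpow_add_one₀ hz0]; ring_nf
    have hk : ∀ k : ℕ, (ζ ^ k) ^ n = (ζ ^ (n - 1)) ^ k * ζ ^ k := by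
      intro k
      rw [← zpow_natCast, ← zpow_mul, mul_comm, zpow_mul, zpow_natCast, hn, mul_pow, zpow_natCast]
    simp only [ut, hk, one_zpow]
    generalize ζ ^ (n - 1) = t
    linear_combination (-1) ^ n * (q : ℂ) ^ (2 * n ^ 2 + n) * (t + t ^ 4 * (1 + ζ ^ 5) + t ^ 2 + t ^ 3 * (1 + ζ ^ 5)) * h5
  refine (hasSum_congr' hterm).2 ?_
  refine (hi.hasSum_iff ?_).1 ?_
  · intro n hn
    have ht : ζ ^ (n - 1) ≠ 1 := by
      intro h
      obtain ⟨d, hd⟩ := zeta_zpow_one h5 h1 h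
      exact hn ⟨d, by simp at hd ⊢; omega⟩
    have ht5 : (ζ ^ (n - 1)) ^ 5 = 1 := by
      rw [← zpow_natCast, ← zpow_mul, mul_comm, zpow_mul, zpow_natCast, h5, one_zpow]
    generalize ζ ^ (n - 1) = t at *
    have : 1 + t + t ^ 2 + t ^ 3 + t ^ 4 = 0 := by
      have h : (t - 1) * (1 + t + t ^ 2 + t ^ 3 + t ^ 4) = 0 := by linear_combination ht5
      exact (mul_eq_zero.1 h).resolve_left (sub_ne_zero.2 ht)
    rw [this, mul_zero]
  · have hq25 : (q : ℝ) ^ 25 < 1 := pow_lt_one₀ hq0.le hq1 (by norm_num)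
    have h := (ut_summable (q := q ^ 25) (by positivity) hq25 one_ne_zero).hasSum.mul_left (-5 * (q : ℂ) ^ 3)
    refine (hasSum_congr' fun m => ?_).2 h
    simp only [Function.comp, ut, one_zpow, mul_one]
    have a1 : ζ ^ (5 * m + 1 - 1) = 1 := by
      rw [add_sub_cancel_right, zpow_mul]
      have : ζ ^ (5 : ℤ) = 1 := by exact_mod_cast h5
      rw [this, one_zpow]
    have a2 : (-1 : ℂ) ^ (5 * m + 1) = - (-1) ^ m := by
      rw [zpow_add₀ (by norm_num), zpow_mul]; norm_num
    have a3 : (q : ℂ) ^ (2 * (5 * m + 1) ^ 2 + (5 * m + 1)) = (q : ℂ) ^ 3 * (((q ^ 25 : ℝ) : ℂ)) ^ (2 * m ^ 2 + m) := by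
      push_cast
      rw [← zpow_natCast (q : ℂ) 25, ← zpow_natCast (q : ℂ) 3, ← zpow_mul, ← zpow_add₀ hq]
      congr 1
      push_cast; ring
    rw [a1, a2, a3]
    ring
end part_K1

section part_K2
open Filter Topology
noncomputable def wR (ζ : ℂ) (n M : ℕ) : ℂ :=
  wT ζ (fun n => n) 0 1 n M + ζ ^ 4 * (wT ζ (fun n => n) 1 4 n M + ζ ^ 2 * wT ζ (fun n => n) 4 3 n M
    - wT ζ (fun _ => 0) 2 4 n M) + ζ ^ 3 * (wT ζ (fun n => n) 2 2 n M
    + ζ ^ 4 * (wT ζ (fun n => n) 3 0 n M + wL ζ 1 n M + wL ζ 2 n M - wT ζ (fun _ => 0) 1 0 n M))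

noncomputable def R0 (ζ : ℂ) : ℂ :=
  1 / (1 - ζ) + ζ ^ 4 * (1 / (1 - ζ ^ 4) + ζ ^ 2 * (1 / (1 - ζ ^ 3)) - 1 / (1 - ζ ^ 4))
    + ζ ^ 3 * (1 / (1 - ζ ^ 2) + ζ ^ 4 * (1 + ζ / (1 - ζ) + ζ ^ 2 / (1 - ζ ^ 2)))

lemma Tt_unit {q : ℝ} (hq0 : 0 < q) (hq1 : q < 1) {β : ℂ} (hβ : β ≠ 0) {z : ℂ}
    (hz : ‖z‖ = 1) : Tt q z β = 1 / (1 - z) + LamS q (ut q β) z := by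
  obtain ⟨a, ha, haq, ha0, ha1⟩ := mid_a hq0 hq1
  rw [Tt, Lam_eq hq0 hq1 ha ha1 (ut_adm hq0 hq1 hβ) (mem_ann_of ha0 haq (unit_bd hq0 hq1 hz).1 (unit_bd hq0 hq1 hz).2), ut_zero]

lemma Lamx_unit {q : ℝ} (hq0 : 0 < q) (hq1 : q < 1) {β : ℂ} (hβ : ‖β‖ = 1) {z : ℂ}
    (hz : ‖z‖ = 1) : Lam q (fun n => (-q * β) ^ n) z = 1 / (1 - z) + LamS q (fun n => (-q * β) ^ n) z := by
  have hxn : ‖(-q * β : ℂ)‖ = q := by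
    rw [norm_mul, hβ, norm_neg, Complex.norm_real, Real.norm_of_nonneg hq0.le, mul_one]
  obtain ⟨ad, -⟩ := T3 hq0 hq1 (x := -q * β) (by rw [hxn]; nlinarith) (by rw [hxn]; exact hq1)
  obtain ⟨a, ha, haq, ha0, ha1⟩ := mid_a hq0 hq1
  rw [Lam_eq hq0 hq1 ha ha1 ad (mem_ann_of ha0 haq (unit_bd hq0 hq1 hz).1 (unit_bd hq0 hq1 hz).2), zpow_zero]

noncomputable def Rh (ζ : ℂ) : PowerSeries ℂ := PowerSeries.C (R0 ζ) + lamb (wR ζ)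
noncomputable def Th (ζ : ℂ) : PowerSeries ℂ := PowerSeries.C (1 / (1 - ζ)) + lamb (wT ζ (fun n => n) 0 1)

lemma formal_main {ζ : ℂ} (h5 : ζ ^ 5 = 1) (h1 : ζ ≠ 1) :
    PowerSeries.C (-5) * PowerSeries.X ^ 3 * PowerSeries.expand 25 (by norm_num) (toC psi) * Th ζ = toC psi * Rh ζ := by
  have hno := zeta_norm h5
  have hz0 := zeta_ne0 h5
  have hnp : ∀ k : ℕ, ‖ζ ^ k‖ = 1 := fun k => by rw [norm_pow, hno, one_pow]
  have n2 := zeta_pow_ne (k := 2) (by norm_num) h5 h1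
  rw [← sub_eq_zero]
  apply repAt_zero
  have hev : ∀ᶠ q : ℝ in 𝓝[>] 0, q ∈ Set.Ioo 0 1 := Ioo_mem_nhdsGT one_pos
  filter_upwards [hev, ev_jt_ne hno h1, ev_jt_ne (hnp 2) n2, ev_jt_neg_ne (hnp 2), ev_deriv_ne]
    with q hq hj1 hj2 hj3 hj4
  have hq0 := hq.1
  have hq1 := hq.2
  have i1 := ident1 hq0 hq1 h5 h1 hj1 hj2 hj3
  have i2 := ident2 hq0 hq1 h5 h1 hj1 hj2 hj4
  have i3 := ident3 hq0 hq1 h5 h1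
  have hT := (repAt_C q hq0 (1 / (1 - ζ))).add hq0 (LamS_ut_rep hq0 hq1 hno 0 1)
  rw [zpow_zero, zpow_one, ← Tt_unit hq0 hq1 one_ne_zero hno] at hT
  have hq25 : (q : ℝ) ^ 25 < 1 := pow_lt_one₀ hq0.le hq1 (by norm_num)
  have hL := (((repAt_C q hq0 (-5)).mul hq0 (repAt_X q hq0 3)).mul hq0
    (expand_rep hq0 (by norm_num) (psi_rep (q := q ^ 25) (by positivity) hq25))).mul hq0 hT
  have r1 := LamS_ut_rep hq0 hq1 hno 1 4
  have r2 := LamS_ut_rep hq0 hq1 hno 4 3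
  have r3 := LamS_x_rep hq0 hq1 hno 2 4
  have r4 := LamS_ut_rep hq0 hq1 hno 2 2
  have r5 := LamS_ut_rep hq0 hq1 hno 3 0
  have r6 := Lmb_rep hq0 hq1 hno 1
  have r7 := Lmb_rep hq0 hq1 hno 2
  have r8 := LamS_x_rep hq0 hq1 hno 1 0
  have c2 : ζ ^ (2 : ℤ) = ζ ^ 2 := by norm_cast
  have c3 : ζ ^ (3 : ℤ) = ζ ^ 3 := by norm_cast
  have c4 : ζ ^ (4 : ℤ) = ζ ^ 4 := by norm_cast
  simp only [zpow_zero, zpow_one, c2, c3, c4] at r1 r2 r3 r4 r5 r6 r7 r8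
  have CC := fun c : ℂ => repAt_C q hq0 c
  have hR0 := (LamS_ut_rep hq0 hq1 hno 0 1)
  rw [zpow_zero, zpow_one] at hR0
  have hR := (CC (R0 ζ)).add hq0 ((hR0.add hq0 ((CC (ζ ^ 4)).mul hq0 ((r1.add hq0 ((CC (ζ ^ 2)).mul hq0 r2)).sub hq0 r3))).add hq0
    ((CC (ζ ^ 3)).mul hq0 (r4.add hq0 ((CC (ζ ^ 4)).mul hq0 (((r5.add hq0 r6).add hq0 r7).sub hq0 r8)))))
  have hF := hL.sub hq0 ((psi_rep hq0 hq1).mul hq0 hR)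
  rw [Tt_unit hq0 hq1 hz0 (hnp 4), Tt_unit hq0 hq1 (pow_ne_zero 4 hz0) (hnp 3), Lamx_unit hq0 hq1 (hnp 2) (hnp 4)] at i1
  rw [Tt_unit hq0 hq1 (pow_ne_zero 2 hz0) (hnp 2)] at i2
  have hT1 := Tt_unit hq0 hq1 one_ne_zero hno
  have eR : Rh ζ = PowerSeries.C (R0 ζ) + (lamb (wT ζ (fun n ↦ n) 0 1) +
            PowerSeries.C (ζ ^ 4) *
              (lamb (wT ζ (fun n ↦ n) 1 4) + PowerSeries.C (ζ ^ 2) * lamb (wT ζ (fun n ↦ n) 4 3) -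
                lamb (wT ζ (fun x ↦ 0) 2 4)) +
          PowerSeries.C (ζ ^ 3) *
            (lamb (wT ζ (fun n ↦ n) 2 2) +
              PowerSeries.C (ζ ^ 4) *
                (lamb (wT ζ (fun n ↦ n) 3 0) + lamb (wL ζ 1) + lamb (wL ζ 2) - lamb (wT ζ (fun x ↦ 0) 1 0)))) := by
    rw [Rh]
    congr 1
    ext N
    simp only [lamb, wR, map_add, map_sub, PowerSeries.coeff_mk, PowerSeries.coeff_C_mul, Finset.sum_add_distrib,
      Finset.sum_sub_distrib, Finset.mul_sum]
    simp only [← Finset.mul_sum, Finset.sum_add_distrib, Finset.sum_sub_distrib]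
  rw [eR, Th]
  convert hF using 1
  rw [R0]
  linear_combination (Tt q ζ 1) * i3 - ζ ^ 4 * i1 - ζ ^ 3 * i2 - vth q 1 * hT1
end part_K2

section part_P1
open Filter Topology
/-- finite sets of multisets with parts at most `2k`, `s` parts, sum `n`, no repeated odd parts -/
noncomputable def pA : ℕ → ℕ → ℕ → Finset (Multiset ℕ)
  | _, 0, n => if n = 0 then {0} else ∅
  | 0, _ + 1, _ => ∅
  | k + 1, s + 1, n => pA k (s + 1) n ∪
      ((if 2 * k + 1 ≤ n then (pA k s (n - (2 * k + 1))).image (Multiset.cons (2 * k + 1)) else ∅) ∪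
      (if 2 * k + 2 ≤ n then (pA (k + 1) s (n - (2 * k + 2))).image (Multiset.cons (2 * k + 2)) else ∅))

def pOK (k s n : ℕ) (m : Multiset ℕ) : Prop :=
  (∀ i ∈ m, 0 < i ∧ i ≤ 2 * k) ∧ (∀ j, Odd j → m.count j ≤ 1) ∧ Multiset.card m = s ∧ m.sum = n

def pF : ℕ → ℕ → ℕ → ℤ
  | _, 0, n => if n = 0 then 1 else 0
  | 0, _ + 1, _ => 0
  | k + 1, s + 1, n => pF k (s + 1) n +
      ((if 2 * k + 1 ≤ n then pF k s (n - (2 * k + 1)) else 0) +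
      (if 2 * k + 2 ≤ n then pF (k + 1) s (n - (2 * k + 2)) else 0))

lemma mem_pA (k s n : ℕ) (m : Multiset ℕ) : m ∈ pA k s n ↔ pOK k s n m := by
  induction k generalizing s n m with
  | zero =>
    cases s with
    | zero =>
      rw [pA]
      by_cases hn : n = 0
      · subst hn
        simp only [if_true, Finset.mem_singleton, pOK]
        constructor
        · rintro rfl; simp
        · rintro ⟨-, -, h, -⟩; exact Multiset.card_eq_zero.1 h
      · simp only [if_neg hn, Finset.notMem_empty, pOK, false_iff]
        rintro ⟨-, -, h, h2⟩
        rw [Multiset.card_eq_zero.1 h] at h2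
        exact hn (by simpa using h2.symm)
    | succ s =>
      rw [pA]
      simp only [Finset.notMem_empty, pOK, false_iff]
      rintro ⟨h1, -, h, -⟩
      obtain ⟨a, ha⟩ := Multiset.card_pos_iff_exists_mem.1 (show 0 < Multiset.card m by omega)
      have := h1 a ha
      omega
  | succ k ihk =>
    induction s generalizing n m with
    | zero =>
      rw [pA]
      by_cases hn : n = 0
      · subst hn
        simp only [if_true, Finset.mem_singleton, pOK]
        constructor
        · rintro rfl; simp
        · rintro ⟨-, -, h, -⟩; exact Multiset.card_eq_zero.1 h
      · simp only [if_neg hn, Finset.notMem_empty, pOK, false_iff]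
        rintro ⟨-, -, h, h2⟩
        rw [Multiset.card_eq_zero.1 h] at h2
        exact hn (by simpa using h2.symm)
    | succ s ihs =>
      rw [pA]
      have e1 : (m ∈ (if 2 * k + 1 ≤ n then (pA k s (n - (2 * k + 1))).image (Multiset.cons (2 * k + 1)) else ∅))
          ↔ ∃ m', pOK k s (n - (2 * k + 1)) m' ∧ 2 * k + 1 ≤ n ∧ m = (2 * k + 1) ::ₘ m' := by
        split_ifs with h
        · simp only [Finset.mem_image, ihk]
          exact ⟨fun ⟨a, ha, e⟩ => ⟨a, ha, h, e.symm⟩, fun ⟨a, ha, _, e⟩ => ⟨a, ha, e.symm⟩⟩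
        · simp only [Finset.notMem_empty, false_iff]
          rintro ⟨_, _, h', _⟩; exact h h'
      have e2 : (m ∈ (if 2 * k + 2 ≤ n then (pA (k + 1) s (n - (2 * k + 2))).image (Multiset.cons (2 * k + 2)) else ∅))
          ↔ ∃ m', pOK (k + 1) s (n - (2 * k + 2)) m' ∧ 2 * k + 2 ≤ n ∧ m = (2 * k + 2) ::ₘ m' := by
        split_ifs with h
        · simp only [Finset.mem_image, ihs]
          exact ⟨fun ⟨a, ha, e⟩ => ⟨a, ha, h, e.symm⟩, fun ⟨a, ha, _, e⟩ => ⟨a, ha, e.symm⟩⟩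
        · simp only [Finset.notMem_empty, false_iff]
          rintro ⟨_, _, h', _⟩; exact h h'
      rw [Finset.mem_union, Finset.mem_union, e1, e2, ihk]
      constructor
      · rintro (h | ⟨m', ⟨h1, h2, h3, h4⟩, h5, rfl⟩ | ⟨m', ⟨h1, h2, h3, h4⟩, h5, rfl⟩)
        · exact ⟨fun i hi => ⟨(h.1 i hi).1, by have := (h.1 i hi).2; omega⟩, h.2⟩
        · refine ⟨?_, ?_, by simp [h3], by rw [Multiset.sum_cons, h4]; omega⟩
          · intro i hi
            rcases Multiset.mem_cons.1 hi with rfl | hi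
            · omega
            · have := h1 i hi; omega
          · intro j hj
            by_cases hjk : j = 2 * k + 1
            · subst hjk
              rw [Multiset.count_cons_self, Multiset.count_eq_zero_of_notMem]
              intro h; have := h1 _ h; omega
            · rw [Multiset.count_cons_of_ne hjk]; exact h2 j hj
        · refine ⟨?_, ?_, by simp [h3], by rw [Multiset.sum_cons, h4]; omega⟩
          · intro i hi
            rcases Multiset.mem_cons.1 hi with rfl | hi
            · omega
            · have := h1 i hi; omega
          · intro j hj
            rw [Multiset.count_cons_of_ne]; exact h2 j hj
            rintro rfl
            rw [Nat.odd_iff] at hj; omega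
      · rintro ⟨h1, h2, h3, h4⟩
        by_cases hA : 2 * k + 2 ∈ m
        · obtain ⟨m', rfl⟩ := Multiset.exists_cons_of_mem hA
          rw [Multiset.sum_cons] at h4
          rw [Multiset.card_cons] at h3
          refine Or.inr (Or.inr ⟨m', ⟨fun i hi => h1 i (Multiset.mem_cons_of_mem hi), ?_, by omega, by omega⟩, by omega, rfl⟩)
          intro j hj
          exact (Multiset.count_le_count_cons _ _ _).trans (h2 j hj)
        · by_cases hB : 2 * k + 1 ∈ m
          · obtain ⟨m', rfl⟩ := Multiset.exists_cons_of_mem hB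
            rw [Multiset.sum_cons] at h4
            rw [Multiset.card_cons] at h3
            refine Or.inr (Or.inl ⟨m', ⟨fun i hi => ?_, ?_, by omega, by omega⟩, by omega, rfl⟩)
            · have hi' := h1 i (Multiset.mem_cons_of_mem hi)
              refine ⟨hi'.1, ?_⟩
              have n1 : i ≠ 2 * k + 2 := by rintro rfl; exact hA (Multiset.mem_cons_of_mem hi)
              have n2 : i ≠ 2 * k + 1 := by
                rintro rfl
                have := h2 (2 * k + 1) ⟨k, rfl⟩
                rw [Multiset.count_cons_self] at this
                have := Multiset.count_pos.2 hi
                omega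
              omega
            · intro j hj
              exact (Multiset.count_le_count_cons _ _ _).trans (h2 j hj)
          · refine Or.inl ⟨fun i hi => ?_, h2, h3, h4⟩
            have hi' := h1 i hi
            have n1 : i ≠ 2 * k + 2 := by rintro rfl; exact hA hi
            have n2 : i ≠ 2 * k + 1 := by rintro rfl; exact hB hi
            omega

lemma card_pA (k s n : ℕ) : ((pA k s n).card : ℤ) = pF k s n := by
  induction k generalizing s n with
  | zero => cases s <;> simp only [pA, pF] <;> (try split_ifs) <;> simp
  | succ k ihk =>
    induction s generalizing n with
    | zero => simp only [pA, pF] ; split_ifs <;> simp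
    | succ s ihs =>
      rw [pA, pF, Finset.card_union_of_disjoint, Finset.card_union_of_disjoint]
      · push_cast
        rw [ihk]
        congr 2
        · split_ifs
          · rw [Finset.card_image_of_injective _ (fun a b h => (Multiset.cons_inj_right _).1 h), ihk]
          · simp
        · split_ifs
          · rw [Finset.card_image_of_injective _ (fun a b h => (Multiset.cons_inj_right _).1 h), ihs]
          · simp
      · rw [Finset.disjoint_left]
        intro a ha hb
        split_ifs at ha hb with h1 h2 <;> try simp at ha hb
        obtain ⟨x, hx, rfl⟩ := ha
        obtain ⟨y, hy, e⟩ := hb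
        rw [mem_pA] at hx hy
        have : 2 * k + 2 ∈ (2 * k + 1) ::ₘ x := by rw [← e]; exact Multiset.mem_cons_self _ _
        rcases Multiset.mem_cons.1 this with h | h
        · omega
        · have := hx.1 _ h; omega
      · rw [Finset.disjoint_left]
        intro a ha hb
        rw [mem_pA] at ha
        rw [Finset.mem_union] at hb
        rcases hb with hb | hb
        · split_ifs at hb with h1 <;> try simp at hb
          obtain ⟨y, hy, rfl⟩ := hb
          have := ha.1 _ (Multiset.mem_cons_self _ _)
          omega
        · split_ifs at hb with h1 <;> try simp at hb
          obtain ⟨y, hy, rfl⟩ := hb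
          have := ha.1 _ (Multiset.mem_cons_self _ _)
          omega
end part_P1

section part_P2
open Filter Topology
def pE : ℕ → ℕ → ℕ → ℤ
  | 0, s, n => pF 0 s n
  | k + 1, s, n => pF (k + 1) s n - pF k s n

lemma pA_mono (k s n : ℕ) : pA k s n ⊆ pA (k + 1) s n := by
  intro m hm
  rw [mem_pA] at hm ⊢
  exact ⟨fun i hi => ⟨(hm.1 i hi).1, by have := (hm.1 i hi).2; omega⟩, hm.2⟩

lemma card_pB (k s n : ℕ) : (((pA k s n).filter (fun m => (m.sup + 1) / 2 = k)).card : ℤ) = pE k s n := by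
  cases k with
  | zero =>
    rw [pE, ← card_pA, Finset.filter_true_of_mem]
    intro m hm
    rw [mem_pA] at hm
    have : m.sup ≤ 0 := Multiset.sup_le.2 fun i hi => by have := (hm.1 i hi).2; omega
    omega
  | succ k =>
    rw [pE, ← card_pA, ← card_pA, ← Nat.cast_sub (Finset.card_le_card (pA_mono k s n)),
      ← Finset.card_sdiff_of_subset (pA_mono k s n)]
    congr 2
    ext m
    rw [Finset.mem_filter, Finset.mem_sdiff]
    refine and_congr_right fun hm => ?_
    rw [mem_pA] at hm ⊢
    have h1 : m.sup ≤ 2 * (k + 1) := Multiset.sup_le.2 fun i hi => (hm.1 i hi).2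
    constructor
    · rintro h ⟨h2, -⟩
      have : m.sup ≤ 2 * k := Multiset.sup_le.2 fun i hi => (h2 i hi).2
      omega
    · intro h
      by_contra hc
      apply h
      refine ⟨fun i hi => ⟨(hm.1 i hi).1, (Multiset.le_sup hi).trans ?_⟩, hm.2⟩
      omega

lemma N2_eq (r : ℤ) (n : ℕ) : (N2 r 5 n : ℤ) = ∑ k ∈ Finset.range (n + 1), ∑ s ∈ Finset.range (n + 1),
    if ((k : ℤ) - s) ≡ r [ZMOD 5] then pE k s n else 0 := by
  classical
  rw [N2, Nat.card_eq_fintype_card, Fintype.card_subtype,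
    Finset.card_eq_sum_card_fiberwise (f := fun P : n.Partition => ((P.parts.sup + 1) / 2, Multiset.card P.parts))
      (t := Finset.range (n + 1) ×ˢ Finset.range (n + 1)), Finset.sum_product]
  · push_cast
    refine Finset.sum_congr rfl fun k hk => Finset.sum_congr rfl fun s hs => ?_
    by_cases h : ((k : ℤ) - s) ≡ r [ZMOD 5]
    · rw [if_pos h, ← card_pB]
      norm_cast
      refine Finset.card_bij (fun P _ => P.parts) ?_ ?_ ?_
      · intro P hP
        simp only [Finset.mem_filter, Finset.mem_univ, true_and, Prod.mk.injEq] at hP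
        rw [Finset.mem_filter, mem_pA]
        refine ⟨⟨fun i hi => ⟨P.parts_pos hi, ?_⟩, hP.1.1, hP.2.2, P.parts_sum⟩, hP.2.1⟩
        have := Multiset.le_sup hi
        omega
      · intro P _ Q _ h
        exact Nat.Partition.ext h
      · intro m hm
        rw [Finset.mem_filter, mem_pA] at hm
        refine ⟨⟨m, fun hi => (hm.1.1 _ hi).1, hm.1.2.2.2⟩, ?_, rfl⟩
        simp only [Finset.mem_filter, Finset.mem_univ, true_and, Prod.mk.injEq]
        refine ⟨⟨hm.1.2.1, ?_⟩, hm.2, hm.1.2.2.1⟩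
        rw [m2Rank]
        simp only
        rw [hm.2, hm.1.2.2.1]
        exact h
    · rw [if_neg h]
      norm_cast
      rw [Finset.card_eq_zero, Finset.filter_eq_empty_iff]
      intro P hP hc
      simp only [Finset.mem_filter, Finset.mem_univ, true_and, Prod.mk.injEq] at hP hc
      apply h
      have := hP.2
      rw [m2Rank, hc.1, hc.2] at this
      exact this
  · intro P hP
    simp only [Finset.coe_product, Set.mem_prod, Finset.mem_coe, Finset.mem_range]
    have h1 : P.parts.sup ≤ n := Multiset.sup_le.2 fun i hi => P.parts_sum ▸ Multiset.le_sum_of_mem hi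
    have h2 : Multiset.card P.parts ≤ n := by
      have := Multiset.card_nsmul_le_sum (s := P.parts) (a := 1) (fun x hx => P.parts_pos hx)
      rw [P.parts_sum] at this
      simpa using this
    omega
end part_P2

section part_P3
open Filter Topology
noncomputable def Fs (k s : ℕ) : PowerSeries ℤ := PowerSeries.mk (pF k s)
noncomputable def Es (k s : ℕ) : PowerSeries ℤ := PowerSeries.mk (pE k s)
noncomputable def Fle (k s : ℕ) : PowerSeries ℤ := ∑ i ∈ Finset.range (s + 1), Fs k i
noncomputable def Ele (k s : ℕ) : PowerSeries ℤ := ∑ i ∈ Finset.range (s + 1), Es k i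

lemma Fs_zero (k : ℕ) : Fs k 0 = 1 := by
  ext n
  cases k <;> simp [Fs, pF, PowerSeries.coeff_one]

lemma Fs_zero_succ (s : ℕ) : Fs 0 (s + 1) = 0 := by
  ext n
  simp [Fs, pF]

lemma Fs_succ (k s : ℕ) : Fs (k + 1) (s + 1) = Fs k (s + 1) + PowerSeries.X ^ (2 * k + 1) * Fs k s
    + PowerSeries.X ^ (2 * k + 2) * Fs (k + 1) s := by
  ext n
  simp only [map_add, PowerSeries.coeff_X_pow_mul', Fs, PowerSeries.coeff_mk]
  rw [pF, add_assoc]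

lemma Es_zero (s : ℕ) : Es 0 s = Fs 0 s := rfl
lemma Es_succ (k s : ℕ) : Es (k + 1) s = Fs (k + 1) s - Fs k s := by
  ext n
  simp [Es, Fs, pE]

lemma Fle_zero (k : ℕ) : Fle k 0 = 1 := by simp [Fle, Fs_zero]
lemma Fle_zero_left (s : ℕ) : Fle 0 s = 1 := by
  rw [Fle, Finset.sum_range_succ', Fs_zero, Finset.sum_eq_zero, zero_add]
  intro i _; exact Fs_zero_succ i
lemma Ele_zero_left (s : ℕ) : Ele 0 s = 1 := Fle_zero_left s
lemma Ele_succ_zero (k : ℕ) : Ele (k + 1) 0 = 0 := by simp [Ele, Es_succ, Fs_zero]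
lemma Fle_succ_right (k s : ℕ) : Fle k (s + 1) = Fle k s + Fs k (s + 1) := by
  rw [Fle, Finset.sum_range_succ, ← Fle]

lemma Ele_sub (k s : ℕ) : Ele (k + 1) s = Fle (k + 1) s - Fle k s := by
  rw [Ele, Fle, Fle, ← Finset.sum_sub_distrib]
  exact Finset.sum_congr rfl fun i _ => Es_succ k i

lemma Ele_succ (k s : ℕ) : Ele (k + 1) (s + 1) = PowerSeries.X ^ (2 * k + 1) * Fle k s + PowerSeries.X ^ (2 * k + 2) * Fle (k + 1) s := by
  rw [Ele, Finset.sum_range_succ', Es_succ, Fs_zero, Fs_zero, sub_self, add_zero, Fle, Fle, Finset.mul_sum,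
    Finset.mul_sum, ← Finset.sum_add_distrib]
  refine Finset.sum_congr rfl fun i _ => ?_
  rw [Es_succ, Fs_succ]; ring

lemma Fle_succ (k s : ℕ) : Fle (k + 1) (s + 1) = Fle k (s + 1) + PowerSeries.X ^ (2 * k + 1) * Fle k s
    + PowerSeries.X ^ (2 * k + 2) * Fle (k + 1) s := by
  have := Ele_succ k s
  rw [Ele_sub] at this
  linear_combination this

lemma Fs_conj (k s : ℕ) : Fs (k + 1) (s + 1) = PowerSeries.X ^ (2 * s + 2) * Fle k (s + 1) + PowerSeries.X ^ (2 * s + 1) * Fle k s := by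
  induction k generalizing s with
  | zero =>
    rw [Fle_zero_left, Fle_zero_left]
    induction s with
    | zero => rw [Fs_succ, Fs_zero_succ, Fs_zero, Fs_zero]; ring
    | succ s ih => rw [Fs_succ, ih, Fs_zero_succ, Fs_zero_succ]; ring
  | succ k ihk =>
    induction s with
    | zero =>
      have h := ihk 0
      rw [Fle_zero, Fle_succ_right, Fle_zero] at h
      rw [Fs_succ, Fs_zero, Fs_zero, Fle_zero, Fle_succ_right, Fle_zero]
      have h2 := Fs_succ k 0
      rw [Fs_zero, Fs_zero] at h2
      rw [h2] at h ⊢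
      linear_combination h
    | succ s ihs =>
      rw [Fs_succ (k + 1) (s + 1), ihk, ihk, ihs, Fle_succ k (s + 1), Fle_succ k s]
      ring

lemma pF_zero (k s n : ℕ) (h : n < s) : pF k s n = 0 := by
  induction k generalizing s n with
  | zero => cases s <;> simp_all [pF]
  | succ k ihk =>
    induction s generalizing n with
    | zero => omega
    | succ s ihs =>
      rw [pF, ihk _ _ h, zero_add]
      split_ifs
      · rw [ihk _ _ (by omega), ihs _ (by omega), add_zero]
      · rw [ihk _ _ (by omega), add_zero]
      · omega
      · rfl

lemma pE_zero (k s n : ℕ) (h : n < s) : pE k s n = 0 := by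
  cases k <;> simp [pE, pF_zero _ _ _ h]

lemma pE_zero' (k s n : ℕ) (h : n < k) : pE k s n = 0 := by
  cases k with
  | zero => omega
  | succ k =>
    cases s with
    | zero => simp [pE, pF]
    | succ s =>
      rw [pE, pF, if_neg (by omega), if_neg (by omega)]; ring

def Od {R : Type*} [CommRing R] (f : ℕ → PowerSeries R) : Prop := ∀ N k, N < k → PowerSeries.coeff N (f k) = 0

noncomputable def ser {R : Type*} [CommRing R] (f : ℕ → PowerSeries R) : PowerSeries R :=
  PowerSeries.mk fun N => ∑ k ∈ Finset.range (N + 1), PowerSeries.coeff N (f k)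

section
variable {R : Type*} [CommRing R]

lemma ser_add (f g : ℕ → PowerSeries R) : ser (fun k => f k + g k) = ser f + ser g := by
  ext N
  simp [ser, Finset.sum_add_distrib]

lemma ser_succ {f : ℕ → PowerSeries R} (hf : Od f) : ser f = f 0 + ser (fun k => f (k + 1)) := by
  ext N
  simp only [ser, map_add, PowerSeries.coeff_mk]
  rw [Finset.sum_range_succ', Finset.sum_range_succ _ N, hf N (N + 1) (by omega)]
  ring

lemma Od.shift {f : ℕ → PowerSeries R} (hf : Od f) (j : ℕ) : Od (fun k => f (k + j)) :=
  fun N k h => hf N (k + j) (by omega)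

lemma ser_shift {f : ℕ → PowerSeries R} (hf : Od f) (j : ℕ) (h0 : ∀ s < j, f s = 0) :
    ser f = ser (fun k => f (k + j)) := by
  induction j with
  | zero => rfl
  | succ j ih =>
    rw [ih (fun s hs => h0 s (by omega)), ser_succ (hf.shift j)]
    simp only [zero_add]
    rw [h0 j (by omega), zero_add]
    congr 1
    ext1 k
    congr 1
    ring

lemma ser_trunc {f : ℕ → PowerSeries R} (hf : Od f) (N K : ℕ) (h : N ≤ K) :
    PowerSeries.coeff N (ser f) = ∑ k ∈ Finset.range (K + 1), PowerSeries.coeff N (f k) := by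
  rw [ser, PowerSeries.coeff_mk]
  refine Finset.sum_subset (fun k hk => ?_) fun k hk hk' => ?_
  · rw [Finset.mem_range] at *; omega
  · rw [Finset.mem_range] at *; exact hf _ _ (by omega)

lemma Od.mul {f : ℕ → PowerSeries R} (hf : Od f) (p : PowerSeries R) : Od (fun k => p * f k) := by
  intro N k h
  rw [PowerSeries.coeff_mul]
  refine Finset.sum_eq_zero fun x hx => ?_
  rw [Finset.HasAntidiagonal.mem_antidiagonal] at hx
  rw [hf _ _ (by omega), mul_zero]

lemma ser_mul {f : ℕ → PowerSeries R} (hf : Od f) (p : PowerSeries R) : ser (fun k => p * f k) = p * ser f := by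
  ext N
  rw [PowerSeries.coeff_mul, ser, PowerSeries.coeff_mk]
  simp only [PowerSeries.coeff_mul]
  rw [Finset.sum_comm]
  refine Finset.sum_congr rfl fun x hx => ?_
  rw [Finset.HasAntidiagonal.mem_antidiagonal] at hx
  rw [ser_trunc hf x.2 N (by omega), Finset.mul_sum]

lemma Od_X (g : ℕ → PowerSeries R) (e : ℕ → ℕ) (he : ∀ k, k ≤ e k) :
    Od (fun k => PowerSeries.X ^ (e k) * g k) := by
  intro N k h
  simp only
  rw [PowerSeries.coeff_X_pow_mul', if_neg]
  have := he k; omega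

lemma Od.add {f g : ℕ → PowerSeries R} (hf : Od f) (hg : Od g) : Od (fun k => f k + g k) := by
  intro N k h
  simp only
  rw [map_add, hf _ _ h, hg _ _ h, add_zero]
end

noncomputable def Sr (w : ℕ → ℕ → ℤ) : PowerSeries ℤ :=
  PowerSeries.mk fun N => ∑ k ∈ Finset.range (N + 1), ∑ s ∈ Finset.range (N + 1), w k s * pE k s N

lemma Od_rowE (a : ℕ → ℕ) : Od (fun k => ∑ s ∈ Finset.range (a k), Es k s) := by
  intro N k h
  simp only [map_sum]
  exact Finset.sum_eq_zero fun s _ => by rw [Es, PowerSeries.coeff_mk, pE_zero' _ _ _ h]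

lemma Od_colE (a : ℕ → ℕ) : Od (fun s => ∑ k ∈ Finset.range (a s), Es k s) := by
  intro N k h
  simp only [map_sum]
  exact Finset.sum_eq_zero fun s _ => by rw [Es, PowerSeries.coeff_mk, pE_zero _ _ _ h]

lemma sum_lt (N a : ℕ) (f : ℕ → ℤ) (hf : ∀ s, N < s → f s = 0) :
    ∑ s ∈ Finset.range (N + 1), (if s < a then 1 else 0) * f s = ∑ s ∈ Finset.range a, f s := by
  simp only [ite_mul, one_mul, zero_mul]
  rw [← Finset.sum_filter]
  refine Finset.sum_subset (fun x hx => ?_) fun x hx hx' => ?_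
  · rw [Finset.mem_filter] at hx; exact Finset.mem_range.2 hx.2
  · apply hf
    rw [Finset.mem_filter, Finset.mem_range] at hx'
    rw [Finset.mem_range] at hx
    by_contra hc
    exact hx' ⟨by omega, hx⟩

lemma Sr_row (a : ℕ → ℕ) : Sr (fun k s => if s < a k then 1 else 0) = ser (fun k => ∑ s ∈ Finset.range (a k), Es k s) := by
  ext N
  rw [Sr, ser, PowerSeries.coeff_mk, PowerSeries.coeff_mk]
  refine Finset.sum_congr rfl fun k _ => ?_
  rw [sum_lt _ _ _ (fun s hs => pE_zero _ _ _ hs), map_sum]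
  simp [Es]

lemma Sr_col (a : ℕ → ℕ) : Sr (fun k s => if k < a s then 1 else 0) = ser (fun s => ∑ k ∈ Finset.range (a s), Es k s) := by
  ext N
  rw [Sr, ser, PowerSeries.coeff_mk, PowerSeries.coeff_mk, Finset.sum_comm]
  refine Finset.sum_congr rfl fun k _ => ?_
  rw [sum_lt _ _ (fun j => pE j k N) (fun s hs => pE_zero' _ _ _ hs), map_sum]
  simp [Es]

lemma sum_Es (a s : ℕ) : ∑ k ∈ Finset.range (a + 1), Es k s = Fs a s := by
  induction a with
  | zero => simp [Es_zero]
  | succ a ih => rw [Finset.sum_range_succ, ih, Es_succ]; ring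

noncomputable def Qs (c : ℕ) : PowerSeries ℤ := Sr (fun k s => if s < k + c + 1 then 1 else 0)
noncomputable def As (c : ℕ) : PowerSeries ℤ := Sr (fun k s => if k < s + c + 1 then 1 else 0)
noncomputable def Vs (m : ℕ) : PowerSeries ℤ := Sr (fun k s => if s < k + 1 - m then 1 else 0)
noncomputable def Ws (m : ℕ) : PowerSeries ℤ := Sr (fun k s => if k < s + 1 - m then 1 else 0)
noncomputable def Ps : PowerSeries ℤ := Sr (fun _ _ => 1)

noncomputable def T1 (c : ℕ) : PowerSeries ℤ :=
  ser (fun k => PowerSeries.X ^ (2 * k) * Fle k (k + c)) + ser (fun k => PowerSeries.X ^ (2 * k + 1) * Fle k (k + c + 1))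
noncomputable def T2 (c : ℕ) : PowerSeries ℤ :=
  ser (fun k => PowerSeries.X ^ (2 * k) * Fle (k + c) k) + ser (fun k => PowerSeries.X ^ (2 * k + 1) * Fle (k + c + 1) k)

lemma Sr_add (v w : ℕ → ℕ → ℤ) : Sr (fun k s => v k s + w k s) = Sr v + Sr w := by
  ext N
  simp [Sr, add_mul, Finset.sum_add_distrib]

lemma Q_add_W (c : ℕ) : Qs c + Ws (c + 1) = Ps := by
  rw [Qs, Ws, Ps, ← Sr_add]
  congr 1
  ext k s
  split_ifs <;> first | rfl | omega

lemma A_add_V (c : ℕ) : As c + Vs (c + 1) = Ps := by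
  rw [As, Vs, Ps, ← Sr_add]
  congr 1
  ext k s
  split_ifs <;> first | rfl | omega

lemma Q_succ (c : ℕ) : Qs (c + 1) = T1 c := by
  rw [Qs, Sr_row, ser_succ (Od_rowE _), T1, ser_succ (Od_X _ _ (fun k => by omega))]
  change Ele 0 _ + ser (fun k => Ele (k + 1) _) = _
  rw [Ele_zero_left, Fle_zero_left, mul_zero, pow_zero, one_mul, add_assoc, ← ser_add]
  congr 2
  ext1 k
  rw [show k + 1 + (c + 1) = k + c + 1 + 1 by ring, Ele_succ, show k + 1 + c = k + c + 1 by ring,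
    show 2 * (k + 1) = 2 * k + 2 by ring]
  ring

lemma Q_zero : Qs 0 = 1 + PowerSeries.X * T2 0 := by
  rw [Qs, Sr_row, ser_succ (Od_rowE _), T2, mul_add, ← ser_mul (Od_X _ _ (fun k => by omega)),
    ← ser_mul (Od_X _ _ (fun k => by omega)), ← ser_add]
  change Ele 0 _ + ser (fun k => Ele (k + 1) _) = _
  rw [Ele_zero_left]
  congr 2
  ext1 k
  rw [add_zero, Ele_succ]
  ring

lemma A_succ (c : ℕ) : As (c + 1) = T2 c := by
  rw [As, Sr_col, ser_succ (Od_colE _), T2, ser_succ (Od_X _ _ (fun k => by omega))]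
  simp only [sum_Es]
  rw [Fs_zero, Fle_zero, mul_zero, pow_zero, one_mul, add_assoc, ← ser_add]
  congr 2
  ext1 k
  rw [show k + 1 + (c + 1) = k + c + 1 + 1 by ring, Fs_conj, show k + 1 + c = k + c + 1 by ring,
    show 2 * (k + 1) = 2 * k + 2 by ring]

lemma W_eq (j : ℕ) : Ws (j + 1) = PowerSeries.X ^ (2 * (j + 1) + 1) * T1 (j + 1) := by
  have e : Ws (j + 1) = ser (fun s => Fs s (s + (j + 1))) := by
    rw [Ws, Sr_col, ser_shift (Od_colE _) (j + 1)]
    · congr 1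
      ext1 s
      rw [show s + (j + 1) + 1 - (j + 1) = s + 1 by omega, sum_Es]
    · intro s hs
      rw [show s + 1 - (j + 1) = 0 by omega]; rfl
  have hO : Od (fun s => Fs s (s + (j + 1))) := by
    intro N k h
    simp only
    rw [Fs, PowerSeries.coeff_mk, pF_zero _ _ _ (by omega)]
  rw [e, ser_succ hO, T1, mul_add, ← ser_mul (Od_X _ _ (fun k => by omega)),
    ← ser_mul (Od_X _ _ (fun k => by omega)), ← ser_add, zero_add, Fs_zero_succ, zero_add]
  congr 1
  ext1 k
  rw [show k + 1 + (j + 1) = k + (j + 1) + 1 by ring, Fs_conj]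
  ring

lemma V_eq (m : ℕ) : Vs (m + 1) = PowerSeries.X ^ (2 * (m + 1) + 1) * T2 (m + 1) := by
  have hO := Od_rowE (fun k => k + 1 - (m + 1))
  have hO2 : Od (fun k => Ele (k + (m + 1)) k) := by
    intro N k h
    simp only
    rw [Ele, map_sum]
    exact Finset.sum_eq_zero fun s _ => by rw [Es, PowerSeries.coeff_mk, pE_zero' _ _ _ (by omega)]
  have e : Vs (m + 1) = ser (fun k => Ele (k + (m + 1)) k) := by
    rw [Vs, Sr_row, ser_shift hO (m + 1)]
    · congr 1
      ext1 s
      rw [show s + (m + 1) + 1 - (m + 1) = s + 1 by omega]; rfl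
    · intro s hs
      rw [show s + 1 - (m + 1) = 0 by omega]; rfl
  rw [e, ser_succ hO2, T2, mul_add, ← ser_mul (Od_X _ _ (fun k => by omega)),
    ← ser_mul (Od_X _ _ (fun k => by omega)), ← ser_add, zero_add, Ele_succ_zero, zero_add]
  congr 1
  ext1 k
  rw [show k + 1 + (m + 1) = k + (m + 1) + 1 by ring, Ele_succ]
  ring

lemma V_rec (m : ℕ) : Vs (m + 1) = PowerSeries.X ^ (2 * (m + 1) + 1) * (Ps - Vs (m + 3)) := by
  rw [V_eq, ← A_succ, ← A_add_V (m + 2)]; ring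

lemma W_rec (m : ℕ) : Ws (m + 1) = PowerSeries.X ^ (2 * (m + 1) + 1) * (Ps - Ws (m + 3)) := by
  rw [W_eq, ← Q_succ, ← Q_add_W (m + 2)]; ring

lemma PW_rec : Ps - Ws 1 = 1 + PowerSeries.X * (Ps - Vs 2) := by
  have h1 := Q_add_W 0
  have h2 := A_add_V 1
  rw [Q_zero, ← A_succ] at h1
  linear_combination PowerSeries.X * h2 - h1

lemma Zs_ser (m : ℕ) : Zs m = ser (fun k => PowerSeries.C ((-1) ^ k) * PowerSeries.X ^ (2 * k ^ 2 + 3 * k + 1 + 2 * m * (k + 1))) := by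
  ext N
  rw [Zs, fs, ser, PowerSeries.coeff_mk, PowerSeries.coeff_mk]
  refine Finset.sum_congr rfl fun k _ => ?_
  rw [PowerSeries.coeff_C_mul, PowerSeries.coeff_X_pow]
  simp only [eq_comm (a := N), mul_ite, mul_one, mul_zero]

lemma Od_Z (m : ℕ) : Od (fun k => PowerSeries.C ((-1 : ℤ) ^ k) * PowerSeries.X ^ (2 * k ^ 2 + 3 * k + 1 + 2 * m * (k + 1))) := by
  intro N k h
  rw [PowerSeries.coeff_C_mul, PowerSeries.coeff_X_pow, if_neg, mul_zero]
  have := (quad_mono m).le_apply (x := k)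
  omega

lemma Z_rec (m : ℕ) : Zs m = PowerSeries.X ^ (2 * m + 1) * (1 - Zs (m + 2)) := by
  rw [Zs_ser m, ser_succ (Od_Z m), mul_sub, Zs_ser (m + 2)]
  have : ser (fun k => PowerSeries.C ((-1 : ℤ) ^ (k + 1)) * PowerSeries.X ^ (2 * (k + 1) ^ 2 + 3 * (k + 1) + 1 + 2 * m * (k + 1 + 1)))
    = -PowerSeries.X ^ (2 * m + 1) * ser (fun k => PowerSeries.C ((-1) ^ k) * PowerSeries.X ^ (2 * k ^ 2 + 3 * k + 1 + 2 * (m + 2) * (k + 1))) := by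
    rw [← ser_mul (Od_Z (m + 2))]
    congr 1
    ext1 k
    rw [pow_succ (-1 : ℤ) k]
    simp only [map_mul, map_neg, map_one, map_pow]
    ring
  rw [this]
  simp only [pow_zero, map_one]
  ring

lemma rec_zero (D : ℕ → PowerSeries ℤ) (h : ∀ m, D (m + 1) = -(PowerSeries.X ^ (2 * (m + 1) + 1) * D (m + 3))) (m : ℕ) : D (m + 1) = 0 := by
  ext N
  rw [map_zero]
  induction N using Nat.strong_induction_on generalizing m with
  | _ N ih =>
    rw [h, map_neg, PowerSeries.coeff_X_pow_mul']
    split_ifs with hh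
    · rw [ih _ (by omega) (m + 2), neg_zero]
    · simp

lemma V_PZ (m : ℕ) : Vs (m + 1) = Ps * Zs (m + 1) := by
  have := rec_zero (fun m => Vs m - Ps * Zs m) (fun m => by
    rw [V_rec, Z_rec (m + 1)]; ring) m
  exact sub_eq_zero.1 this

lemma W_PZ (m : ℕ) : Ws (m + 1) = Ps * Zs (m + 1) := by
  have := rec_zero (fun m => Ws m - Ps * Zs m) (fun m => by
    rw [W_rec, Z_rec (m + 1)]; ring) m
  exact sub_eq_zero.1 this

lemma P_psi : Ps * psi = 1 := by
  have h := PW_rec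
  rw [W_PZ 0, V_PZ 1] at h
  have h0 := Z_rec 0
  rw [psi]
  simp only [mul_zero, zero_add, pow_one] at h h0
  rw [h0]
  linear_combination h
end part_P3

section part_P4
open Filter Topology
noncomputable def Gz (ζ : ℂ) : PowerSeries ℂ :=
  PowerSeries.mk fun N => ∑ k ∈ Finset.range (N + 1), ∑ s ∈ Finset.range (N + 1), ζ ^ ((k : ℤ) - s) * (pE k s N : ℂ)

lemma tele_up (ζ : ℂ) (N d : ℕ) (hd : d ≤ N) :
    ζ ^ d = 1 + ∑ m ∈ Finset.range (N + 1), (if m < d then 1 else 0) * (ζ ^ (m + 1) - ζ ^ m) := by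
  simp only [ite_mul, one_mul, zero_mul]
  rw [← Finset.sum_filter]
  have : (Finset.range (N + 1)).filter (fun m => m < d) = Finset.range d := by
    ext m; simp only [Finset.mem_filter, Finset.mem_range]; omega
  rw [this, Finset.sum_range_sub]
  simp

lemma zpow_decomp (ζ : ℂ) (N k s : ℕ) (hk : k ≤ N) (hs : s ≤ N) :
    ζ ^ ((k : ℤ) - s) = 1 + ∑ m ∈ Finset.range (N + 1), ((if s < k + 1 - (m + 1) then 1 else 0) * (ζ ^ (m + 1) - ζ ^ m)
      + (if k < s + 1 - (m + 1) then 1 else 0) * (ζ⁻¹ ^ (m + 1) - ζ⁻¹ ^ m)) := by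
  rw [Finset.sum_add_distrib]
  rcases le_total s k with h | h
  · rw [show (k : ℤ) - s = ((k - s : ℕ) : ℤ) by omega, zpow_natCast, tele_up ζ N (k - s) (by omega)]
    rw [Finset.sum_eq_zero (f := fun m => (if k < s + 1 - (m + 1) then (1 : ℂ) else 0) * (ζ⁻¹ ^ (m + 1) - ζ⁻¹ ^ m)), add_zero]
    · congr 1
      refine Finset.sum_congr rfl fun m _ => ?_
      congr 1
      exact if_congr (by omega) rfl rfl
    · intro m _
      rw [if_neg (by omega), zero_mul]
  · rw [show (k : ℤ) - s = -((s - k : ℕ) : ℤ) by omega, zpow_neg, zpow_natCast, ← inv_pow, tele_up ζ⁻¹ N (s - k) (by omega)]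
    rw [Finset.sum_eq_zero (f := fun m => (if s < k + 1 - (m + 1) then (1 : ℂ) else 0) * (ζ ^ (m + 1) - ζ ^ m)), zero_add]
    · congr 1
      refine Finset.sum_congr rfl fun m _ => ?_
      congr 1
      exact if_congr (by omega) rfl rfl
    · intro m _
      rw [if_neg (by omega), zero_mul]

lemma coeff_toC_Sr (w : ℕ → ℕ → ℤ) (N : ℕ) : PowerSeries.coeff N (toC (Sr w)) =
    ∑ k ∈ Finset.range (N + 1), ∑ s ∈ Finset.range (N + 1), (w k s : ℂ) * (pE k s N : ℂ) := by
  rw [coeff_toC, Sr, PowerSeries.coeff_mk]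
  push_cast
  rfl

noncomputable def cz (ζ : ℂ) (m : ℕ) : ℂ := (ζ ^ (m + 1) - ζ ^ m) + (ζ⁻¹ ^ (m + 1) - ζ⁻¹ ^ m)

lemma Gz_eq (ζ : ℂ) : Gz ζ = toC Ps + ser (fun m => PowerSeries.C (ζ ^ (m + 1) - ζ ^ m) * toC (Vs (m + 1))
    + PowerSeries.C (ζ⁻¹ ^ (m + 1) - ζ⁻¹ ^ m) * toC (Ws (m + 1))) := by
  ext N
  rw [Gz, ser, map_add, PowerSeries.coeff_mk, PowerSeries.coeff_mk]
  have e : ∀ t : ℕ → ℕ → ℕ → ℂ, ∑ k ∈ Finset.range (N + 1), ∑ s ∈ Finset.range (N + 1), ∑ m ∈ Finset.range (N + 1), t m k s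
      = ∑ m ∈ Finset.range (N + 1), ∑ k ∈ Finset.range (N + 1), ∑ s ∈ Finset.range (N + 1), t m k s := by
    intro t
    rw [Finset.sum_comm (s := Finset.range (N + 1)) (t := Finset.range (N + 1)) (f := fun m k => ∑ s ∈ Finset.range (N + 1), t m k s)]
    exact Finset.sum_congr rfl fun k _ => Finset.sum_comm
  have e2 : ∀ k ∈ Finset.range (N + 1), ∀ s ∈ Finset.range (N + 1), ζ ^ ((k : ℤ) - s) * (pE k s N : ℂ) =
      ((1 : ℤ) : ℂ) * (pE k s N : ℂ) + ∑ m ∈ Finset.range (N + 1),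
        ((ζ ^ (m + 1) - ζ ^ m) * (((if s < k + 1 - (m + 1) then 1 else 0 : ℤ) : ℂ) * (pE k s N : ℂ))
        + (ζ⁻¹ ^ (m + 1) - ζ⁻¹ ^ m) * (((if k < s + 1 - (m + 1) then 1 else 0 : ℤ) : ℂ) * (pE k s N : ℂ))) := by
    intro k hk s hs
    rw [Finset.mem_range] at hk hs
    rw [zpow_decomp ζ N k s (by omega) (by omega), add_mul, Finset.sum_mul]
    congr 1
    · simp
    · refine Finset.sum_congr rfl fun m _ => ?_
      push_cast
      ring
  rw [Finset.sum_congr rfl fun k hk => Finset.sum_congr rfl fun s hs => e2 k hk s hs]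
  simp only [Finset.sum_add_distrib]
  simp only [map_add, PowerSeries.coeff_C_mul, Vs, Ws, Ps, coeff_toC_Sr]
  simp only [Finset.sum_add_distrib]
  simp only [Finset.mul_sum]
  congr 1
  congr 1
  · exact e (fun m k s => (ζ ^ (m + 1) - ζ ^ m) * (((if s < k + 1 - (m + 1) then 1 else 0 : ℤ) : ℂ) * (pE k s N : ℂ)))
  · exact e (fun m k s => (ζ⁻¹ ^ (m + 1) - ζ⁻¹ ^ m) * (((if k < s + 1 - (m + 1) then 1 else 0 : ℤ) : ℂ) * (pE k s N : ℂ)))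

lemma coeff_Zs_lt (m N : ℕ) (h : N < 2 * m + 1) : PowerSeries.coeff N (Zs m) = 0 := by
  rw [Z_rec, PowerSeries.coeff_X_pow_mul', if_neg (by omega)]

lemma Od_cZ (ζ : ℂ) : Od (fun m => PowerSeries.C (cz ζ m) * toC (Zs (m + 1))) := by
  intro N m h
  simp only
  rw [PowerSeries.coeff_C_mul, coeff_toC, coeff_Zs_lt _ _ (by omega)]
  simp

lemma Gz_eq2 (ζ : ℂ) : Gz ζ = toC Ps * (1 + ser (fun m => PowerSeries.C (cz ζ m) * toC (Zs (m + 1)))) := by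
  rw [Gz_eq, mul_add, mul_one, ← ser_mul (Od_cZ ζ)]
  congr 2
  ext1 m
  rw [V_PZ, W_PZ, map_mul, cz, map_add]
  ring

lemma Y_eq {ζ : ℂ} (h0 : ζ ≠ 0) (h1 : ζ ≠ 1) :
    1 + ser (fun m => PowerSeries.C (cz ζ m) * toC (Zs (m + 1))) = PowerSeries.C (1 - ζ) * Th ζ := by
  have hz : 1 - ζ ≠ 0 := sub_ne_zero.2 h1.symm
  rw [Th, mul_add, ← map_mul, mul_one_div_cancel hz, map_one]
  congr 1
  ext N
  rw [PowerSeries.coeff_C_mul, ser, PowerSeries.coeff_mk, lamb, PowerSeries.coeff_mk, Finset.mul_sum]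
  simp only [PowerSeries.coeff_C_mul, coeff_toC, Zs, fs, PowerSeries.coeff_mk]
  push_cast
  simp only [Finset.mul_sum]
  rw [← Finset.sum_product' (f := fun m i => cz ζ m * (if 2 * i ^ 2 + 3 * i + 1 + 2 * (m + 1) * (i + 1) = N then (-1 : ℂ) ^ i else 0))]
  rw [← Finset.sum_filter_add_sum_filter_not N.divisorsAntidiagonal (fun x => x.2 % 2 = 1 ∧ x.1 ≤ x.2 / 2)]
  rw [Finset.sum_eq_zero (s := N.divisorsAntidiagonal.filter (fun x => ¬(x.2 % 2 = 1 ∧ x.1 ≤ x.2 / 2))), add_zero]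
  rw [← Finset.sum_filter_add_sum_filter_not (Finset.range (N + 1) ×ˢ Finset.range (N + 1))
    (fun x => 2 * x.2 ^ 2 + 3 * x.2 + 1 + 2 * (x.1 + 1) * (x.2 + 1) = N)]
  rw [Finset.sum_eq_zero (s := (Finset.range (N + 1) ×ˢ Finset.range (N + 1)).filter
    (fun x => ¬ (2 * x.2 ^ 2 + 3 * x.2 + 1 + 2 * (x.1 + 1) * (x.2 + 1) = N))), add_zero]
  · refine Finset.sum_bij' (fun x _ => (x.2 + 1, 2 * x.2 + 2 * x.1 + 3)) (fun x _ => (x.2 / 2 - x.1, x.1 - 1)) ?_ ?_ ?_ ?_ ?_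
    · intro x hx
      rw [Finset.mem_filter] at hx
      rw [Finset.mem_filter, Nat.mem_divisorsAntidiagonal]
      refine ⟨⟨?_, by omega⟩, by simp only; omega, by simp only; omega⟩
      simp only
      rw [← hx.2]; ring
    · rintro ⟨n, M⟩ hx
      rw [Finset.mem_filter, Nat.mem_divisorsAntidiagonal] at hx
      obtain ⟨⟨h1, h2⟩, h3, h4⟩ := hx
      simp only at h1 h2 h3 h4
      obtain ⟨n, rfl⟩ : ∃ n', n = n' + 1 := Nat.exists_eq_succ_of_ne_zero (by rintro rfl; simp at h1; omega)
      obtain ⟨m, rfl⟩ : ∃ m, M = 2 * n + 2 * m + 3 := ⟨(M - (2 * n + 3)) / 2, by omega⟩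
      have e1 : (2 * n + 2 * m + 3) / 2 - (n + 1) = m := by omega
      have e : 2 * n ^ 2 + 3 * n + 1 + 2 * (m + 1) * (n + 1) = N := by rw [← h1]; ring
      simp only [e1, add_tsub_cancel_right, Finset.mem_filter, Finset.mem_product, Finset.mem_range]
      refine ⟨⟨?_, ?_⟩, e⟩ <;> nlinarith
    · rintro ⟨m, n⟩ hx
      simp only [Prod.mk.injEq]
      omega
    · rintro ⟨n, M⟩ hx
      rw [Finset.mem_filter, Nat.mem_divisorsAntidiagonal] at hx
      obtain ⟨⟨h1, h2⟩, h3, h4⟩ := hx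
      simp only at h1 h2 h3 h4
      have : n ≠ 0 := by rintro rfl; simp at h1; omega
      simp only [Prod.mk.injEq]
      omega
    · rintro ⟨m, n⟩ hx
      rw [Finset.mem_filter] at hx
      simp only
      rw [if_pos hx.2, wT, if_pos ⟨by omega, by omega⟩,
        show (2 * n + 2 * m + 3) / 2 - (n + 1) = m by omega, cz]
      push_cast
      simp only [zero_mul, neg_zero, zero_add, one_mul, zero_sub, pow_succ]
      rw [neg_add, zpow_add₀ h0, zpow_natCast, zpow_neg, zpow_neg, zpow_natCast, zpow_one, inv_pow]
      have : ζ * ζ⁻¹ = 1 := mul_inv_cancel₀ h0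
      linear_combination (-1 : ℂ) ^ n * (ζ ^ m)⁻¹ * this
  · intro x hx
    rw [Finset.mem_filter] at hx
    rw [if_neg hx.2]; simp
  · intro x hx
    rw [Finset.mem_filter] at hx
    rw [wT, if_neg hx.2, mul_zero]

lemma main_series {ζ : ℂ} (h5 : ζ ^ 5 = 1) (h1 : ζ ≠ 1) :
    PowerSeries.C (-5) * PowerSeries.X ^ 3 * Gz ζ =
      PowerSeries.C (1 - ζ) * Rh ζ * PowerSeries.expand 25 (by norm_num) (toC Ps) := by
  have hm := formal_main h5 h1
  have hG := Gz_eq2 ζ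
  rw [Y_eq (zeta_ne0 h5) h1] at hG
  have hp : toC Ps * toC psi = 1 := by rw [← map_mul, P_psi, map_one]
  have hpe : PowerSeries.expand 25 (by norm_num) (toC Ps) * PowerSeries.expand 25 (by norm_num) (toC psi) = 1 := by
    rw [← map_mul, hp, map_one]
  rw [hG]
  set e1 := PowerSeries.expand 25 (by norm_num) (toC Ps)
  set e2 := PowerSeries.expand 25 (by norm_num) (toC psi)
  linear_combination (PowerSeries.C (1 - ζ) * toC Ps * e1) * hm + PowerSeries.C (1 - ζ) * e1 * Rh ζ * hp
    - (PowerSeries.C (-5) * PowerSeries.X ^ 3 * toC Ps * PowerSeries.C (1 - ζ) * Th ζ) * hpe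
end part_P4

section part_P5
open Filter Topology
def dl (e : ℤ) (i : ℕ) : ℤ := if e % 5 = i then 1 else 0

lemma dl_mod {e e' : ℤ} (h : e % 5 = e' % 5) (i : ℕ) : dl e i = dl e' i := by rw [dl, dl, h]

lemma zpow_dl {ζ : ℂ} (h5 : ζ ^ 5 = 1) (e : ℤ) : ζ ^ e = ∑ i ∈ Finset.range 5, (dl e i : ℂ) * ζ ^ i := by
  rw [zeta_zpow_mod h5]
  have h1 : 0 ≤ e % 5 := by omega
  have h2 : e % 5 < 5 := by omega
  rw [Finset.sum_eq_single (e % 5).toNat]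
  · rw [dl, if_pos (by omega)]; simp
  · intro b _ hb
    rw [dl, if_neg (by omega)]; simp
  · intro h
    rw [Finset.mem_range] at h; omega

def hp (n y : ℤ) (i : ℕ) : ℤ := dl (y - n) i + dl (2 * n - 1 - y) i + dl (n + 1 + 3 * y) i + dl (2 * y - 2) i + dl (3 * n + 2) i
  - dl (-y - 1 + n) i - dl (-2 * n + y) i - dl (-n - 2 - 3 * y) i - dl (-2 * y - 4) i - dl (-3 * n + 2) i
def fp (n y : ℤ) (i : ℕ) : ℤ := -dl (2 * n - y - 1) i + dl (y - 2 * n) i - dl (n + 2) i + dl (2 - n) i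
def gp (n : ℤ) (i : ℕ) : ℤ := dl (n + 2) i - dl (2 - n) i + dl (2 * n + 2) i - dl (2 - 2 * n) i
def vv (n M : ℕ) (i : ℕ) : ℤ :=
  if M % 2 = 1 then (-1) ^ n * ((if n ≤ M / 2 then hp n (M / 2 : ℕ) i else 0) + fp n (M / 2 : ℕ) i) else gp n i

lemma wR_vv {ζ : ℂ} (h5 : ζ ^ 5 = 1) (n M : ℕ) : wR ζ n M = ∑ i ∈ Finset.range 5, (vv n M i : ℂ) * ζ ^ i := by
  have h0 := zeta_ne0 h5
  have hd : ∀ (k : ℕ) (e e' : ℤ), (k + e) % 5 = e' % 5 → ζ ^ k * ζ ^ e = ζ ^ e' := by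
    intro k e e' h
    rw [← zpow_natCast, ← zpow_add₀ h0, zeta_zpow_mod h5, zeta_zpow_mod h5 e', h]
  have he : ∀ (e e' : ℤ), e % 5 = e' % 5 → ζ ^ e = ζ ^ e' := by
    intro e e' h
    rw [zeta_zpow_mod h5, zeta_zpow_mod h5 e', h]
  unfold wR wT wL vv
  by_cases hM : M % 2 = 1
  · simp only [hM, true_and, one_ne_zero, if_false, if_true, zero_le]
    by_cases hn : n ≤ M / 2
    · simp only [if_pos hn, Nat.cast_sub hn, Nat.sub_zero]
      generalize hy : ((M / 2 : ℕ) : ℤ) = y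
      generalize hm : (n : ℤ) = m
      have key : ∑ i ∈ Finset.range 5, (((-1) ^ n * (hp m y i + fp m y i) : ℤ) : ℂ) * ζ ^ i =
         (-1) ^ n * (ζ ^ (y - m) + ζ ^ (2 * m - 1 - y) + ζ ^ (m + 1 + 3 * y) + ζ ^ (2 * y - 2) + ζ ^ (3 * m + 2)
          - ζ ^ (-y - 1 + m) - ζ ^ (-2 * m + y) - ζ ^ (-m - 2 - 3 * y) - ζ ^ (-2 * y - 4) - ζ ^ (-3 * m + 2)
          - ζ ^ (2 * m - y - 1) + ζ ^ (y - 2 * m) - ζ ^ (m + 2) + ζ ^ (2 - m)) := by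
        simp only [zpow_dl h5, hp, fp, ← Finset.sum_add_distrib, ← Finset.sum_sub_distrib, Finset.mul_sum]
        refine Finset.sum_congr rfl fun i _ => ?_
        push_cast
        ring
      have e34 : ζ ^ 3 * ζ ^ 4 = ζ ^ 2 := by linear_combination ζ ^ 2 * h5
      have e42 : ζ ^ 4 * ζ ^ 2 = ζ := by linear_combination ζ * h5
      rw [key]
      rw [← hd 4 (1 * m + 4 * (y - m)) (2 * m - 1 - y) (by push_cast; omega),
       ← hd 1 (4 * m + 3 * (y - m)) (m + 1 + 3 * y) (by push_cast; omega),
       ← hd 3 (2 * m + 2 * (y - m)) (2 * y - 2) (by push_cast; omega),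
       ← hd 2 (3 * m + 0 * (y - m)) (3 * m + 2) (by push_cast; omega),
       ← he (0 * m + 1 * (y - m)) (y - m) (by omega),
       ← he (-0 * m - 1 * (1 + (y - m))) (-y - 1 + m) (by omega),
       ← hd 4 (-1 * m - 4 * (1 + (y - m))) (-2 * m + y) (by push_cast; omega),
       ← hd 1 (-4 * m - 3 * (1 + (y - m))) (-m - 2 - 3 * y) (by push_cast; omega),
       ← hd 3 (-2 * m - 2 * (1 + (y - m))) (-2 * y - 4) (by push_cast; omega),
       ← hd 2 (-3 * m - 0 * (1 + (y - m))) (-3 * m + 2) (by push_cast; omega),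
       ← hd 4 (2 * m + 4 * y) (2 * m - y - 1) (by push_cast; omega),
       ← hd 4 (-2 * m - 4 * (1 + y)) (y - 2 * m) (by push_cast; omega),
       ← hd 2 (1 * m + 0 * y) (m + 2) (by push_cast; omega),
       ← hd 2 (-1 * m - 0 * (1 + y)) (2 - m) (by push_cast; omega)]
      generalize ζ ^ (0 * m + 1 * (y - m)) = z1
      generalize ζ ^ (-0 * m - 1 * (1 + (y - m))) = z2
      generalize ζ ^ (1 * m + 4 * (y - m)) = z3
      generalize ζ ^ (-1 * m - 4 * (1 + (y - m))) = z4
      generalize ζ ^ (4 * m + 3 * (y - m)) = z5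
      generalize ζ ^ (-4 * m - 3 * (1 + (y - m))) = z6
      generalize ζ ^ (2 * m + 4 * y) = z7
      generalize ζ ^ (-2 * m - 4 * (1 + y)) = z8
      generalize ζ ^ (2 * m + 2 * (y - m)) = z9
      generalize ζ ^ (-2 * m - 2 * (1 + (y - m))) = z10
      generalize ζ ^ (3 * m + 0 * (y - m)) = z11
      generalize ζ ^ (-3 * m - 0 * (1 + (y - m))) = z12
      generalize ζ ^ (1 * m + 0 * y) = z13
      generalize ζ ^ (-1 * m - 0 * (1 + y)) = z14
      generalize (-1 : ℂ) ^ n = S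
      linear_combination (S * (z5 - z6)) * e42 + S * (z11 - z12 - (z13 - z14)) * e34
    · simp only [if_neg hn, Nat.sub_zero]
      generalize hy : ((M / 2 : ℕ) : ℤ) = y
      generalize hm : (n : ℤ) = m
      have key : ∑ i ∈ Finset.range 5, (((-1) ^ n * (0 + fp m y i) : ℤ) : ℂ) * ζ ^ i =
         (-1) ^ n * (- ζ ^ (2 * m - y - 1) + ζ ^ (y - 2 * m) - ζ ^ (m + 2) + ζ ^ (2 - m)) := by
        simp only [zpow_dl h5, fp, ← Finset.sum_add_distrib, ← Finset.sum_sub_distrib, Finset.mul_sum, ← Finset.sum_neg_distrib]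
        refine Finset.sum_congr rfl fun i _ => ?_
        push_cast
        ring
      have e34 : ζ ^ 3 * ζ ^ 4 = ζ ^ 2 := by linear_combination ζ ^ 2 * h5
      rw [key]
      rw [← hd 4 (2 * m + 4 * y) (2 * m - y - 1) (by push_cast; omega),
       ← hd 4 (-2 * m - 4 * (1 + y)) (y - 2 * m) (by push_cast; omega),
       ← hd 2 (1 * m + 0 * y) (m + 2) (by push_cast; omega),
       ← hd 2 (-1 * m - 0 * (1 + y)) (2 - m) (by push_cast; omega)]
      generalize ζ ^ (2 * m + 4 * y) = z7
      generalize ζ ^ (-2 * m - 4 * (1 + y)) = z8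
      generalize ζ ^ (1 * m + 0 * y) = z13
      generalize ζ ^ (-1 * m - 0 * (1 + y)) = z14
      generalize (-1 : ℂ) ^ n = S
      linear_combination S * (- (z13 - z14)) * e34
  · have hM2 : M % 2 = 0 := by omega
    simp only [hM2, false_and, if_true, zero_ne_one, if_false]
    generalize hm : (n : ℤ) = m
    have key : ∑ i ∈ Finset.range 5, ((gp m i : ℤ) : ℂ) * ζ ^ i =
         ζ ^ (m + 2) - ζ ^ (2 - m) + ζ ^ (2 * m + 2) - ζ ^ (2 - 2 * m) := by
      simp only [zpow_dl h5, gp, ← Finset.sum_add_distrib, ← Finset.sum_sub_distrib]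
      refine Finset.sum_congr rfl fun i _ => ?_
      push_cast
      ring
    have e34 : ζ ^ 3 * ζ ^ 4 = ζ ^ 2 := by linear_combination ζ ^ 2 * h5
    rw [key]
    rw [← hd 2 (1 * m) (m + 2) (by push_cast; omega), ← hd 2 (-1 * m) (2 - m) (by push_cast; omega),
      ← hd 2 (2 * m) (2 * m + 2) (by push_cast; omega), ← hd 2 (-2 * m) (2 - 2 * m) (by push_cast; omega)]
    linear_combination (ζ ^ (1 * m) - ζ ^ (-1 * m) + ζ ^ (2 * m) - ζ ^ (-2 * m)) * e34

lemma Gz_N2 {ζ : ℂ} (h5 : ζ ^ 5 = 1) (n : ℕ) : PowerSeries.coeff n (Gz ζ) =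
    ∑ r ∈ Finset.range 5, ((N2 r 5 n : ℤ) : ℂ) * ζ ^ r := by
  rw [Gz, PowerSeries.coeff_mk]
  simp only [N2_eq, zpow_dl h5, Finset.sum_mul]
  push_cast
  simp only [Finset.sum_mul]
  rw [Finset.sum_comm (s := Finset.range 5)]
  refine Finset.sum_congr rfl fun k _ => ?_
  rw [Finset.sum_comm (s := Finset.range 5)]
  refine Finset.sum_congr rfl fun s _ => Finset.sum_congr rfl fun r hr => ?_
  rw [Finset.mem_range] at hr
  rw [dl]
  by_cases h : ((k : ℤ) - s) % 5 = r
  · rw [if_pos h, if_pos]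
    · push_cast; ring
    · rw [Int.ModEq]; omega
  · rw [if_neg h, if_neg]
    · simp
    · rw [Int.ModEq]; omega

lemma coeff_mul_expand (A B : PowerSeries ℂ) (n : ℕ) : PowerSeries.coeff n (A * PowerSeries.expand 25 (by norm_num) B) =
    ∑ k ∈ Finset.range (n / 25 + 1), PowerSeries.coeff k B * PowerSeries.coeff (n - 25 * k) A := by
  rw [PowerSeries.coeff_mul, Finset.Nat.sum_antidiagonal_eq_sum_range_succ_mk]
  simp only [PowerSeries.coeff_expand]
  rw [← Finset.sum_range_reflect]
  symm
  refine Finset.sum_of_injOn (fun k => 25 * k) (fun a _ b _ h => by simpa using h) ?_ ?_ ?_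
  · intro k hk
    simp only [Finset.coe_range, Set.mem_Iio] at *
    omega
  · intro m hm hm'
    rw [Finset.mem_range] at hm
    rw [if_neg, mul_zero]
    rintro ⟨d, hd⟩
    apply hm'
    refine ⟨d, ?_, ?_⟩
    · simp only [Finset.coe_range, Set.mem_Iio]; omega
    · simp only; omega
  · intro k hk
    rw [Finset.mem_range] at hk
    have e : n - (n + 1 - 1 - 25 * k) = 25 * k := by omega
    rw [e, if_pos ⟨k, rfl⟩, Nat.mul_div_cancel_left _ (by norm_num), mul_comm]
    congr 2
lemma R0_zero {ζ : ℂ} (h5 : ζ ^ 5 = 1) (h1 : ζ ≠ 1) : R0 ζ = 0 := by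
  have h := congrArg (PowerSeries.coeff 0) (main_series h5 h1)
  rw [coeff_mul_expand] at h
  have hp : PowerSeries.coeff 0 (toC Ps) = 1 := by
    rw [coeff_toC, Ps, Sr, PowerSeries.coeff_mk]; simp [pE, pF]
  simp only [Nat.zero_div, zero_add, Finset.sum_range_one, hp, mul_zero, Nat.sub_zero] at h
  rw [mul_assoc, PowerSeries.coeff_C_mul, PowerSeries.coeff_X_pow_mul', if_neg (by norm_num), PowerSeries.coeff_C_mul, Rh, map_add] at h
  simp [lamb] at h
  rcases h with h | h
  · exact absurd (sub_eq_zero.1 h).symm h1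
  · exact h

def dd (i : ℕ) (n M : ℕ) : ℤ := vv n M i - vv n M ((i + 4) % 5)

lemma cyc {ζ : ℂ} (hζ : IsPrimitiveRoot ζ 5) (c : ℕ → ℤ) (h : ∑ i ∈ Finset.range 5, (c i : ℂ) * ζ ^ i = 0)
    (i j : ℕ) (hi : i < 5) (hj : j < 5) : c i = c j := by
  have h5 := hζ.pow_eq_one
  have h1 := hζ.ne_one (by norm_num)
  have hg : 1 + ζ + ζ ^ 2 + ζ ^ 3 + ζ ^ 4 = 0 := by
    have : (1 - ζ) * (1 + ζ + ζ ^ 2 + ζ ^ 3 + ζ ^ 4) = 0 := by linear_combination -h5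
    exact (mul_eq_zero.1 this).resolve_left (sub_ne_zero.2 h1.symm)
  let p : Polynomial ℤ := ∑ i ∈ Finset.range 4, Polynomial.C (c i - c 4) * Polynomial.X ^ i
  have hp : Polynomial.aeval ζ p = 0 := by
    simp only [p, map_sum, map_mul, Polynomial.aeval_X, map_pow, Polynomial.aeval_C]
    simp only [Finset.sum_range_succ, Finset.sum_range_zero] at h ⊢
    simp only [algebraMap_int_eq, eq_intCast, Int.cast_sub]
    linear_combination h - (c 4 : ℂ) * hg
  have hzInt : IsIntegral ℤ ζ := hζ.isIntegral (by norm_num)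
  have hdvd := minpoly.isIntegrallyClosed_dvd hzInt hp
  rw [← Polynomial.cyclotomic_eq_minpoly hζ (by norm_num)] at hdvd
  have hdeg : p.degree < (Polynomial.cyclotomic 5 ℤ).degree := by
    rw [Polynomial.degree_cyclotomic]
    have : Nat.totient 5 = 4 := by decide
    rw [this]
    refine (Polynomial.degree_sum_le _ _).trans_lt ?_
    rw [Finset.sup_lt_iff (by exact_mod_cast WithBot.bot_lt_coe 4)]
    intro b hb
    refine (Polynomial.degree_C_mul_X_pow_le b _).trans_lt ?_
    exact_mod_cast Finset.mem_range.1 hb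
  have hp0 := Polynomial.eq_zero_of_dvd_of_degree_lt hdvd hdeg
  have hc : ∀ i < 4, c i = c 4 := by
    intro i hi
    have := congrArg (fun q => Polynomial.coeff q i) hp0
    simp only [p, Polynomial.finsetSum_coeff, Polynomial.coeff_C_mul, Polynomial.coeff_X_pow, Polynomial.coeff_zero] at this
    simp only [mul_ite, mul_one, mul_zero] at this
    rw [Finset.sum_ite_eq, if_pos (Finset.mem_range.2 hi)] at this
    omega
  have hc' : ∀ i < 5, c i = c 4 := by
    intro i hi
    rcases Nat.lt_succ_iff_lt_or_eq.1 hi with h | rfl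
    · exact hc i h
    · rfl
  rw [hc' i hi, hc' j hj]

noncomputable def pc (k : ℕ) : ℤ := PowerSeries.coeff k Ps

lemma diff_formula (idx i j : ℕ) (hi : i < 5) (hj : j < 5) :
    -5 * ((N2 i 5 idx : ℤ) - N2 j 5 idx) = ∑ k ∈ Finset.range ((idx + 3) / 25 + 1), pc k *
      ∑ x ∈ (idx + 3 - 25 * k).divisorsAntidiagonal, (dd i x.1 x.2 - dd j x.1 x.2) := by
  obtain ⟨ζ, hζ⟩ : ∃ ζ : ℂ, IsPrimitiveRoot ζ 5 := ⟨_, Complex.isPrimitiveRoot_exp 5 (by norm_num)⟩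
  have h5 := hζ.pow_eq_one
  have h1 := hζ.ne_one (by norm_num)
  have h := congrArg (PowerSeries.coeff (idx + 3)) (main_series h5 h1)
  rw [coeff_mul_expand, mul_assoc, PowerSeries.coeff_C_mul, PowerSeries.coeff_X_pow_mul, Gz_N2 h5] at h
  have hr : ∀ m, PowerSeries.coeff m (PowerSeries.C (1 - ζ) * Rh ζ) =
      ∑ i ∈ Finset.range 5, ((∑ x ∈ m.divisorsAntidiagonal, dd i x.1 x.2 : ℤ) : ℂ) * ζ ^ i := by
    intro m
    rw [PowerSeries.coeff_C_mul, Rh, R0_zero h5 h1, map_zero, zero_add, lamb, PowerSeries.coeff_mk, Finset.mul_sum]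
    push_cast
    simp only [Finset.sum_mul]
    rw [Finset.sum_comm]
    refine Finset.sum_congr rfl fun x _ => ?_
    rw [wR_vv h5]
    simp only [Finset.sum_range_succ, Finset.sum_range_zero, dd]
    push_cast
    norm_num
    linear_combination (-(vv x.1 x.2 4 : ℂ)) * h5
  simp only [hr, coeff_toC] at h
  have h2 : ∑ i ∈ Finset.range 5, ((-5 * (N2 i 5 idx : ℤ) - ∑ k ∈ Finset.range ((idx + 3) / 25 + 1), pc k *
      ∑ x ∈ (idx + 3 - 25 * k).divisorsAntidiagonal, dd i x.1 x.2 : ℤ) : ℂ) * ζ ^ i = 0 := by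
    rw [← sub_eq_zero] at h
    rw [← h]
    simp only [Finset.mul_sum (s := Finset.range 5)]
    rw [Finset.sum_comm (t := Finset.range 5), ← Finset.sum_sub_distrib]
    refine Finset.sum_congr rfl fun i _ => ?_
    push_cast
    rw [sub_mul, Finset.sum_mul]
    congr 1
    · ring
    · refine Finset.sum_congr rfl fun k _ => ?_
      rw [pc]; ring
  have h3 := cyc hζ _ h2 i j hi hj
  simp only [Finset.sum_sub_distrib, mul_sub]
  linarith
end part_P5

section part_P6
open Filter Topology
def av (n : ℕ) : ℤ := if n % 5 = 1 then 1 else if n % 5 = 4 then -1 else 0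
def bv (n : ℕ) : ℤ := if n % 5 = 2 then 1 else if n % 5 = 3 then -1 else 0
def uu (n : ℕ) : ℤ := -((-1) ^ n * av n)
def vu (n : ℕ) : ℤ := (-1) ^ n * bv n

lemma av_mod (n : ℕ) : av n = av (n % 5) := by rw [av, av, Nat.mod_mod]
lemma bv_mod (n : ℕ) : bv n = bv (n % 5) := by rw [bv, bv, Nat.mod_mod]

def hpd (i j : ℕ) (n y : ℤ) : ℤ := -((hp n y i - hp n y ((i + 4) % 5)) - (hp n y j - hp n y ((j + 4) % 5)))
def fpd (i j : ℕ) (n y : ℤ) : ℤ := -((fp n y i - fp n y ((i + 4) % 5)) - (fp n y j - fp n y ((j + 4) % 5)))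
def gpd (i j : ℕ) (n : ℤ) : ℤ := -((gp n i - gp n ((i + 4) % 5)) - (gp n j - gp n ((j + 4) % 5)))

lemma hp_mod (n y : ℤ) (i : ℕ) : hp n y i = hp (n % 5) (y % 5) i := by
  unfold hp
  congr 1
  · congr 1
    · congr 1
      · congr 1
        · congr 1
          · congr 1
            · congr 1
              · congr 1
                · congr 1
                  · exact dl_mod (by omega) i
                  · exact dl_mod (by omega) i
                · exact dl_mod (by omega) i
              · exact dl_mod (by omega) i
            · exact dl_mod (by omega) i
          · exact dl_mod (by omega) i
        · exact dl_mod (by omega) i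
      · exact dl_mod (by omega) i
    · exact dl_mod (by omega) i
  · exact dl_mod (by omega) i

lemma fp_mod (n y : ℤ) (i : ℕ) : fp n y i = fp (n % 5) (y % 5) i := by
  unfold fp
  congr 1
  · congr 1
    · congr 1
      · congr 1
        exact dl_mod (by omega) i
      · exact dl_mod (by omega) i
    · exact dl_mod (by omega) i
  · exact dl_mod (by omega) i

lemma gp_mod (n : ℤ) (i : ℕ) : gp n i = gp (n % 5) i := by
  unfold gp
  congr 1
  · congr 1
    · congr 1
      · exact dl_mod (by omega) i
      · exact dl_mod (by omega) i
    · exact dl_mod (by omega) i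
  · exact dl_mod (by omega) i

lemma raw_eq (i j n M : ℕ) : -(dd i n M - dd j n M) = if M % 2 = 1 then (-1) ^ n *
    ((if n ≤ M / 2 then hpd i j n (M / 2 : ℕ) else 0) + fpd i j n (M / 2 : ℕ)) else gpd i j n := by
  unfold dd vv
  split_ifs <;> simp only [hpd, fpd, gpd] <;> ring

lemma raw_table (i j c : ℕ) (h1 h2 f1 f2 f3 f4 g1 g2 : ℤ)
    (H : ∀ a : ℕ, a < 5 → ∀ y : ℕ, y < 5 → a * (2 * y + 1) % 5 = c → hpd i j a y = h1 * av a + h2 * bv a ∧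
      fpd i j a y = f1 * av a + f2 * bv a + f3 * av (2 * y + 1) + f4 * bv (2 * y + 1))
    (G : ∀ a : ℕ, a < 5 → gpd i j a = g1 * av a + g2 * bv a) (n M : ℕ) (hc : n * M % 5 = c) :
    -(dd i n M - dd j n M) = if M % 2 = 1 then (-1) ^ n * ((if n ≤ M / 2 then h1 * av n + h2 * bv n else 0)
      + (f1 * av n + f2 * bv n + f3 * av M + f4 * bv M)) else g1 * av n + g2 * bv n := by
  rw [raw_eq]
  by_cases hM : M % 2 = 1
  · rw [if_pos hM, if_pos hM]
    have hMy : M = 2 * (M / 2) + 1 := by omega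
    have hcc : (n % 5) * (2 * (M / 2 % 5) + 1) % 5 = c := by
      rw [← hc]; conv_rhs => rw [hMy]
      simp [Nat.mul_mod, Nat.add_mod]
    have h := H (n % 5) (Nat.mod_lt _ (by norm_num)) (M / 2 % 5) (Nat.mod_lt _ (by norm_num)) hcc
    have e1 : hpd i j n (M / 2 : ℕ) = hpd i j (n % 5 : ℕ) (M / 2 % 5 : ℕ) := by
      simp only [hpd]; push_cast
      rw [hp_mod, hp_mod _ _ ((i + 4) % 5), hp_mod _ _ j, hp_mod _ _ ((j + 4) % 5)]
    have e2 : fpd i j n (M / 2 : ℕ) = fpd i j (n % 5 : ℕ) (M / 2 % 5 : ℕ) := by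
      simp only [fpd]; push_cast
      rw [fp_mod, fp_mod _ _ ((i + 4) % 5), fp_mod _ _ j, fp_mod _ _ ((j + 4) % 5)]
    have e3 : av (2 * (M / 2 % 5) + 1) = av M := by
      rw [av_mod, av_mod M]; congr 1; omega
    have e4 : bv (2 * (M / 2 % 5) + 1) = bv M := by
      rw [bv_mod, bv_mod M]; congr 1; omega
    rw [e1, e2, h.1, h.2, e3, e4, ← av_mod, ← bv_mod]
  · rw [if_neg hM, if_neg hM]
    have e1 : gpd i j n = gpd i j (n % 5 : ℕ) := by
      simp only [gpd]; push_cast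
      rw [gp_mod, gp_mod _ ((i + 4) % 5), gp_mod _ j, gp_mod _ ((j + 4) % 5)]
    rw [e1, G _ (Nat.mod_lt _ (by norm_num)), ← av_mod, ← bv_mod]

/-- sum over divisor pairs -/
def DS (N : ℕ) (f : ℕ → ℕ → ℤ) : ℤ := ∑ x ∈ N.divisorsAntidiagonal, f x.1 x.2

lemma DS_add (N : ℕ) (f g : ℕ → ℕ → ℤ) : DS N (fun n M => f n M + g n M) = DS N f + DS N g := Finset.sum_add_distrib
lemma DS_mul (N : ℕ) (c : ℤ) (f : ℕ → ℕ → ℤ) : DS N (fun n M => c * f n M) = c * DS N f := by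
  rw [DS, DS, Finset.mul_sum]
lemma DS_congr {N : ℕ} {f g : ℕ → ℕ → ℤ} (h : ∀ n M, n * M = N → f n M = g n M) : DS N f = DS N g :=
  Finset.sum_congr rfl fun x hx => h _ _ (Nat.mem_divisorsAntidiagonal.1 hx).1
lemma DS_swap (N : ℕ) (f : ℕ → ℕ → ℤ) : DS N f = DS N (fun n M => f M n) := by
  rw [DS, DS, ← Nat.map_swap_divisorsAntidiagonal, Finset.sum_map]
  simp
lemma DS_move (N : ℕ) (g : ℕ → ℤ) : DS N (fun n M => if M % 2 = 0 then g (2 * n) else 0)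
    = DS N (fun _ M => if M % 2 = 0 then g M else 0) := by
  rw [DS_swap N (fun _ M => if M % 2 = 0 then g M else 0)]
  simp only [DS]
  rw [← Finset.sum_filter, ← Finset.sum_filter]
  refine Finset.sum_bij' (fun x _ => (2 * x.1, x.2 / 2)) (fun x _ => (x.1 / 2, 2 * x.2)) ?_ ?_ ?_ ?_ ?_
  · rintro ⟨n, M⟩ hx
    rw [Finset.mem_filter, Nat.mem_divisorsAntidiagonal] at *
    simp only at *
    refine ⟨⟨?_, hx.1.2⟩, by omega⟩
    have : M = 2 * (M / 2) := by omega
    rw [← hx.1.1]; conv_rhs => rw [this]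
    ring
  · rintro ⟨n, M⟩ hx
    rw [Finset.mem_filter, Nat.mem_divisorsAntidiagonal] at *
    simp only at *
    refine ⟨⟨?_, hx.1.2⟩, by omega⟩
    have : n = 2 * (n / 2) := by omega
    rw [← hx.1.1]; conv_rhs => rw [this]
    ring
  · rintro ⟨n, M⟩ hx
    rw [Finset.mem_filter] at hx
    simp only [Prod.mk.injEq] at *
    omega
  · rintro ⟨n, M⟩ hx
    rw [Finset.mem_filter] at hx
    simp only [Prod.mk.injEq] at *
    omega
  · rintro ⟨n, M⟩ hx
    rfl

def oS (N : ℕ) (f : ℕ → ℕ → ℤ) : ℤ := DS N (fun n M => if M % 2 = 1 then (-1) ^ n * f n M else 0)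
def eS (N : ℕ) (f : ℕ → ℕ → ℤ) : ℤ := DS N (fun n M => if M % 2 = 0 then f n M else 0)

lemma oeS_even (N : ℕ) (hN : N % 2 = 0) (f : ℕ → ℕ → ℤ) : oS N f = DS N f - eS N f := by
  rw [eq_sub_iff_add_eq, oS, eS, ← DS_add]
  refine DS_congr fun n M h => ?_
  by_cases hM : M % 2 = 1
  · have hn : Even n := by
      rw [Nat.even_iff]
      have : n * M % 2 = 0 := by rw [h, hN]
      rw [Nat.mul_mod, hM] at this; omega
    rw [if_pos hM, if_neg (by omega), hn.neg_one_pow]; ring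
  · rw [if_neg hM, if_pos (by omega)]; ring

lemma oeS_odd (N : ℕ) (hN : N % 2 = 1) (f : ℕ → ℕ → ℤ) : oS N f = -DS N f ∧ eS N f = 0 := by
  have key : ∀ n M, n * M = N → n % 2 = 1 ∧ M % 2 = 1 := by
    intro n M h
    have : Odd (n * M) := by rw [h, Nat.odd_iff, hN]
    rw [Nat.odd_mul, Nat.odd_iff, Nat.odd_iff] at this
    exact this
  constructor
  · rw [← neg_one_mul, ← DS_mul, oS]
    refine DS_congr fun n M h => ?_
    obtain ⟨h1, h2⟩ := key n M h
    rw [if_pos h2, (Nat.odd_iff.2 h1).neg_one_pow]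
  · rw [eS]
    have : DS N (fun n M => if M % 2 = 0 then f n M else 0) = DS N (fun _ _ => 0) := by
      refine DS_congr fun n M h => ?_
      obtain ⟨h1, h2⟩ := key n M h
      rw [if_neg (by omega)]
    rw [this, DS]; simp

lemma eA (N : ℕ) : eS N (fun n _ => av n) = eS N (fun _ M => bv M) := by
  rw [eS, eS, ← DS_move N bv]
  refine DS_congr fun n M _ => ?_
  congr 1
  simp only [av, bv]
  split_ifs <;> omega

lemma eB (N : ℕ) : eS N (fun n _ => bv n) = - eS N (fun _ M => av M) := by
  rw [eS, eS, ← DS_move N av, ← neg_one_mul, ← DS_mul]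
  refine DS_congr fun n M _ => ?_
  by_cases h : M % 2 = 0
  · rw [if_pos h, if_pos h]
    simp only [av, bv]
    split_ifs <;> omega
  · rw [if_neg h, if_neg h, mul_zero]

lemma res_rel (c : ℕ) (f g : ℕ → ℤ) (hf : ∀ n, f n = f (n % 5)) (hg : ∀ n, g n = g (n % 5))
    (H : ∀ a < 5, ∀ b < 5, a * b % 5 = c → f a = g b) (N : ℕ) (hN : N % 5 = c) :
    DS N (fun n _ => f n) = DS N (fun _ M => g M) ∧ eS N (fun n _ => f n) = eS N (fun _ M => g M) := by
  have key : ∀ n M, n * M = N → f n = g M := by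
    intro n M h
    rw [hf, hg]
    refine H _ (Nat.mod_lt _ (by norm_num)) _ (Nat.mod_lt _ (by norm_num)) ?_
    rw [← Nat.mul_mod, h, hN]
  constructor
  · exact DS_congr fun n M h => key n M h
  · exact DS_congr fun n M h => by simp only [key n M h]

lemma neg_mod {f : ℕ → ℤ} (hf : ∀ n, f n = f (n % 5)) (n : ℕ) : (-f n) = -f (n % 5) := by rw [hf]

lemma DS_neg (N : ℕ) (f : ℕ → ℕ → ℤ) : DS N (fun n M => - f n M) = - DS N f := by
  rw [DS, DS, Finset.sum_neg_distrib]
lemma eS_neg (N : ℕ) (f : ℕ → ℕ → ℤ) : eS N (fun n M => - f n M) = - eS N f := by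
  rw [eS, eS, ← DS_neg]
  exact DS_congr fun n M _ => by split_ifs <;> ring

lemma rel1 (N : ℕ) (hN : N % 5 = 1) : oS N (fun n _ => bv n) + eS N (fun n _ => bv n) = 0 ∧
    eS N (fun n _ => av n) = - eS N (fun n _ => bv n) := by
  have h := res_rel 1 bv (fun n => - bv n) bv_mod (neg_mod bv_mod) (by decide) N hN
  rw [DS_neg, eS_neg, ← DS_swap N (fun n _ => bv n), ← eA] at h
  rcases Nat.mod_two_eq_zero_or_one N with p | p
  · rw [oeS_even N p]; omega
  · rw [(oeS_odd N p _).1, (oeS_odd N p _).2, (oeS_odd N p _).2]; omega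

lemma rel4 (N : ℕ) (hN : N % 5 = 4) : oS N (fun n _ => av n) + eS N (fun n _ => av n) = 0 ∧
    eS N (fun n _ => av n) = eS N (fun n _ => bv n) := by
  have h := res_rel 4 av (fun n => - av n) av_mod (neg_mod av_mod) (by decide) N hN
  have h' := res_rel 4 bv (fun n => bv n) bv_mod bv_mod (by decide) N hN
  rw [DS_neg, eS_neg, ← DS_swap N (fun n _ => av n)] at h
  rw [← eA] at h'
  rcases Nat.mod_two_eq_zero_or_one N with p | p
  · rw [oeS_even N p]; omega
  · rw [(oeS_odd N p _).1, (oeS_odd N p _).2, (oeS_odd N p _).2]; omega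

lemma rel2 (N : ℕ) (hN : N % 5 = 2) : eS N (fun n _ => bv n) = 0 ∧
    oS N (fun n _ => av n) + eS N (fun n _ => av n) = oS N (fun n _ => bv n) := by
  have h := res_rel 2 av bv av_mod bv_mod (by decide) N hN
  have h' := res_rel 2 bv av bv_mod av_mod (by decide) N hN
  have hb := eB N
  rw [← DS_swap N (fun n _ => bv n)] at h
  rcases Nat.mod_two_eq_zero_or_one N with p | p
  · rw [oeS_even N p, oeS_even N p]; omega
  · rw [(oeS_odd N p _).1, (oeS_odd N p _).2, (oeS_odd N p _).2, (oeS_odd N p _).1]; omega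

lemma rel3 (N : ℕ) (hN : N % 5 = 3) : eS N (fun n _ => av n) = 0 ∧
    oS N (fun n _ => av n) + oS N (fun n _ => bv n) + eS N (fun n _ => bv n) = 0 := by
  have h := res_rel 3 av (fun n => - bv n) av_mod (neg_mod bv_mod) (by decide) N hN
  have ha := eA N
  have hx : eS N (fun n _ => av n) = - eS N (fun _ M => bv M) := h.2.trans (eS_neg N (fun _ M => bv M))
  have hy : DS N (fun n _ => av n) = - DS N (fun n _ => bv n) := by
    rw [h.1, DS_swap N (fun n _ => bv n)]; exact DS_neg N (fun _ M => bv M)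
  clear h
  rcases Nat.mod_two_eq_zero_or_one N with p | p
  · rw [oeS_even N p, oeS_even N p]; omega
  · rw [(oeS_odd N p _).1, (oeS_odd N p _).2, (oeS_odd N p _).2, (oeS_odd N p _).1]; omega

lemma rel0 (N : ℕ) : oS N (fun _ M => av M) = oS N (fun n _ => av n) + eS N (fun n _ => av n) + eS N (fun n _ => bv n) ∧
    oS N (fun _ M => bv M) = oS N (fun n _ => bv n) + eS N (fun n _ => bv n) - eS N (fun n _ => av n) := by
  have ha := eA N
  have hb := eB N
  rcases Nat.mod_two_eq_zero_or_one N with p | p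
  · rw [oeS_even N p, oeS_even N p, oeS_even N p, oeS_even N p, DS_swap N (fun _ M => av M), DS_swap N (fun _ M => bv M)]; omega
  · rw [(oeS_odd N p _).1, (oeS_odd N p _).2, (oeS_odd N p _).2, (oeS_odd N p _).1, (oeS_odd N p _).1, (oeS_odd N p _).1, DS_swap N (fun _ M => av M), DS_swap N (fun _ M => bv M)]; omega

def LU (N : ℕ) : ℤ := DS N (fun n M => if M % 2 = 1 then uu n else 0)
def LV (N : ℕ) : ℤ := DS N (fun n M => if M % 2 = 1 then vu n else 0)
def HU (N : ℕ) : ℤ := DS N (fun n M => if M % 2 = 1 ∧ n ≤ M / 2 then uu n else 0)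
def HV (N : ℕ) : ℤ := DS N (fun n M => if M % 2 = 1 ∧ n ≤ M / 2 then vu n else 0)
def EA (N : ℕ) : ℤ := DS N (fun n M => if M % 2 = 0 then av n else 0)

lemma LU_eq (N : ℕ) : LU N = - oS N (fun n _ => av n) := by
  rw [LU, oS, ← DS_neg]
  exact DS_congr fun n M _ => by simp only [uu]; split_ifs <;> ring
lemma LV_eq (N : ℕ) : LV N = oS N (fun n _ => bv n) := rfl

lemma raw_sum (i j c : ℕ) (h1 h2 f1 f2 f3 f4 g1 g2 : ℤ)
    (H : ∀ a : ℕ, a < 5 → ∀ y : ℕ, y < 5 → a * (2 * y + 1) % 5 = c → hpd i j a y = h1 * av a + h2 * bv a ∧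
      fpd i j a y = f1 * av a + f2 * bv a + f3 * av (2 * y + 1) + f4 * bv (2 * y + 1))
    (G : ∀ a : ℕ, a < 5 → gpd i j a = g1 * av a + g2 * bv a) (N : ℕ) (hc : N % 5 = c) :
    DS N (fun n M => dd i n M - dd j n M) = -(-h1 * HU N + h2 * HV N + f1 * oS N (fun n _ => av n)
      + f2 * oS N (fun n _ => bv n) + f3 * oS N (fun _ M => av M) + f4 * oS N (fun _ M => bv M)
      + g1 * eS N (fun n _ => av n) + g2 * eS N (fun n _ => bv n)) := by
  rw [HU, HV, oS, oS, oS, oS, eS, eS]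
  simp only [← DS_mul, ← DS_add]
  rw [← DS_neg]
  refine DS_congr fun n M h => ?_
  have := raw_table i j c h1 h2 f1 f2 f3 f4 g1 g2 H G n M (by rw [h, hc])
  rw [← neg_eq_iff_eq_neg] at *
  rw [this]
  by_cases hM : M % 2 = 1
  · have : ¬ M % 2 = 0 := by omega
    by_cases hn : n ≤ M / 2
    · simp only [hM, hn, if_true, true_and, uu, vu, one_ne_zero, if_false]
      ring
    · simp only [hM, hn, if_true, true_and, if_false, one_ne_zero]
      ring
  · have : M % 2 = 0 := by omega
    simp [this]

lemma L3_21 (N : ℕ) (hc : N % 5 = 3) : DS N (fun n M => dd 2 n M - dd 1 n M) = -5 * (HU N - LV N) := by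
  rw [raw_sum 2 1 3 (-5) 0 3 (-2) 0 0 (-1) 3 (by decide) (by decide) N hc, LV_eq]
  have := rel3 N hc
  linarith [this.1, this.2]
lemma L3_02 (N : ℕ) (hc : N % 5 = 3) : DS N (fun n M => dd 0 n M - dd 2 n M) = -5 * (2 * HU N - LV N) := by
  rw [raw_sum 0 2 3 (-10) 0 1 (-4) 0 0 3 1 (by decide) (by decide) N hc, LV_eq]
  have := rel3 N hc
  linarith [this.1, this.2]
lemma L4_01 (N : ℕ) (hc : N % 5 = 4) : DS N (fun n M => dd 0 n M - dd 1 n M) = -5 * EA N := by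
  rw [raw_sum 0 1 4 0 0 1 0 0 0 2 4 (by decide) (by decide) N hc]
  have := rel4 N hc
  change _ = -5 * eS N (fun n _ => av n)
  linarith [this.1, this.2]
lemma L0_12 (N : ℕ) (hc : N % 5 = 0) : DS N (fun n M => dd 1 n M - dd 2 n M) = -5 * LV N := by
  rw [raw_sum 1 2 0 0 0 (-1) 3 1 2 1 (-3) (by decide) (by decide) N hc, LV_eq]
  have := rel0 N
  linarith [this.1, this.2]
lemma L0_01 (N : ℕ) (hc : N % 5 = 0) : DS N (fun n M => dd 0 n M - dd 1 n M) = -5 * (LU N - LV N) := by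
  rw [raw_sum 0 1 0 0 0 (-2) (-4) (-3) (-1) 2 4 (by decide) (by decide) N hc, LV_eq, LU_eq]
  have := rel0 N
  linarith [this.1, this.2]
lemma L1_10 (N : ℕ) (hc : N % 5 = 1) : DS N (fun n M => dd 1 n M - dd 0 n M) = -5 * EA N := by
  rw [raw_sum 1 0 1 0 0 0 3 0 0 (-2) (-4) (by decide) (by decide) N hc]
  have := rel1 N hc
  change _ = -5 * eS N (fun n _ => av n)
  linarith [this.1, this.2]
lemma L2_02 (N : ℕ) (hc : N % 5 = 2) : DS N (fun n M => dd 0 n M - dd 2 n M) = -5 * (LU N + HV N) := by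
  rw [raw_sum 0 2 2 0 5 (-2) (-3) 0 0 3 1 (by decide) (by decide) N hc, LU_eq]
  have := rel2 N hc
  linarith [this.1, this.2]
lemma L2_10 (N : ℕ) (hc : N % 5 = 2) : DS N (fun n M => dd 1 n M - dd 0 n M) = -5 * HV N := by
  rw [raw_sum 1 0 2 0 5 (-2) 2 0 0 (-2) (-4) (by decide) (by decide) N hc]
  have := rel2 N hc
  linarith [this.1, this.2]
end part_P6

section part_P8
open Filter Topology
/-- number of `M ∈ (a,b]` with `M ≡ c (mod 50)` -/
def Kc (c a b : ℕ) : ℤ := (((Finset.Ioc a b).filter (fun M => M % 50 = c)).card : ℤ)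

lemma Kc_nonneg (c a b : ℕ) : 0 ≤ Kc c a b := by rw [Kc]; positivity

lemma Kc_empty (c a b : ℕ) (h : b ≤ a) : Kc c a b = 0 := by
  rw [Kc, Finset.Ioc_eq_empty_of_le h]; simp

lemma Kc_eq (c a b : ℕ) (hc : c < 50) (h : a ≤ b) :
    Kc c a b = (((b + 50 - c) / 50 : ℕ) : ℤ) - ((a + 50 - c) / 50 : ℕ) := by
  induction b, h using Nat.le_induction with
  | base => rw [Kc_empty _ _ _ le_rfl]; ring
  | succ b hab ih =>
    have e : Finset.Ioc a (b + 1) = insert (b + 1) (Finset.Ioc a b) := by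
      ext z; simp only [Finset.mem_Ioc, Finset.mem_insert]; omega
    rw [Kc, e, Finset.filter_insert]
    rw [Kc] at ih
    split_ifs with hb
    · rw [Finset.card_insert_of_notMem (by simp)]
      push_cast
      rw [ih]; omega
    · rw [ih]; omega

lemma Kc_lower (c a b : ℕ) (hc : c < 50) : (b : ℤ) - a - 49 ≤ 50 * Kc c a b := by
  rcases le_total a b with h | h
  · rw [Kc_eq c a b hc h]; omega
  · have := Kc_nonneg c a b; omega

lemma Kc_upper (c a b : ℕ) (hc : c < 50) (h : a ≤ b) : 50 * Kc c a b ≤ (b : ℤ) - a + 49 := by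
  rw [Kc_eq c a b hc h]; omega

lemma Kc_pair (c c' a a' b b' : ℕ) (hc : c < 50) (hc' : c' < 50) (ha : a ≤ a') (hb : b' ≤ b) :
    Kc c' a' b' ≤ Kc c a b + 1 := by
  rcases le_total a' b' with h | h
  · rw [Kc_eq c a b hc (by omega), Kc_eq c' a' b' hc' h]; omega
  · rw [Kc_empty _ _ _ h]
    have := Kc_nonneg c a b; omega

def cl (p σ n : ℕ) : ℕ := if (σ * n ^ 19 % 25) % 2 = p then σ * n ^ 19 % 25 else σ * n ^ 19 % 25 + 25

lemma cl_lt (p σ n : ℕ) : cl p σ n < 50 := by rw [cl]; split_ifs <;> omega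

lemma cl_iff (p σ n M : ℕ) (hp : p < 2) (hσ : σ < 25) (hn : n % 5 ≠ 0) :
    (M % 2 = p ∧ n * M % 25 = σ) ↔ M % 50 = cl p σ n := by
  have hn20 : n ^ 20 ≡ 1 [MOD 25] := by
    have hco : Nat.Coprime n 25 := by
      have : Nat.Coprime n 5 := by
        rw [Nat.coprime_comm, Nat.Prime.coprime_iff_not_dvd (by norm_num)]; omega
      exact Nat.Coprime.pow_right 2 this
    have h := Nat.ModEq.pow_totient hco
    have ht : Nat.totient 25 = 20 := by decide
    rwa [ht] at h
  have e : n * M % 25 = σ ↔ M % 25 = σ * n ^ 19 % 25 := by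
    constructor
    · intro h
      have h1 : n * M ≡ σ [MOD 25] := by rw [Nat.ModEq, h, Nat.mod_eq_of_lt hσ]
      have h2 : n ^ 20 * M ≡ 1 * M [MOD 25] := hn20.mul_right M
      have h3 : n ^ 20 * M ≡ σ * n ^ 19 [MOD 25] := by
        have := h1.mul_right (n ^ 19)
        have e : n * M * n ^ 19 = n ^ 20 * M := by ring
        rwa [e] at this
      rw [one_mul] at h2
      exact h2.symm.trans h3
    · intro h
      have h1 : n * M ≡ n * (σ * n ^ 19) [MOD 25] := Nat.ModEq.mul_left n h
      have e : n * (σ * n ^ 19) = σ * n ^ 20 := by ring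
      rw [e] at h1
      have h2 := h1.trans (hn20.mul_left σ)
      rw [mul_one, Nat.ModEq, Nat.mod_eq_of_lt hσ] at h2
      exact h2
  rw [e, cl]
  split_ifs with h <;> omega

def LO (p : ℕ) (w r : ℕ → ℤ) (N : ℕ) : ℤ :=
  DS N (fun n M => if M % 2 = p then (if 2 * n < M then w n else r n) else 0)

def SS (L : ℕ → ℤ) (σ j : ℕ) : ℤ := ∑ i ∈ Finset.range (j + 1), L (σ + 25 * i)

lemma DS_box (N x : ℕ) (h : N ≤ x) (g : ℕ → ℕ → ℤ) : DS N g =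
    ∑ n ∈ Finset.range (x + 1), ∑ M ∈ Finset.range (x + 1), if n * M = N ∧ 0 < n * M then g n M else 0 := by
  rw [← Finset.sum_product', ← Finset.sum_filter, DS]
  refine Finset.sum_congr ?_ fun _ _ => rfl
  ext ⟨n, M⟩
  simp only [Nat.mem_divisorsAntidiagonal, Finset.mem_filter, Finset.mem_product, Finset.mem_range]
  constructor
  · rintro ⟨h1, h2⟩
    have hp : 0 < n * M := by omega
    have hn : 0 < n := Nat.pos_of_ne_zero (by rintro rfl; simp at hp)
    have hM : 0 < M := Nat.pos_of_ne_zero (by rintro rfl; simp at hp)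
    refine ⟨⟨?_, ?_⟩, h1, hp⟩ <;> nlinarith
  · rintro ⟨_, h1, h2⟩
    exact ⟨h1, by omega⟩

lemma SS_box (σ j : ℕ) (hσ : σ < 25) (g : ℕ → ℕ → ℤ) : SS (fun N => DS N g) σ j =
    ∑ n ∈ Finset.range (σ + 25 * j + 1), ∑ M ∈ Finset.range (σ + 25 * j + 1),
      if n * M ≤ σ + 25 * j ∧ n * M % 25 = σ ∧ 0 < n * M then g n M else 0 := by
  rw [SS]
  rw [Finset.sum_congr rfl fun i hi => DS_box (σ + 25 * i) (σ + 25 * j) (by rw [Finset.mem_range] at hi; omega) g]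
  rw [Finset.sum_comm]
  refine Finset.sum_congr rfl fun n _ => ?_
  rw [Finset.sum_comm]
  refine Finset.sum_congr rfl fun M _ => ?_
  generalize n * M = t
  generalize g n M = y
  by_cases h : t ≤ σ + 25 * j ∧ t % 25 = σ ∧ 0 < t
  · rw [if_pos h, Finset.sum_eq_single (t / 25)]
    · rw [if_pos (by omega)]
    · intro i _ hi
      rw [if_neg (by omega)]
    · intro hi
      rw [Finset.mem_range] at hi; omega
  · rw [if_neg h]
    refine Finset.sum_eq_zero fun i hi => ?_
    rw [Finset.mem_range] at hi
    rw [if_neg (by omega)]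

/-- the hyperbola count -/
def Cn (p σ x n : ℕ) : ℤ := Kc (cl p σ n) (2 * n) (x / n)

lemma Cn_nonneg (p σ x n : ℕ) : 0 ≤ Cn p σ x n := Kc_nonneg _ _ _

lemma Cn_pair (p σ x n m : ℕ) (hn : 0 < n) (h : n ≤ m) : Cn p σ x m ≤ Cn p σ x n + 1 :=
  Kc_pair _ _ _ _ _ _ (cl_lt _ _ _) (cl_lt _ _ _) (by omega) (Nat.div_le_div_left h hn)

lemma Cn_zero (p σ x n : ℕ) (h : x < 2 * n * n) : Cn p σ x n = 0 := by
  refine Kc_empty _ _ _ ?_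
  rcases Nat.eq_zero_or_pos n with rfl | hn
  · simp
  · have : x / n < 2 * n + 1 := by
      rw [Nat.div_lt_iff_lt_mul hn]; nlinarith
    omega

lemma Cn_lower (p σ x n : ℕ) : ((x / n : ℕ) : ℤ) - 2 * n - 49 ≤ 50 * Cn p σ x n := by
  have := Kc_lower (cl p σ n) (2 * n) (x / n) (cl_lt _ _ _)
  push_cast at *
  exact this

lemma Cn_upper (p σ x n : ℕ) (h : 2 * n ≤ x / n) : 50 * Cn p σ x n ≤ ((x / n : ℕ) : ℤ) - 2 * n + 49 := by
  have := Kc_upper (cl p σ n) (2 * n) (x / n) (cl_lt _ _ _) h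
  push_cast at *
  exact this

lemma inner_H (p σ x n : ℕ) (hp : p < 2) (hσ : σ < 25) (hn : n % 5 ≠ 0) (y : ℤ) :
    ∑ M ∈ Finset.range (x + 1), (if n * M ≤ x ∧ n * M % 25 = σ ∧ 0 < n * M then
      (if M % 2 = p then (if 2 * n < M then y else 0) else 0) else 0) = y * Cn p σ x n := by
  have hn0 : 0 < n := by omega
  have e : ∀ M ∈ Finset.range (x + 1), (if n * M ≤ x ∧ n * M % 25 = σ ∧ 0 < n * M then
      (if M % 2 = p then (if 2 * n < M then y else 0) else 0) else 0) =
      if (M ∈ Finset.Ioc (2 * n) (x / n) ∧ M % 50 = cl p σ n) then y else 0 := by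
    intro M _
    have h1 := cl_iff p σ n M hp hσ hn
    have h2 : M ∈ Finset.Ioc (2 * n) (x / n) ↔ (2 * n < M ∧ n * M ≤ x) := by
      rw [Finset.mem_Ioc, Nat.le_div_iff_mul_le hn0, mul_comm M n]
    have : 2 * n < M → 0 < n * M := fun h => Nat.mul_pos hn0 (by omega)
    split_ifs <;> first | rfl | (exfalso; tauto)
  rw [Finset.sum_congr rfl e, ← Finset.sum_filter, Finset.sum_const, Cn, Kc, nsmul_eq_mul, mul_comm]
  congr 3
  ext M
  simp only [Finset.mem_filter, Finset.mem_range, Finset.mem_Ioc]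
  constructor
  · tauto
  · rintro ⟨⟨h1, h2⟩, h3⟩
    have : x / n ≤ x := Nat.div_le_self x n
    exact ⟨by omega, ⟨h1, h2⟩, h3⟩

/-- the remaining part, for fixed `M` -/
def Rm (σ x M : ℕ) (r : ℕ → ℤ) : ℤ := ∑ n ∈ Finset.Ioc (M / 2) (x / M), if n * M % 25 = σ then r n else 0

lemma inner_R (p σ x M : ℕ) (hM : M % 2 = p) (h0 : 0 < M) (r : ℕ → ℤ) (hp : p = 1 ∨ r = 0) :
    ∑ n ∈ Finset.range (x + 1), (if n * M ≤ x ∧ n * M % 25 = σ ∧ 0 < n * M then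
      (if M % 2 = p then (if 2 * n < M then 0 else r n) else 0) else 0) = Rm σ x M r := by
  rcases hp with rfl | rfl
  · rw [Rm, ← Finset.sum_filter_add_sum_filter_not _ (fun n => n ∈ Finset.Ioc (M / 2) (x / M))]
    rw [Finset.sum_eq_zero (s := Finset.filter (fun n => ¬ _) _), add_zero]
    · have e : (Finset.range (x + 1)).filter (fun n => n ∈ Finset.Ioc (M / 2) (x / M)) = Finset.Ioc (M / 2) (x / M) := by
        ext n
        simp only [Finset.mem_filter, Finset.mem_range, Finset.mem_Ioc]
        have : x / M ≤ x := Nat.div_le_self x M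
        omega
      rw [e]
      refine Finset.sum_congr rfl fun n hn => ?_
      rw [Finset.mem_Ioc, Nat.le_div_iff_mul_le h0] at hn
      have h1 : 0 < n * M := Nat.mul_pos (by omega) h0
      rw [if_pos hM, if_neg (show ¬ 2 * n < M by omega)]
      simp only [hn.2, h1, true_and, and_true]
    · intro n hn
      rw [Finset.mem_filter, Finset.mem_Ioc, Nat.le_div_iff_mul_le h0] at hn
      rw [if_pos hM]
      by_cases hc : 2 * n < M
      · simp [hc]
      · rw [if_neg (fun h => hn.2 ⟨by omega, h.1⟩)]
  · simp [Rm]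

lemma SS_LO (p σ j : ℕ) (hp : p < 2) (hσ : σ < 25) (w r : ℕ → ℤ) (hw : ∀ n, n % 5 = 0 → w n = 0)
    (hpr : p = 1 ∨ r = 0) :
    SS (LO p w r) σ j = ∑ n ∈ Finset.range (σ + 25 * j + 1), w n * Cn p σ (σ + 25 * j) n +
      ∑ M ∈ (Finset.range (σ + 25 * j + 1)).filter (fun M => M % 2 = p), Rm σ (σ + 25 * j) M r := by
  have e : (LO p w r) = fun N => DS N (fun n M => (if M % 2 = p then (if 2 * n < M then w n else 0) else 0)
      + (if M % 2 = p then (if 2 * n < M then 0 else r n) else 0)) := by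
    funext N
    exact DS_congr fun n M _ => by split_ifs <;> ring
  rw [e, SS_box σ j hσ]
  generalize σ + 25 * j = x
  have e2 : ∀ n M : ℕ, (if n * M ≤ x ∧ n * M % 25 = σ ∧ 0 < n * M then ((if M % 2 = p then (if 2 * n < M then w n else 0) else 0)
      + (if M % 2 = p then (if 2 * n < M then 0 else r n) else 0)) else 0) =
      (if n * M ≤ x ∧ n * M % 25 = σ ∧ 0 < n * M then (if M % 2 = p then (if 2 * n < M then w n else 0) else 0) else 0)
      + (if n * M ≤ x ∧ n * M % 25 = σ ∧ 0 < n * M then (if M % 2 = p then (if 2 * n < M then 0 else r n) else 0) else 0) := by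
    intro n M
    split_ifs <;> ring
  simp only [e2, Finset.sum_add_distrib]
  congr 1
  · refine Finset.sum_congr rfl fun n _ => ?_
    by_cases hn : n % 5 = 0
    · rw [hw n hn]; simp
    · exact inner_H p σ x n hp hσ hn (w n)
  · rw [Finset.sum_comm, Finset.sum_filter]
    refine Finset.sum_congr rfl fun M _ => ?_
    by_cases hM : M % 2 = p
    · rw [if_pos hM]
      rcases Nat.eq_zero_or_pos M with rfl | h0
      · simp [Rm]
      · exact inner_R p σ x M hM h0 r hpr
    · simp [hM]
end part_P8

section part_P9
open Filter Topology
def tab (l : List ℤ) (n : ℕ) : ℤ := l.getD (n % 10) 0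

lemma tab_add (l : List ℤ) (i n : ℕ) : tab l (10 * i + n) = tab l n := by
  rw [tab, tab]; congr 1; omega

/-- bounded walk check -/
def chk (g : ℕ → ℤ) (lo hi : ℤ) : ℕ → ℕ → ℤ → Bool
  | 0, _, acc => decide (acc = 0)
  | f + 1, k, acc => decide (lo ≤ acc) && decide (acc ≤ hi) && chk g lo hi f (k + 1) (acc + g k)

lemma chk_spec (g : ℕ → ℤ) (lo hi : ℤ) (f k : ℕ) (h : chk g lo hi f k (∑ n ∈ Finset.range k, g n) = true) :
    (∑ n ∈ Finset.range (k + f), g n = 0) ∧ ∀ i, k ≤ i → i < k + f → lo ≤ ∑ n ∈ Finset.range i, g n ∧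
      ∑ n ∈ Finset.range i, g n ≤ hi := by
  induction f generalizing k with
  | zero =>
    simp only [chk, decide_eq_true_eq] at h
    exact ⟨h, fun i h1 h2 => by omega⟩
  | succ f ih =>
    simp only [chk, Bool.and_eq_true, decide_eq_true_eq] at h
    rw [← Finset.sum_range_succ] at h
    obtain ⟨a, b⟩ := ih (k + 1) h.2
    refine ⟨?_, fun i h1 h2 => ?_⟩
    · rw [← a]; congr 2; omega
    · rcases Nat.eq_or_lt_of_le h1 with rfl | h1
      · exact h.1
      · exact b i h1 (by omega)

def gm (l : List ℤ) (σ m n : ℕ) : ℤ := if n * m % 25 = σ then tab l n else 0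

lemma gm_per (l : List ℤ) (σ m n : ℕ) : gm l σ m (50 + n) = gm l σ m n := by
  have h1 : (50 + n) * m % 25 = n * m % 25 := by
    have : (50 + n) * m = n * m + 25 * (2 * m) := by ring
    rw [this, Nat.add_mul_mod_self_left]
  have h2 : tab l (50 + n) = tab l n := tab_add l 5 n
  rw [gm, gm, h1, h2]

def chkR (l : List ℤ) (cls : ℕ) (e : ℕ → ℤ) : Bool :=
  (List.range 5).all fun s => (List.range 25).all fun m =>
    [0, -1, -2].any fun lo => chk (gm l (5 * s + cls) m) lo (lo + e (m % 5)) 50 0 0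

lemma per_sum (g : ℕ → ℤ) (hg : ∀ n, g (50 + n) = g n) (h0 : ∑ n ∈ Finset.range 50, g n = 0) (i : ℕ) :
    ∑ n ∈ Finset.range i, g n = ∑ n ∈ Finset.range (i % 50), g n := by
  induction i using Nat.strong_induction_on with
  | _ i ih =>
    rcases Nat.lt_or_ge i 50 with h | h
    · rw [Nat.mod_eq_of_lt h]
    · obtain ⟨k, rfl⟩ := Nat.exists_eq_add_of_le h
      rw [Finset.sum_range_add, h0, zero_add, Finset.sum_congr rfl fun n _ => hg n, ih k (by omega)]
      congr 2; omega

lemma Rm_lower (l : List ℤ) (cls : ℕ) (e : ℕ → ℤ) (h : chkR l cls e = true) (he : ∀ m, 0 ≤ e m) (σ x M : ℕ)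
    (hσ : σ < 25) (hc : σ % 5 = cls) : - e (M % 5) ≤ Rm σ x M (tab l) := by
  rcases le_total (x / M) (M / 2) with hab | hab
  · rw [Rm, Finset.Ioc_eq_empty_of_le hab]; simpa using he _
  have e1 : Rm σ x M (tab l) = ∑ n ∈ Finset.Ioc (M / 2) (x / M), gm l σ (M % 25) n := by
    refine Finset.sum_congr rfl fun n _ => ?_
    rw [gm]; simp [Nat.mul_mod]
  have e2 : ∑ n ∈ Finset.Ioc (M / 2) (x / M), gm l σ (M % 25) n =
      ∑ n ∈ Finset.range (x / M + 1), gm l σ (M % 25) n - ∑ n ∈ Finset.range (M / 2 + 1), gm l σ (M % 25) n := by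
    rw [← Finset.sum_Ico_eq_sub _ (by omega)]
    refine Finset.sum_congr ?_ fun _ _ => rfl
    ext z; simp only [Finset.mem_Ioc, Finset.mem_Ico]; omega
  rw [e1, e2]
  simp only [chkR, List.all_eq_true, List.mem_range, List.any_eq_true] at h
  obtain ⟨lo, -, hlo⟩ := h (σ / 5) (by omega) (M % 25) (by omega)
  have e3 : 5 * (σ / 5) + cls = σ := by omega
  have e4 : M % 25 % 5 = M % 5 := by omega
  rw [e3, e4] at hlo
  obtain ⟨a, b⟩ := chk_spec _ _ _ 50 0 (by simpa using hlo)
  rw [zero_add] at a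
  rw [per_sum _ (gm_per l σ _) a (x / M + 1), per_sum _ (gm_per l σ _) a (M / 2 + 1)]
  have h1 := b ((x / M + 1) % 50) (by omega) (by omega)
  have h2 := b ((M / 2 + 1) % 50) (by omega) (by omega)
  linarith [h1.1, h2.2]

lemma sum_blocks (f : ℕ → ℤ) (T : ℕ) : ∑ n ∈ Finset.range (10 * T), f n =
    ∑ i ∈ Finset.range T, ∑ r ∈ Finset.range 10, f (10 * i + r) := by
  induction T with
  | zero => simp
  | succ T ih => rw [Finset.sum_range_succ, ← ih, show 10 * (T + 1) = 10 * T + 10 by ring, Finset.sum_range_add]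

lemma R_lower (l : List ℤ) (cls : ℕ) (e : ℕ → ℤ) (h : chkR l cls e = true) (he : ∀ m, 0 ≤ e m)
    (he2 : e 1 + e 3 + e 0 + e 2 + e 4 = 2) (σ x T : ℕ)
    (hσ : σ < 25) (hc : σ % 5 = cls) (hx : x < 200 * T * T) :
    - (4 * T : ℤ) ≤ ∑ M ∈ (Finset.range (x + 1)).filter (fun M => M % 2 = 1), Rm σ x M (tab l) := by
  have h1 : ∑ M ∈ (Finset.range (x + 1)).filter (fun M => M % 2 = 1), Rm σ x M (tab l) ≥
      ∑ M ∈ (Finset.range (x + 1)).filter (fun M => M % 2 = 1), if M < 10 * (2 * T) then - e (M % 5) else 0 := by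
    refine Finset.sum_le_sum fun M _ => ?_
    split_ifs with hM
    · exact Rm_lower l cls e h he σ x M hσ hc
    · have : x / M ≤ M / 2 := by
        have hT : 0 < T := Nat.pos_of_ne_zero (by rintro rfl; simp at hx)
        have h2 : x / M < 10 * T := by
          rw [Nat.div_lt_iff_lt_mul (by omega)]; nlinarith
        omega
      rw [Rm, Finset.Ioc_eq_empty_of_le this]; simp
  refine le_trans ?_ h1
  rw [← Finset.sum_filter]
  have h2 : ∑ M ∈ Finset.range (10 * (2 * T)), (if M % 2 = 1 then - e (M % 5) else 0) = -(4 * T : ℤ) := by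
    rw [sum_blocks]
    have : ∀ i ∈ Finset.range (2 * T), ∑ r ∈ Finset.range 10, (if (10 * i + r) % 2 = 1 then - e ((10 * i + r) % 5) else 0) = -2 := by
      intro i _
      have : ∀ r, (if (10 * i + r) % 2 = 1 then - e ((10 * i + r) % 5) else 0) = if r % 2 = 1 then - e (r % 5) else 0 := by
        intro r
        rw [show (10 * i + r) % 2 = r % 2 by omega, show (10 * i + r) % 5 = r % 5 by omega]
      simp only [this, Finset.sum_range_succ, Finset.sum_range_zero]
      norm_num
      linarith
    rw [Finset.sum_congr rfl this]
    simp; ring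
  rw [← h2, ← Finset.sum_filter]
  refine Finset.sum_le_sum_of_subset_of_nonpos' (fun M hM => ?_) (fun M _ _ => by linarith [he (M % 5)])
  simp only [Finset.mem_filter, Finset.mem_range] at *
  tauto

lemma H_blocks (p σ x T : ℕ) (l : List ℤ) (hx : x < 200 * T * T) :
    ∑ n ∈ Finset.range (x + 1), tab l n * Cn p σ x n =
    ∑ r ∈ Finset.range 10, tab l r * ∑ i ∈ Finset.range T, Cn p σ x (10 * i + r) := by
  have h1 : ∑ n ∈ Finset.range (x + 1), tab l n * Cn p σ x n = ∑ n ∈ Finset.range (x + 1 + 10 * T), tab l n * Cn p σ x n := by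
    refine Finset.sum_subset (fun n hn => ?_) (fun n _ hn => ?_)
    · rw [Finset.mem_range] at *; omega
    · rw [Finset.mem_range] at hn
      rw [Cn_zero, mul_zero]
      nlinarith
  have h2 : ∑ n ∈ Finset.range (10 * T), tab l n * Cn p σ x n = ∑ n ∈ Finset.range (x + 1 + 10 * T), tab l n * Cn p σ x n := by
    refine Finset.sum_subset (fun n hn => ?_) (fun n _ hn => ?_)
    · rw [Finset.mem_range] at *; omega
    · rw [Finset.mem_range] at hn
      rw [Cn_zero, mul_zero]
      nlinarith
  rw [h1, ← h2, sum_blocks, Finset.sum_comm]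
  refine Finset.sum_congr rfl fun r _ => ?_
  rw [Finset.mul_sum]
  exact Finset.sum_congr rfl fun i _ => by rw [tab_add]

/-- block sums of the counts -/
def EE (p σ x T r : ℕ) : ℤ := ∑ i ∈ Finset.range T, Cn p σ x (10 * i + r)

lemma EE_shift (p σ x T r : ℕ) : EE p σ x T (r + 10) ≥ EE p σ x T r - Cn p σ x r := by
  have h := Finset.sum_range_succ (fun i => Cn p σ x (10 * i + r)) T
  rw [Finset.sum_range_succ'] at h
  have e : EE p σ x T (r + 10) = ∑ i ∈ Finset.range T, Cn p σ x (10 * (i + 1) + r) :=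
    Finset.sum_congr rfl fun i _ => by congr 1; ring
  have := Cn_nonneg p σ x (10 * T + r)
  simp only [mul_zero, zero_add] at h
  rw [e, EE]; linarith

lemma EE_shift' (p σ x T r : ℕ) (hx : x < 200 * T * T) : EE p σ x T (r + 10) = EE p σ x T r - Cn p σ x r := by
  have h := Finset.sum_range_succ (fun i => Cn p σ x (10 * i + r)) T
  rw [Finset.sum_range_succ'] at h
  have e : EE p σ x T (r + 10) = ∑ i ∈ Finset.range T, Cn p σ x (10 * (i + 1) + r) :=
    Finset.sum_congr rfl fun i _ => by congr 1; ring
  have := Cn_zero p σ x (10 * T + r) (by nlinarith)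
  simp only [mul_zero, zero_add] at h
  rw [e, EE]; linarith

lemma EE_pair (p σ x T r s i0 : ℕ) (hr : 0 < r) (hs : r ≤ s) (hT : i0 ≤ T) :
    ∑ i ∈ Finset.range i0, (Cn p σ x (10 * i + r) - Cn p σ x (10 * i + s)) - ((T : ℤ) - i0) ≤ EE p σ x T r - EE p σ x T s := by
  rw [EE, EE, ← Finset.sum_sub_distrib]
  induction T, hT using Nat.le_induction with
  | base => simp
  | succ T hT ih =>
    rw [Finset.sum_range_succ _ T]
    have := Cn_pair p σ x (10 * T + r) (10 * T + s) (by omega) (by omega)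
    push_cast
    linarith

lemma Cn_lo (p σ x n : ℕ) (hn : 0 < n) : (x : ℤ) - n + 1 - 2 * n * n - 49 * n ≤ 50 * n * Cn p σ x n := by
  have h := Cn_lower p σ x n
  have h2 : (x : ℤ) < n * ((x / n : ℕ) : ℤ) + n := by
    have := Nat.lt_mul_div_succ x hn
    have h3 : x < n * (x / n) + n := by rw [Nat.mul_add] at this; omega
    exact_mod_cast h3
  have hn' : (0 : ℤ) < n := by exact_mod_cast hn
  nlinarith

lemma Cn_hi (p σ x n : ℕ) (hn : 0 < n) (hx : 2 * n * n ≤ x) : 50 * n * Cn p σ x n ≤ (x : ℤ) - 2 * n * n + 49 * n := by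
  have h := Cn_upper p σ x n (by rw [Nat.le_div_iff_mul_le hn]; exact hx)
  have h2 : (n : ℤ) * ((x / n : ℕ) : ℤ) ≤ x := by
    exact_mod_cast Nat.mul_div_le x n
  have hn' : (0 : ℤ) < n := by exact_mod_cast hn
  nlinarith

lemma exists_T (x : ℕ) : ∃ T : ℕ, 1 ≤ T ∧ x < 200 * T * T ∧ 200 * (T - 1) * (T - 1) ≤ x := by
  refine ⟨Nat.sqrt (x / 2) / 10 + 1, by omega, ?_, ?_⟩
  · have h := Nat.lt_succ_sqrt (x / 2)
    rw [Nat.succ_eq_add_one] at h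
    generalize Nat.sqrt (x / 2) = y at *
    have h2 : y + 1 ≤ 10 * (y / 10 + 1) := by omega
    have h3 := Nat.mul_le_mul h2 h2
    nlinarith [Nat.div_add_mod x 2, Nat.mod_lt x (show 2 > 0 by norm_num)]
  · have h := Nat.sqrt_le (x / 2)
    generalize Nat.sqrt (x / 2) = y at *
    rw [Nat.add_sub_cancel]
    have h2 : 10 * (y / 10) ≤ y := by omega
    have h3 := Nat.mul_le_mul h2 h2
    have h4 : 2 * (y * y) ≤ x := by omega
    calc _ = 2 * (10 * (y / 10) * (10 * (y / 10))) := by ring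
      _ ≤ x := by omega
end part_P9

section part_P10
open Filter Topology
def e3 (m : ℕ) : ℤ := if m = 1 ∨ m = 4 then 1 else 0
def e0 (m : ℕ) : ℤ := if m = 0 then 2 else 0
def e2 (m : ℕ) : ℤ := if m = 2 ∨ m = 3 then 1 else 0

lemma e3_nn (m : ℕ) : 0 ≤ e3 m := by rw [e3]; split_ifs <;> norm_num
lemma e0_nn (m : ℕ) : 0 ≤ e0 m := by rw [e0]; split_ifs <;> norm_num
lemma e2_nn (m : ℕ) : 0 ≤ e2 m := by rw [e2]; split_ifs <;> norm_num

lemma chkR_A : chkR [0, 0, -1, -1, 0, 0, 0, 1, 1, 0] 3 e3 = true := by decide +kernel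
lemma chkR_C : chkR [0, 0, 1, 1, 0, 0, 0, -1, -1, 0] 0 e0 = true := by decide +kernel
lemma chkR_D : chkR [0, 1, -1, -1, 1, 0, -1, 1, 1, -1] 0 e0 = true := by decide +kernel
lemma chkR_E : chkR [0, 1, 0, 0, 1, 0, -1, 0, 0, -1] 2 e2 = true := by decide +kernel

lemma Rm_nil (σ x : ℕ) (s : Finset ℕ) : ∑ M ∈ s, Rm σ x M (tab []) = 0 := by
  simp [Rm, tab]

lemma tab_five (l : List ℤ) (h0 : l.getD 0 0 = 0) (h5 : l.getD 5 0 = 0) (n : ℕ) (hn : n % 5 = 0) : tab l n = 0 := by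
  have : n % 10 = 0 ∨ n % 10 = 5 := by omega
  rcases this with h | h <;> rw [tab, h] <;> assumption

lemma H_eq (p σ x T : ℕ) (l : List ℤ) (hx : x < 200 * T * T) :
    ∑ n ∈ Finset.range (x + 1), tab l n * Cn p σ x n =
    tab l 0 * EE p σ x T 0 + tab l 1 * EE p σ x T 1 + tab l 2 * EE p σ x T 2 + tab l 3 * EE p σ x T 3 + tab l 4 * EE p σ x T 4 +
    tab l 5 * EE p σ x T 5 + tab l 6 * EE p σ x T 6 + tab l 7 * EE p σ x T 7 + tab l 8 * EE p σ x T 8 + tab l 9 * EE p σ x T 9 := by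
  rw [H_blocks p σ x T l hx]
  simp only [Finset.sum_range_succ, Finset.sum_range_zero, zero_add, EE]

lemma large_A (σ j : ℕ) (hσ : σ < 25) (hc : σ % 5 = 3) (hj : 510 ≤ j) :
    1 ≤ SS (LO 1 (tab [0, 1, -1, -1, 1, 0, -1, 1, 1, -1]) (tab [0, 0, -1, -1, 0, 0, 0, 1, 1, 0])) σ j := by
  rw [SS_LO 1 σ j (by norm_num) hσ _ _ (tab_five _ rfl rfl) (Or.inl rfl)]
  have hx0 : 12750 ≤ σ + 25 * j := by omega
  generalize σ + 25 * j = x at *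
  obtain ⟨T, hT1, hT, hT2⟩ := exists_T x
  have hT3 : 2 ≤ T := by
    by_contra h
    have : T ≤ 1 := by omega
    have := Nat.mul_le_mul this this
    nlinarith
  have hR := R_lower _ 3 e3 chkR_A e3_nn (by decide) σ x T hσ hc hT
  rw [H_eq 1 σ x T _ hT]
  have k1 := EE_pair 1 σ x T 1 6 2 (by norm_num) (by norm_num) hT3
  have k4 := EE_pair 1 σ x T 4 9 2 (by norm_num) (by norm_num) hT3
  have k7 := EE_pair 1 σ x T 7 12 2 (by norm_num) (by norm_num) hT3
  have k8 := EE_pair 1 σ x T 8 13 2 (by norm_num) (by norm_num) hT3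
  have s2 := EE_shift' 1 σ x T 2 hT
  have s3 := EE_shift' 1 σ x T 3 hT
  simp only [Finset.sum_range_succ, Finset.sum_range_zero, zero_add, mul_zero, mul_one, Nat.reduceAdd, Nat.reduceMul, Nat.cast_one, Nat.cast_ofNat] at k1 k4 k7 k8 s2 s3
  have l1 := Cn_lo 1 σ x 1 (by norm_num)
  have u6 := Cn_hi 1 σ x 6 (by norm_num) (by omega)
  have l11 := Cn_lo 1 σ x 11 (by norm_num)
  have u16 := Cn_hi 1 σ x 16 (by norm_num) (by omega)
  have l4 := Cn_lo 1 σ x 4 (by norm_num)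
  have u9 := Cn_hi 1 σ x 9 (by norm_num) (by omega)
  have l14 := Cn_lo 1 σ x 14 (by norm_num)
  have u19 := Cn_hi 1 σ x 19 (by norm_num) (by omega)
  have l7 := Cn_lo 1 σ x 7 (by norm_num)
  have u12 := Cn_hi 1 σ x 12 (by norm_num) (by omega)
  have l17 := Cn_lo 1 σ x 17 (by norm_num)
  have u22 := Cn_hi 1 σ x 22 (by norm_num) (by omega)
  have l8 := Cn_lo 1 σ x 8 (by norm_num)
  have u13 := Cn_hi 1 σ x 13 (by norm_num) (by omega)
  have l18 := Cn_lo 1 σ x 18 (by norm_num)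
  have u23 := Cn_hi 1 σ x 23 (by norm_num) (by omega)
  have u2 := Cn_hi 1 σ x 2 (by norm_num) (by omega)
  have u3 := Cn_hi 1 σ x 3 (by norm_num) (by omega)
  obtain ⟨t, rfl⟩ : ∃ t, T = t + 1 := ⟨T - 1, by omega⟩
  rw [Nat.add_sub_cancel] at hT2
  have hq : (200 * t * t : ℤ) ≤ x := by exact_mod_cast hT2
  have hsq := sq_nonneg ((t : ℤ) - 7)
  have hx1 : (12750 : ℤ) ≤ x := by exact_mod_cast hx0
  have w0 : tab [0, 1, -1, -1, 1, 0, -1, 1, 1, -1] 0 = 0 := rfl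
  have w1 : tab [0, 1, -1, -1, 1, 0, -1, 1, 1, -1] 1 = 1 := rfl
  have w2 : tab [0, 1, -1, -1, 1, 0, -1, 1, 1, -1] 2 = -1 := rfl
  have w3 : tab [0, 1, -1, -1, 1, 0, -1, 1, 1, -1] 3 = -1 := rfl
  have w4 : tab [0, 1, -1, -1, 1, 0, -1, 1, 1, -1] 4 = 1 := rfl
  have w5 : tab [0, 1, -1, -1, 1, 0, -1, 1, 1, -1] 5 = 0 := rfl
  have w6 : tab [0, 1, -1, -1, 1, 0, -1, 1, 1, -1] 6 = -1 := rfl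
  have w7 : tab [0, 1, -1, -1, 1, 0, -1, 1, 1, -1] 7 = 1 := rfl
  have w8 : tab [0, 1, -1, -1, 1, 0, -1, 1, 1, -1] 8 = 1 := rfl
  have w9 : tab [0, 1, -1, -1, 1, 0, -1, 1, 1, -1] 9 = -1 := rfl
  rw [w0, w1, w2, w3, w4, w5, w6, w7, w8, w9]
  push_cast at *
  linarith

lemma large_B (σ j : ℕ) (hσ : σ < 25) (hc : σ % 5 = 3) (hj : 115 ≤ j) :
    1 ≤ SS (LO 1 (tab [0, 2, -1, -1, 2, 0, -2, 1, 1, -2]) (tab [0, 0, -1, -1, 0, 0, 0, 1, 1, 0])) σ j := by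
  rw [SS_LO 1 σ j (by norm_num) hσ _ _ (tab_five _ rfl rfl) (Or.inl rfl)]
  have hx0 : 2875 ≤ σ + 25 * j := by omega
  generalize σ + 25 * j = x at *
  obtain ⟨T, hT1, hT, hT2⟩ := exists_T x
  have hT3 : 1 ≤ T := by
    by_contra h
    have : T ≤ 0 := by omega
    have := Nat.mul_le_mul this this
    nlinarith
  have hR := R_lower _ 3 e3 chkR_A e3_nn (by decide) σ x T hσ hc hT
  rw [H_eq 1 σ x T _ hT]
  have k1 := EE_pair 1 σ x T 1 6 1 (by norm_num) (by norm_num) hT3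
  have k4 := EE_pair 1 σ x T 4 9 1 (by norm_num) (by norm_num) hT3
  have k7 := EE_pair 1 σ x T 7 12 1 (by norm_num) (by norm_num) hT3
  have k8 := EE_pair 1 σ x T 8 13 1 (by norm_num) (by norm_num) hT3
  have s2 := EE_shift' 1 σ x T 2 hT
  have s3 := EE_shift' 1 σ x T 3 hT
  simp only [Finset.sum_range_succ, Finset.sum_range_zero, zero_add, mul_zero, mul_one, Nat.reduceAdd, Nat.reduceMul, Nat.cast_one, Nat.cast_ofNat] at k1 k4 k7 k8 s2 s3
  have l1 := Cn_lo 1 σ x 1 (by norm_num)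
  have u6 := Cn_hi 1 σ x 6 (by norm_num) (by omega)
  have l4 := Cn_lo 1 σ x 4 (by norm_num)
  have u9 := Cn_hi 1 σ x 9 (by norm_num) (by omega)
  have l7 := Cn_lo 1 σ x 7 (by norm_num)
  have u12 := Cn_hi 1 σ x 12 (by norm_num) (by omega)
  have l8 := Cn_lo 1 σ x 8 (by norm_num)
  have u13 := Cn_hi 1 σ x 13 (by norm_num) (by omega)
  have u2 := Cn_hi 1 σ x 2 (by norm_num) (by omega)
  have u3 := Cn_hi 1 σ x 3 (by norm_num) (by omega)
  obtain ⟨t, rfl⟩ : ∃ t, T = t + 1 := ⟨T - 1, by omega⟩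
  rw [Nat.add_sub_cancel] at hT2
  have hq : (200 * t * t : ℤ) ≤ x := by exact_mod_cast hT2
  have hsq := sq_nonneg ((t : ℤ) - 3)
  have hx1 : (2875 : ℤ) ≤ x := by exact_mod_cast hx0
  have w0 : tab [0, 2, -1, -1, 2, 0, -2, 1, 1, -2] 0 = 0 := rfl
  have w1 : tab [0, 2, -1, -1, 2, 0, -2, 1, 1, -2] 1 = 2 := rfl
  have w2 : tab [0, 2, -1, -1, 2, 0, -2, 1, 1, -2] 2 = -1 := rfl
  have w3 : tab [0, 2, -1, -1, 2, 0, -2, 1, 1, -2] 3 = -1 := rfl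
  have w4 : tab [0, 2, -1, -1, 2, 0, -2, 1, 1, -2] 4 = 2 := rfl
  have w5 : tab [0, 2, -1, -1, 2, 0, -2, 1, 1, -2] 5 = 0 := rfl
  have w6 : tab [0, 2, -1, -1, 2, 0, -2, 1, 1, -2] 6 = -2 := rfl
  have w7 : tab [0, 2, -1, -1, 2, 0, -2, 1, 1, -2] 7 = 1 := rfl
  have w8 : tab [0, 2, -1, -1, 2, 0, -2, 1, 1, -2] 8 = 1 := rfl
  have w9 : tab [0, 2, -1, -1, 2, 0, -2, 1, 1, -2] 9 = -2 := rfl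
  rw [w0, w1, w2, w3, w4, w5, w6, w7, w8, w9]
  push_cast at *
  linarith

lemma large_C (σ j : ℕ) (hσ : σ < 25) (hc : σ % 5 = 0) (hj : 115 ≤ j) :
    1 ≤ SS (LO 1 (tab [0, 0, 1, 1, 0, 0, 0, -1, -1, 0]) (tab [0, 0, 1, 1, 0, 0, 0, -1, -1, 0])) σ j := by
  rw [SS_LO 1 σ j (by norm_num) hσ _ _ (tab_five _ rfl rfl) (Or.inl rfl)]
  have hx0 : 2875 ≤ σ + 25 * j := by omega
  generalize σ + 25 * j = x at *
  obtain ⟨T, hT1, hT, hT2⟩ := exists_T x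
  have hT3 : 1 ≤ T := by
    by_contra h
    have : T ≤ 0 := by omega
    have := Nat.mul_le_mul this this
    nlinarith
  have hR := R_lower _ 0 e0 chkR_C e0_nn (by decide) σ x T hσ hc hT
  rw [H_eq 1 σ x T _ hT]
  have k2 := EE_pair 1 σ x T 2 7 1 (by norm_num) (by norm_num) hT3
  have k3 := EE_pair 1 σ x T 3 8 1 (by norm_num) (by norm_num) hT3
  simp only [Finset.sum_range_succ, Finset.sum_range_zero, zero_add, mul_zero, mul_one, Nat.reduceAdd, Nat.reduceMul, Nat.cast_one, Nat.cast_ofNat] at k2 k3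
  have l2 := Cn_lo 1 σ x 2 (by norm_num)
  have u7 := Cn_hi 1 σ x 7 (by norm_num) (by omega)
  have l3 := Cn_lo 1 σ x 3 (by norm_num)
  have u8 := Cn_hi 1 σ x 8 (by norm_num) (by omega)
  obtain ⟨t, rfl⟩ : ∃ t, T = t + 1 := ⟨T - 1, by omega⟩
  rw [Nat.add_sub_cancel] at hT2
  have hq : (200 * t * t : ℤ) ≤ x := by exact_mod_cast hT2
  have hsq := sq_nonneg ((t : ℤ) - 3)
  have hx1 : (2875 : ℤ) ≤ x := by exact_mod_cast hx0
  have w0 : tab [0, 0, 1, 1, 0, 0, 0, -1, -1, 0] 0 = 0 := rfl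
  have w1 : tab [0, 0, 1, 1, 0, 0, 0, -1, -1, 0] 1 = 0 := rfl
  have w2 : tab [0, 0, 1, 1, 0, 0, 0, -1, -1, 0] 2 = 1 := rfl
  have w3 : tab [0, 0, 1, 1, 0, 0, 0, -1, -1, 0] 3 = 1 := rfl
  have w4 : tab [0, 0, 1, 1, 0, 0, 0, -1, -1, 0] 4 = 0 := rfl
  have w5 : tab [0, 0, 1, 1, 0, 0, 0, -1, -1, 0] 5 = 0 := rfl
  have w6 : tab [0, 0, 1, 1, 0, 0, 0, -1, -1, 0] 6 = 0 := rfl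
  have w7 : tab [0, 0, 1, 1, 0, 0, 0, -1, -1, 0] 7 = -1 := rfl
  have w8 : tab [0, 0, 1, 1, 0, 0, 0, -1, -1, 0] 8 = -1 := rfl
  have w9 : tab [0, 0, 1, 1, 0, 0, 0, -1, -1, 0] 9 = 0 := rfl
  rw [w0, w1, w2, w3, w4, w5, w6, w7, w8, w9]
  push_cast at *
  linarith

lemma large_D (σ j : ℕ) (hσ : σ < 25) (hc : σ % 5 = 0) (hj : 510 ≤ j) :
    1 ≤ SS (LO 1 (tab [0, 1, -1, -1, 1, 0, -1, 1, 1, -1]) (tab [0, 1, -1, -1, 1, 0, -1, 1, 1, -1])) σ j := by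
  rw [SS_LO 1 σ j (by norm_num) hσ _ _ (tab_five _ rfl rfl) (Or.inl rfl)]
  have hx0 : 12750 ≤ σ + 25 * j := by omega
  generalize σ + 25 * j = x at *
  obtain ⟨T, hT1, hT, hT2⟩ := exists_T x
  have hT3 : 2 ≤ T := by
    by_contra h
    have : T ≤ 1 := by omega
    have := Nat.mul_le_mul this this
    nlinarith
  have hR := R_lower _ 0 e0 chkR_D e0_nn (by decide) σ x T hσ hc hT
  rw [H_eq 1 σ x T _ hT]
  have k1 := EE_pair 1 σ x T 1 6 2 (by norm_num) (by norm_num) hT3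
  have k4 := EE_pair 1 σ x T 4 9 2 (by norm_num) (by norm_num) hT3
  have k7 := EE_pair 1 σ x T 7 12 2 (by norm_num) (by norm_num) hT3
  have k8 := EE_pair 1 σ x T 8 13 2 (by norm_num) (by norm_num) hT3
  have s2 := EE_shift' 1 σ x T 2 hT
  have s3 := EE_shift' 1 σ x T 3 hT
  simp only [Finset.sum_range_succ, Finset.sum_range_zero, zero_add, mul_zero, mul_one, Nat.reduceAdd, Nat.reduceMul, Nat.cast_one, Nat.cast_ofNat] at k1 k4 k7 k8 s2 s3
  have l1 := Cn_lo 1 σ x 1 (by norm_num)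
  have u6 := Cn_hi 1 σ x 6 (by norm_num) (by omega)
  have l11 := Cn_lo 1 σ x 11 (by norm_num)
  have u16 := Cn_hi 1 σ x 16 (by norm_num) (by omega)
  have l4 := Cn_lo 1 σ x 4 (by norm_num)
  have u9 := Cn_hi 1 σ x 9 (by norm_num) (by omega)
  have l14 := Cn_lo 1 σ x 14 (by norm_num)
  have u19 := Cn_hi 1 σ x 19 (by norm_num) (by omega)
  have l7 := Cn_lo 1 σ x 7 (by norm_num)
  have u12 := Cn_hi 1 σ x 12 (by norm_num) (by omega)
  have l17 := Cn_lo 1 σ x 17 (by norm_num)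
  have u22 := Cn_hi 1 σ x 22 (by norm_num) (by omega)
  have l8 := Cn_lo 1 σ x 8 (by norm_num)
  have u13 := Cn_hi 1 σ x 13 (by norm_num) (by omega)
  have l18 := Cn_lo 1 σ x 18 (by norm_num)
  have u23 := Cn_hi 1 σ x 23 (by norm_num) (by omega)
  have u2 := Cn_hi 1 σ x 2 (by norm_num) (by omega)
  have u3 := Cn_hi 1 σ x 3 (by norm_num) (by omega)
  obtain ⟨t, rfl⟩ : ∃ t, T = t + 1 := ⟨T - 1, by omega⟩
  rw [Nat.add_sub_cancel] at hT2
  have hq : (200 * t * t : ℤ) ≤ x := by exact_mod_cast hT2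
  have hsq := sq_nonneg ((t : ℤ) - 7)
  have hx1 : (12750 : ℤ) ≤ x := by exact_mod_cast hx0
  have w0 : tab [0, 1, -1, -1, 1, 0, -1, 1, 1, -1] 0 = 0 := rfl
  have w1 : tab [0, 1, -1, -1, 1, 0, -1, 1, 1, -1] 1 = 1 := rfl
  have w2 : tab [0, 1, -1, -1, 1, 0, -1, 1, 1, -1] 2 = -1 := rfl
  have w3 : tab [0, 1, -1, -1, 1, 0, -1, 1, 1, -1] 3 = -1 := rfl
  have w4 : tab [0, 1, -1, -1, 1, 0, -1, 1, 1, -1] 4 = 1 := rfl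
  have w5 : tab [0, 1, -1, -1, 1, 0, -1, 1, 1, -1] 5 = 0 := rfl
  have w6 : tab [0, 1, -1, -1, 1, 0, -1, 1, 1, -1] 6 = -1 := rfl
  have w7 : tab [0, 1, -1, -1, 1, 0, -1, 1, 1, -1] 7 = 1 := rfl
  have w8 : tab [0, 1, -1, -1, 1, 0, -1, 1, 1, -1] 8 = 1 := rfl
  have w9 : tab [0, 1, -1, -1, 1, 0, -1, 1, 1, -1] 9 = -1 := rfl
  rw [w0, w1, w2, w3, w4, w5, w6, w7, w8, w9]
  push_cast at *
  linarith

lemma large_E (σ j : ℕ) (hσ : σ < 25) (hc : σ % 5 = 2) (hj : 115 ≤ j) :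
    1 ≤ SS (LO 1 (tab [0, 1, 1, 1, 1, 0, -1, -1, -1, -1]) (tab [0, 1, 0, 0, 1, 0, -1, 0, 0, -1])) σ j := by
  rw [SS_LO 1 σ j (by norm_num) hσ _ _ (tab_five _ rfl rfl) (Or.inl rfl)]
  have hx0 : 2875 ≤ σ + 25 * j := by omega
  generalize σ + 25 * j = x at *
  obtain ⟨T, hT1, hT, hT2⟩ := exists_T x
  have hT3 : 1 ≤ T := by
    by_contra h
    have : T ≤ 0 := by omega
    have := Nat.mul_le_mul this this
    nlinarith
  have hR := R_lower _ 2 e2 chkR_E e2_nn (by decide) σ x T hσ hc hT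
  rw [H_eq 1 σ x T _ hT]
  have k1 := EE_pair 1 σ x T 1 6 1 (by norm_num) (by norm_num) hT3
  have k4 := EE_pair 1 σ x T 4 9 1 (by norm_num) (by norm_num) hT3
  have k2 := EE_pair 1 σ x T 2 7 1 (by norm_num) (by norm_num) hT3
  have k3 := EE_pair 1 σ x T 3 8 1 (by norm_num) (by norm_num) hT3
  simp only [Finset.sum_range_succ, Finset.sum_range_zero, zero_add, mul_zero, mul_one, Nat.reduceAdd, Nat.reduceMul, Nat.cast_one, Nat.cast_ofNat] at k1 k4 k2 k3
  have l1 := Cn_lo 1 σ x 1 (by norm_num)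
  have u6 := Cn_hi 1 σ x 6 (by norm_num) (by omega)
  have l4 := Cn_lo 1 σ x 4 (by norm_num)
  have u9 := Cn_hi 1 σ x 9 (by norm_num) (by omega)
  have l2 := Cn_lo 1 σ x 2 (by norm_num)
  have u7 := Cn_hi 1 σ x 7 (by norm_num) (by omega)
  have l3 := Cn_lo 1 σ x 3 (by norm_num)
  have u8 := Cn_hi 1 σ x 8 (by norm_num) (by omega)
  obtain ⟨t, rfl⟩ : ∃ t, T = t + 1 := ⟨T - 1, by omega⟩
  rw [Nat.add_sub_cancel] at hT2
  have hq : (200 * t * t : ℤ) ≤ x := by exact_mod_cast hT2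
  have hsq := sq_nonneg ((t : ℤ) - 3)
  have hx1 : (2875 : ℤ) ≤ x := by exact_mod_cast hx0
  have w0 : tab [0, 1, 1, 1, 1, 0, -1, -1, -1, -1] 0 = 0 := rfl
  have w1 : tab [0, 1, 1, 1, 1, 0, -1, -1, -1, -1] 1 = 1 := rfl
  have w2 : tab [0, 1, 1, 1, 1, 0, -1, -1, -1, -1] 2 = 1 := rfl
  have w3 : tab [0, 1, 1, 1, 1, 0, -1, -1, -1, -1] 3 = 1 := rfl
  have w4 : tab [0, 1, 1, 1, 1, 0, -1, -1, -1, -1] 4 = 1 := rfl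
  have w5 : tab [0, 1, 1, 1, 1, 0, -1, -1, -1, -1] 5 = 0 := rfl
  have w6 : tab [0, 1, 1, 1, 1, 0, -1, -1, -1, -1] 6 = -1 := rfl
  have w7 : tab [0, 1, 1, 1, 1, 0, -1, -1, -1, -1] 7 = -1 := rfl
  have w8 : tab [0, 1, 1, 1, 1, 0, -1, -1, -1, -1] 8 = -1 := rfl
  have w9 : tab [0, 1, 1, 1, 1, 0, -1, -1, -1, -1] 9 = -1 := rfl
  rw [w0, w1, w2, w3, w4, w5, w6, w7, w8, w9]
  push_cast at *
  linarith

lemma large_F (σ j : ℕ) (hσ : σ < 25) (hj : 115 ≤ j) :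
    1 ≤ SS (LO 1 (tab [0, 0, 1, 1, 0, 0, 0, -1, -1, 0]) (tab [])) σ j := by
  rw [SS_LO 1 σ j (by norm_num) hσ _ _ (tab_five _ rfl rfl) (Or.inl rfl)]
  have hx0 : 2875 ≤ σ + 25 * j := by omega
  generalize σ + 25 * j = x at *
  obtain ⟨T, hT1, hT, hT2⟩ := exists_T x
  have hT3 : 1 ≤ T := by
    by_contra h
    have : T ≤ 0 := by omega
    have := Nat.mul_le_mul this this
    nlinarith
  rw [Rm_nil]
  rw [H_eq 1 σ x T _ hT]
  have k2 := EE_pair 1 σ x T 2 7 1 (by norm_num) (by norm_num) hT3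
  have k3 := EE_pair 1 σ x T 3 8 1 (by norm_num) (by norm_num) hT3
  simp only [Finset.sum_range_succ, Finset.sum_range_zero, zero_add, mul_zero, mul_one, Nat.reduceAdd, Nat.reduceMul, Nat.cast_one, Nat.cast_ofNat] at k2 k3
  have l2 := Cn_lo 1 σ x 2 (by norm_num)
  have u7 := Cn_hi 1 σ x 7 (by norm_num) (by omega)
  have l3 := Cn_lo 1 σ x 3 (by norm_num)
  have u8 := Cn_hi 1 σ x 8 (by norm_num) (by omega)
  obtain ⟨t, rfl⟩ : ∃ t, T = t + 1 := ⟨T - 1, by omega⟩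
  rw [Nat.add_sub_cancel] at hT2
  have hq : (200 * t * t : ℤ) ≤ x := by exact_mod_cast hT2
  have hsq := sq_nonneg ((t : ℤ) - 3)
  have hx1 : (2875 : ℤ) ≤ x := by exact_mod_cast hx0
  have w0 : tab [0, 0, 1, 1, 0, 0, 0, -1, -1, 0] 0 = 0 := rfl
  have w1 : tab [0, 0, 1, 1, 0, 0, 0, -1, -1, 0] 1 = 0 := rfl
  have w2 : tab [0, 0, 1, 1, 0, 0, 0, -1, -1, 0] 2 = 1 := rfl
  have w3 : tab [0, 0, 1, 1, 0, 0, 0, -1, -1, 0] 3 = 1 := rfl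
  have w4 : tab [0, 0, 1, 1, 0, 0, 0, -1, -1, 0] 4 = 0 := rfl
  have w5 : tab [0, 0, 1, 1, 0, 0, 0, -1, -1, 0] 5 = 0 := rfl
  have w6 : tab [0, 0, 1, 1, 0, 0, 0, -1, -1, 0] 6 = 0 := rfl
  have w7 : tab [0, 0, 1, 1, 0, 0, 0, -1, -1, 0] 7 = -1 := rfl
  have w8 : tab [0, 0, 1, 1, 0, 0, 0, -1, -1, 0] 8 = -1 := rfl
  have w9 : tab [0, 0, 1, 1, 0, 0, 0, -1, -1, 0] 9 = 0 := rfl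
  rw [w0, w1, w2, w3, w4, w5, w6, w7, w8, w9]
  push_cast at *
  linarith

lemma large_G (σ j : ℕ) (hσ : σ < 25) (hj : 115 ≤ j) :
    1 ≤ SS (LO 0 (tab [0, 1, 1, -1, -1, 0, 1, 1, -1, -1]) (tab [])) σ j := by
  rw [SS_LO 0 σ j (by norm_num) hσ _ _ (tab_five _ rfl rfl) (Or.inr (by funext n; simp [tab]))]
  have hx0 : 2875 ≤ σ + 25 * j := by omega
  generalize σ + 25 * j = x at *
  obtain ⟨T, hT1, hT, hT2⟩ := exists_T x
  have hT3 : 1 ≤ T := by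
    by_contra h
    have : T ≤ 0 := by omega
    have := Nat.mul_le_mul this this
    nlinarith
  rw [Rm_nil]
  rw [H_eq 0 σ x T _ hT]
  have k1 := EE_pair 0 σ x T 1 4 1 (by norm_num) (by norm_num) hT3
  have k6 := EE_pair 0 σ x T 6 9 1 (by norm_num) (by norm_num) hT3
  have k2 := EE_pair 0 σ x T 2 3 1 (by norm_num) (by norm_num) hT3
  have k7 := EE_pair 0 σ x T 7 8 1 (by norm_num) (by norm_num) hT3
  simp only [Finset.sum_range_succ, Finset.sum_range_zero, zero_add, mul_zero, mul_one, Nat.reduceAdd, Nat.reduceMul, Nat.cast_one, Nat.cast_ofNat] at k1 k6 k2 k7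
  have l1 := Cn_lo 0 σ x 1 (by norm_num)
  have u4 := Cn_hi 0 σ x 4 (by norm_num) (by omega)
  have l6 := Cn_lo 0 σ x 6 (by norm_num)
  have u9 := Cn_hi 0 σ x 9 (by norm_num) (by omega)
  have l2 := Cn_lo 0 σ x 2 (by norm_num)
  have u3 := Cn_hi 0 σ x 3 (by norm_num) (by omega)
  have l7 := Cn_lo 0 σ x 7 (by norm_num)
  have u8 := Cn_hi 0 σ x 8 (by norm_num) (by omega)
  obtain ⟨t, rfl⟩ : ∃ t, T = t + 1 := ⟨T - 1, by omega⟩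
  rw [Nat.add_sub_cancel] at hT2
  have hq : (200 * t * t : ℤ) ≤ x := by exact_mod_cast hT2
  have hsq := sq_nonneg ((t : ℤ) - 3)
  have hx1 : (2875 : ℤ) ≤ x := by exact_mod_cast hx0
  have w0 : tab [0, 1, 1, -1, -1, 0, 1, 1, -1, -1] 0 = 0 := rfl
  have w1 : tab [0, 1, 1, -1, -1, 0, 1, 1, -1, -1] 1 = 1 := rfl
  have w2 : tab [0, 1, 1, -1, -1, 0, 1, 1, -1, -1] 2 = 1 := rfl
  have w3 : tab [0, 1, 1, -1, -1, 0, 1, 1, -1, -1] 3 = -1 := rfl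
  have w4 : tab [0, 1, 1, -1, -1, 0, 1, 1, -1, -1] 4 = -1 := rfl
  have w5 : tab [0, 1, 1, -1, -1, 0, 1, 1, -1, -1] 5 = 0 := rfl
  have w6 : tab [0, 1, 1, -1, -1, 0, 1, 1, -1, -1] 6 = 1 := rfl
  have w7 : tab [0, 1, 1, -1, -1, 0, 1, 1, -1, -1] 7 = 1 := rfl
  have w8 : tab [0, 1, 1, -1, -1, 0, 1, 1, -1, -1] 8 = -1 := rfl
  have w9 : tab [0, 1, 1, -1, -1, 0, 1, 1, -1, -1] 9 = -1 := rfl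
  rw [w0, w1, w2, w3, w4, w5, w6, w7, w8, w9]
  push_cast at *
  linarith

lemma large_H (σ j : ℕ) (hσ : σ < 25) (hj : 115 ≤ j) :
    1 ≤ SS (LO 0 (tab [0, 1, -1, 1, -1, 0, 1, -1, 1, -1]) (tab [])) σ j := by
  rw [SS_LO 0 σ j (by norm_num) hσ _ _ (tab_five _ rfl rfl) (Or.inr (by funext n; simp [tab]))]
  have hx0 : 2875 ≤ σ + 25 * j := by omega
  generalize σ + 25 * j = x at *
  obtain ⟨T, hT1, hT, hT2⟩ := exists_T x
  have hT3 : 1 ≤ T := by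
    by_contra h
    have : T ≤ 0 := by omega
    have := Nat.mul_le_mul this this
    nlinarith
  rw [Rm_nil]
  rw [H_eq 0 σ x T _ hT]
  have k1 := EE_pair 0 σ x T 1 4 1 (by norm_num) (by norm_num) hT3
  have k6 := EE_pair 0 σ x T 6 9 1 (by norm_num) (by norm_num) hT3
  have k3 := EE_pair 0 σ x T 3 7 1 (by norm_num) (by norm_num) hT3
  have k8 := EE_pair 0 σ x T 8 12 1 (by norm_num) (by norm_num) hT3
  have s2 := EE_shift' 0 σ x T 2 hT
  simp only [Finset.sum_range_succ, Finset.sum_range_zero, zero_add, mul_zero, mul_one, Nat.reduceAdd, Nat.reduceMul, Nat.cast_one, Nat.cast_ofNat] at k1 k6 k3 k8 s2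
  have l1 := Cn_lo 0 σ x 1 (by norm_num)
  have u4 := Cn_hi 0 σ x 4 (by norm_num) (by omega)
  have l6 := Cn_lo 0 σ x 6 (by norm_num)
  have u9 := Cn_hi 0 σ x 9 (by norm_num) (by omega)
  have l3 := Cn_lo 0 σ x 3 (by norm_num)
  have u7 := Cn_hi 0 σ x 7 (by norm_num) (by omega)
  have l8 := Cn_lo 0 σ x 8 (by norm_num)
  have u12 := Cn_hi 0 σ x 12 (by norm_num) (by omega)
  have u2 := Cn_hi 0 σ x 2 (by norm_num) (by omega)
  obtain ⟨t, rfl⟩ : ∃ t, T = t + 1 := ⟨T - 1, by omega⟩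
  rw [Nat.add_sub_cancel] at hT2
  have hq : (200 * t * t : ℤ) ≤ x := by exact_mod_cast hT2
  have hsq := sq_nonneg ((t : ℤ) - 3)
  have hx1 : (2875 : ℤ) ≤ x := by exact_mod_cast hx0
  have w0 : tab [0, 1, -1, 1, -1, 0, 1, -1, 1, -1] 0 = 0 := rfl
  have w1 : tab [0, 1, -1, 1, -1, 0, 1, -1, 1, -1] 1 = 1 := rfl
  have w2 : tab [0, 1, -1, 1, -1, 0, 1, -1, 1, -1] 2 = -1 := rfl
  have w3 : tab [0, 1, -1, 1, -1, 0, 1, -1, 1, -1] 3 = 1 := rfl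
  have w4 : tab [0, 1, -1, 1, -1, 0, 1, -1, 1, -1] 4 = -1 := rfl
  have w5 : tab [0, 1, -1, 1, -1, 0, 1, -1, 1, -1] 5 = 0 := rfl
  have w6 : tab [0, 1, -1, 1, -1, 0, 1, -1, 1, -1] 6 = 1 := rfl
  have w7 : tab [0, 1, -1, 1, -1, 0, 1, -1, 1, -1] 7 = -1 := rfl
  have w8 : tab [0, 1, -1, 1, -1, 0, 1, -1, 1, -1] 8 = 1 := rfl
  have w9 : tab [0, 1, -1, 1, -1, 0, 1, -1, 1, -1] 9 = -1 := rfl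
  rw [w0, w1, w2, w3, w4, w5, w6, w7, w8, w9]
  push_cast at *
  linarith
end part_P10

section part_P11
open Filter Topology
/-- plain recursive sum, convenient for kernel evaluation -/
def sumN (f : ℕ → ℕ) (n : ℕ) : ℕ := Nat.rec 0 (fun k ih => Nat.add ih (f k)) n

lemma sumN_eq (f : ℕ → ℕ) (n : ℕ) : sumN f n = ∑ k ∈ Finset.range n, f k := by
  induction n with
  | zero => rfl
  | succ n ih => rw [Finset.sum_range_succ, ← ih]; rfl

def enc (l : List ℤ) (n : ℕ) : ℕ := (tab l n + 4).toNat

def tk (p : ℕ) (w r : List ℤ) (N k : ℕ) : ℕ :=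
  Nat.add
    (cond (Nat.beq (Nat.mod N k) 0)
      (cond (Nat.beq (Nat.mod (Nat.div N k) 2) p) (cond (Nat.ble (Nat.succ (Nat.mul 2 k)) (Nat.div N k)) (enc w k) 4) 4) 4)
    (cond (Nat.beq (Nat.mod N (Nat.add (Nat.mul 2 k) p)) 0)
      (cond (Nat.ble (Nat.add (Nat.mul 2 k) p) (Nat.mul 2 (Nat.div N (Nat.add (Nat.mul 2 k) p))))
        (enc r (Nat.div N (Nat.add (Nat.mul 2 k) p))) 4) 4)

def Bd (N : ℕ) : ℕ := Nat.add (Nat.div N 280) 37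

lemma Bd_spec (N n : ℕ) (h : 2 * n * n ≤ N) : n < Bd N := by
  change n < N / 280 + 37
  have h1 : 280 * n ≤ 2 * n * n + 9800 := by
    have := sq_nonneg ((n : ℤ) - 70)
    zify; nlinarith
  omega

lemma enc_eq (l : List ℤ) (hl : ∀ i < 10, -4 ≤ l.getD i 0) (n : ℕ) : (enc l n : ℤ) = tab l n + 4 := by
  have := hl (n % 10) (by omega)
  rw [enc, Int.toNat_of_nonneg]
  rw [tab]; omega

lemma beq_dec (a b : ℕ) : Nat.beq a b = decide (a = b) := by
  rw [Bool.eq_iff_iff, Nat.beq_eq, decide_eq_true_eq]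
lemma ble_dec (a b : ℕ) : Nat.ble a b = decide (a ≤ b) := by
  rw [Bool.eq_iff_iff, Nat.ble_eq, decide_eq_true_eq]

lemma tk_eq (p : ℕ) (w r : List ℤ) (hw : ∀ i < 10, -4 ≤ w.getD i 0) (hr : ∀ i < 10, -4 ≤ r.getD i 0) (N k : ℕ) :
    (tk p w r N k : ℤ) = (if k ∣ N ∧ (N / k) % 2 = p ∧ 2 * k < N / k then tab w k else 0)
      + (if (2 * k + p) ∣ N ∧ 2 * k + p ≤ 2 * (N / (2 * k + p)) then tab r (N / (2 * k + p)) else 0) + 8 := by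
  have e1 : ((cond (Nat.beq (Nat.mod N k) 0)
      (cond (Nat.beq (Nat.mod (Nat.div N k) 2) p) (cond (Nat.ble (Nat.succ (Nat.mul 2 k)) (Nat.div N k)) (enc w k) 4) 4) 4 : ℕ) : ℤ)
      = (if k ∣ N ∧ (N / k) % 2 = p ∧ 2 * k < N / k then tab w k else 0) + 4 := by
    change ((cond (Nat.beq (N % k) 0)
      (cond (Nat.beq ((N / k) % 2) p) (cond (Nat.ble (2 * k + 1) (N / k)) (enc w k) 4) 4) 4 : ℕ) : ℤ) = _
    rw [beq_dec, beq_dec, ble_dec]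
    by_cases h1 : N % k = 0 <;> by_cases h2 : (N / k) % 2 = p <;> by_cases h3 : 2 * k < N / k <;>
      simp [Nat.dvd_iff_mod_eq_zero, h1, h2, Nat.succ_le_iff, enc_eq w hw, h3]
  have e2 : ((cond (Nat.beq (Nat.mod N (Nat.add (Nat.mul 2 k) p)) 0)
      (cond (Nat.ble (Nat.add (Nat.mul 2 k) p) (Nat.mul 2 (Nat.div N (Nat.add (Nat.mul 2 k) p))))
        (enc r (Nat.div N (Nat.add (Nat.mul 2 k) p))) 4) 4 : ℕ) : ℤ)
      = (if (2 * k + p) ∣ N ∧ 2 * k + p ≤ 2 * (N / (2 * k + p)) then tab r (N / (2 * k + p)) else 0) + 4 := by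
    change ((cond (Nat.beq (N % (2 * k + p)) 0)
      (cond (Nat.ble (2 * k + p) (2 * (N / (2 * k + p))))
        (enc r (N / (2 * k + p))) 4) 4 : ℕ) : ℤ) = _
    generalize 2 * k + p = M
    rw [beq_dec, ble_dec]
    by_cases h1 : N % M = 0 <;> by_cases h3 : M ≤ 2 * (N / M) <;>
      simp [Nat.dvd_iff_mod_eq_zero, h1, enc_eq r hr, h3]
  change ((_ + _ : ℕ) : ℤ) = _
  rw [Nat.cast_add, e1, e2]; ring

lemma fast1' (p : ℕ) (w : ℕ → ℤ) (N : ℕ) (hN : 0 < N) :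
    DS N (fun n M => if M % 2 = p then (if 2 * n < M then w n else 0) else 0) =
    ∑ k ∈ Finset.range (Bd N), if k ∣ N ∧ (N / k) % 2 = p ∧ 2 * k < N / k then w k else 0 := by
  rw [DS, Nat.sum_divisorsAntidiagonal (fun n M => if M % 2 = p then (if 2 * n < M then w n else 0) else 0)]
  have h1 : ∀ n ∈ N.divisors, (if N / n % 2 = p then (if 2 * n < N / n then w n else 0) else 0) =
      if n ∣ N ∧ (N / n) % 2 = p ∧ 2 * n < N / n then w n else 0 := by
    intro n hn
    rw [Nat.mem_divisors] at hn
    by_cases h2 : N / n % 2 = p <;> by_cases h3 : 2 * n < N / n <;> simp [hn.1, h2, h3]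
  rw [Finset.sum_congr rfl h1, ← Finset.sum_filter, ← Finset.sum_filter]
  refine Finset.sum_congr ?_ fun _ _ => rfl
  ext n
  simp only [Finset.mem_filter, Nat.mem_divisors, Finset.mem_range]
  constructor
  · rintro ⟨⟨a, b⟩, c⟩
    refine ⟨Bd_spec _ _ ?_, c⟩
    obtain ⟨m, rfl⟩ := a
    have hn : 0 < n := Nat.pos_of_ne_zero (by rintro rfl; simp at hN)
    rw [Nat.mul_div_cancel_left _ hn] at c
    nlinarith [c.2.2]
  · rintro ⟨_, c⟩
    exact ⟨⟨c.1, by omega⟩, c⟩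

lemma fast2 (p : ℕ) (hp : p < 2) (r : ℕ → ℤ) (N : ℕ) (hN : 0 < N) :
    DS N (fun n M => if M % 2 = p then (if 2 * n < M then 0 else r n) else 0) =
    ∑ k ∈ Finset.range (Bd N), if (2 * k + p) ∣ N ∧ 2 * k + p ≤ 2 * (N / (2 * k + p)) then r (N / (2 * k + p)) else 0 := by
  rw [DS, Nat.sum_divisorsAntidiagonal' (fun n M => if M % 2 = p then (if 2 * n < M then 0 else r n) else 0)]
  have h1 : ∀ M ∈ N.divisors, (if M % 2 = p then (if 2 * (N / M) < M then 0 else r (N / M)) else 0) =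
      if M % 2 = p ∧ M ∣ N ∧ M ≤ 2 * (N / M) then r (N / M) else 0 := by
    intro n hn
    rw [Nat.mem_divisors] at hn
    by_cases h2 : n % 2 = p <;> by_cases h3 : 2 * (N / n) < n <;> simp [hn.1, h2, h3, Nat.not_le.2, Nat.not_lt.1]
  rw [Finset.sum_congr rfl h1, ← Finset.sum_filter, ← Finset.sum_filter]
  refine Finset.sum_bij' (fun M _ => M / 2) (fun k _ => 2 * k + p) ?_ ?_ ?_ ?_ ?_
  · intro M hM
    simp only [Finset.mem_filter, Nat.mem_divisors, Finset.mem_range] at *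
    have e : 2 * (M / 2) + p = M := by omega
    rw [e]
    refine ⟨Bd_spec _ _ ?_, hM.2.2⟩
    obtain ⟨m, rfl⟩ := hM.1.1
    have hn : 0 < M := Nat.pos_of_ne_zero (by rintro rfl; simp at hN)
    have h3 := hM.2.2.2
    rw [Nat.mul_div_cancel_left _ hn] at h3
    have h4 : 2 * (M / 2) ≤ M := by omega
    have h5 : M / 2 ≤ m := by omega
    exact Nat.mul_le_mul h4 h5
  · intro k hk
    simp only [Finset.mem_filter, Nat.mem_divisors, Finset.mem_range] at *
    exact ⟨⟨hk.2.1, by omega⟩, by omega, hk.2⟩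
  · intro M hM
    simp only [Finset.mem_filter, Nat.mem_divisors, Finset.mem_range] at *
    omega
  · intro k hk
    omega
  · intro M hM
    simp only [Finset.mem_filter, Nat.mem_divisors, Finset.mem_range] at *
    have e : 2 * (M / 2) + p = M := by omega
    rw [e]

def Lsum (p : ℕ) (w r : List ℤ) (N : ℕ) : ℕ := sumN (tk p w r N) (Bd N)

lemma LO_fast (p : ℕ) (hp : p < 2) (w r : List ℤ) (hw : ∀ i < 10, -4 ≤ w.getD i 0) (hr : ∀ i < 10, -4 ≤ r.getD i 0) (N : ℕ) (hN : 0 < N) :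
    LO p (tab w) (tab r) N = (Lsum p w r N : ℤ) - 8 * Bd N := by
  have e : LO p (tab w) (tab r) N = DS N (fun n M => (if M % 2 = p then (if 2 * n < M then tab w n else 0) else 0)
      + (if M % 2 = p then (if 2 * n < M then 0 else tab r n) else 0)) :=
    DS_congr fun n M _ => by split_ifs <;> ring
  rw [e, DS_add, fast1' p _ N hN, fast2 p hp _ N hN, Lsum, sumN_eq, Nat.cast_sum,
    Finset.sum_congr rfl fun k _ => tk_eq p w r hw hr N k]
  rw [Finset.sum_add_distrib, Finset.sum_add_distrib]
  simp; ring

lemma LO_zero (p : ℕ) (w r : ℕ → ℤ) : LO p w r 0 = 0 := by simp [LO, DS]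

/-- fast value, also at 0 -/
def Lf (p : ℕ) (w r : List ℤ) (N : ℕ) : ℤ := if N = 0 then 0 else (Lsum p w r N : ℤ) - 8 * Bd N

lemma LO_Lf (p : ℕ) (hp : p < 2) (w r : List ℤ) (hw : ∀ i < 10, -4 ≤ w.getD i 0) (hr : ∀ i < 10, -4 ≤ r.getD i 0) (N : ℕ) :
    LO p (tab w) (tab r) N = Lf p w r N := by
  rw [Lf]
  split_ifs with h
  · rw [h, LO_zero]
  · exact LO_fast p hp w r hw hr N (by omega)

/-- running partial sums, absorbed at 0 -/
def Zr (p : ℕ) (w r : List ℤ) (σ z0 i : ℕ) : ℕ :=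
  Nat.rec z0 (fun i ih => Nat.rec 0 (fun s _ =>
    Nat.sub (Nat.add (Nat.succ s) (Lsum p w r (Nat.add σ (Nat.mul 25 (Nat.add i 14)))))
      (Nat.mul 8 (Bd (Nat.add σ (Nat.mul 25 (Nat.add i 14)))))) ih) i

lemma Zr_succ (p : ℕ) (w r : List ℤ) (σ z0 i : ℕ) (h : Zr p w r σ z0 i ≠ 0) : Zr p w r σ z0 (i + 1) =
    Zr p w r σ z0 i + Lsum p w r (σ + 25 * (i + 14)) - 8 * Bd (σ + 25 * (i + 14)) := by
  obtain ⟨s, hs⟩ := Nat.exists_eq_succ_of_ne_zero h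
  rw [hs]
  have : Zr p w r σ z0 (i + 1) = Nat.rec 0 (fun s _ =>
    Nat.sub (Nat.add (Nat.succ s) (Lsum p w r (Nat.add σ (Nat.mul 25 (Nat.add i 14)))))
      (Nat.mul 8 (Bd (Nat.add σ (Nat.mul 25 (Nat.add i 14)))))) (Zr p w r σ z0 i) := rfl
  rw [this, hs]
  rfl

lemma Zr_zero (p : ℕ) (w r : List ℤ) (σ z0 i : ℕ) (h : Zr p w r σ z0 i = 0) : Zr p w r σ z0 (i + 1) = 0 := by
  have : Zr p w r σ z0 (i + 1) = Nat.rec 0 (fun s _ =>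
    Nat.sub (Nat.add (Nat.succ s) (Lsum p w r (Nat.add σ (Nat.mul 25 (Nat.add i 14)))))
      (Nat.mul 8 (Bd (Nat.add σ (Nat.mul 25 (Nat.add i 14)))))) (Zr p w r σ z0 i) := rfl
  rw [this, h]
  rfl

lemma Zr_spec (p : ℕ) (hp : p < 2) (w r : List ℤ) (hw : ∀ i < 10, -4 ≤ w.getD i 0) (hr : ∀ i < 10, -4 ≤ r.getD i 0)
    (σ z0 I : ℕ) (h0 : SS (LO p (tab w) (tab r)) σ 13 = z0) (h : Zr p w r σ z0 I ≠ 0) (i : ℕ) (hi : i ≤ I) :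
    1 ≤ SS (LO p (tab w) (tab r)) σ (13 + i) := by
  have hne : ∀ i ≤ I, Zr p w r σ z0 i ≠ 0 := by
    have hz : ∀ i d, Zr p w r σ z0 i = 0 → Zr p w r σ z0 (i + d) = 0 := by
      intro i d hi
      induction d with
      | zero => exact hi
      | succ d ih => exact Zr_zero _ _ _ _ _ _ ih
    intro i hi h2
    obtain ⟨d, rfl⟩ := Nat.exists_eq_add_of_le hi
    exact h (hz i d h2)
  have hv : ∀ i ≤ I, SS (LO p (tab w) (tab r)) σ (13 + i) = Zr p w r σ z0 i := by
    intro i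
    induction i with
    | zero => intro _; exact h0
    | succ i ih =>
      intro hi
      have h1 := ih (by omega)
      have h2 := Zr_succ p w r σ z0 i (hne i (by omega))
      have h3 := hne (i + 1) hi
      have h4 := LO_fast p hp w r hw hr (σ + 25 * (i + 14)) (by omega)
      have e : SS (LO p (tab w) (tab r)) σ (13 + (i + 1)) = SS (LO p (tab w) (tab r)) σ (13 + i) + LO p (tab w) (tab r) (σ + 25 * (i + 14)) := by
        rw [SS, ← add_assoc, Finset.sum_range_succ, ← SS, show 13 + i + 1 = i + 14 by omega]
      rw [e, h1, h4]
      omega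
  rw [hv i hi]
  have := hne i hi
  omega

def SSf (p : ℕ) (w r : List ℤ) (σ j : ℕ) : ℤ := Nat.rec (Lf p w r σ) (fun i ih => ih + Lf p w r (σ + 25 * (i + 1))) j

lemma SS_SSf (p : ℕ) (hp : p < 2) (w r : List ℤ) (hw : ∀ i < 10, -4 ≤ w.getD i 0) (hr : ∀ i < 10, -4 ≤ r.getD i 0) (σ j : ℕ) :
    SS (LO p (tab w) (tab r)) σ j = SSf p w r σ j := by
  induction j with
  | zero => simp [SS, SSf, LO_Lf p hp w r hw hr]
  | succ j ih =>
    rw [SS, Finset.sum_range_succ, ← SS, ih, LO_Lf p hp w r hw hr]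
    rfl
end part_P11

section part_P12
open Filter Topology
lemma DS_flip (N : ℕ) (f : ℕ → ℕ → ℤ) : DS N (fun n M => if M % 2 = 0 then f n (M / 2) else 0)
    = DS N (fun n M => if M % 2 = 0 then f (M / 2) n else 0) := by
  rw [DS, DS, ← Finset.sum_filter (fun x : ℕ × ℕ => x.2 % 2 = 0) (fun x => f x.1 (x.2 / 2)),
    ← Finset.sum_filter (fun x : ℕ × ℕ => x.2 % 2 = 0) (fun x => f (x.2 / 2) x.1)]
  have key : ∀ x : ℕ × ℕ, x.1 * x.2 = N ∧ N ≠ 0 → x.2 % 2 = 0 → (x.2 / 2 * (2 * x.1) = N ∧ N ≠ 0) := by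
    rintro ⟨n, M⟩ ⟨h1, h2⟩ h3
    refine ⟨?_, h2⟩
    obtain ⟨m, rfl⟩ : ∃ m, M = 2 * m := ⟨M / 2, by dsimp only at h3; omega⟩
    dsimp only at *
    rw [← h1, Nat.mul_div_cancel_left _ (by norm_num)]; ring
  refine Finset.sum_bij' (fun x _ => (x.2 / 2, 2 * x.1)) (fun x _ => (x.2 / 2, 2 * x.1)) ?_ ?_ ?_ ?_ ?_
  · intro x hx
    simp only [Finset.mem_filter, Nat.mem_divisorsAntidiagonal] at *
    exact ⟨key x hx.1 hx.2, by omega⟩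
  · intro x hx
    simp only [Finset.mem_filter, Nat.mem_divisorsAntidiagonal] at *
    exact ⟨key x hx.1 hx.2, by omega⟩
  · intro x hx
    simp only [Finset.mem_filter, Nat.mem_divisorsAntidiagonal] at *
    exact Prod.ext (by dsimp only; omega) (by dsimp only; omega)
  · intro x hx
    simp only [Finset.mem_filter, Nat.mem_divisorsAntidiagonal] at *
    exact Prod.ext (by dsimp only; omega) (by dsimp only; omega)
  · intro x hx
    dsimp only
    congr 1; omega

lemma uu_mod (n : ℕ) : uu n = uu (n % 10) := by
  rw [uu, uu, av_mod n, av_mod (n % 10), Nat.mod_mod_of_dvd _ (by norm_num),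
    neg_one_pow_eq_pow_mod_two, neg_one_pow_eq_pow_mod_two (n := n % 10), Nat.mod_mod_of_dvd _ (by norm_num)]
lemma vu_mod (n : ℕ) : vu n = vu (n % 10) := by
  rw [vu, vu, bv_mod n, bv_mod (n % 10), Nat.mod_mod_of_dvd _ (by norm_num),
    neg_one_pow_eq_pow_mod_two, neg_one_pow_eq_pow_mod_two (n := n % 10), Nat.mod_mod_of_dvd _ (by norm_num)]

lemma tab_of (l : List ℤ) (f : ℕ → ℤ) (hf : ∀ n, f n = f (n % 10)) (h : ∀ m < 10, f m = l.getD m 0) (n : ℕ) :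
    tab l n = f n := by
  rw [tab, hf, h _ (Nat.mod_lt _ (by norm_num))]

/-- linear combinations of the basic sums are `LO` sums -/
lemma LO_comb (w r : List ℤ) (c1 c2 c3 c4 : ℤ)
    (hw : ∀ m < 10, (c1 + c3) * uu m + (c2 + c4) * vu m = w.getD m 0)
    (hr : ∀ m < 10, c1 * uu m + c2 * vu m = r.getD m 0) (N : ℕ) :
    LO 1 (tab w) (tab r) N = c1 * LU N + c2 * LV N + c3 * HU N + c4 * HV N := by
  rw [LU, LV, HU, HV, ← DS_mul, ← DS_mul, ← DS_mul, ← DS_mul, ← DS_add, ← DS_add, ← DS_add]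
  refine DS_congr fun n M _ => ?_
  rw [tab_of w (fun m => (c1 + c3) * uu m + (c2 + c4) * vu m) (fun n => by rw [← uu_mod, ← vu_mod]) hw,
    tab_of r (fun m => c1 * uu m + c2 * vu m) (fun n => by rw [← uu_mod, ← vu_mod]) hr]
  by_cases h1 : M % 2 = 1
  · by_cases h2 : 2 * n < M
    · have h3 : n ≤ M / 2 := by omega
      simp only [h1, h2, h3, if_true, and_self]; ring
    · have h3 : ¬ n ≤ M / 2 := by omega
      simp only [h1, h2, h3, if_true, if_false, and_false]; ring
  · simp only [h1, if_false, false_and]; ring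

lemma LO_EA (ε : ℤ) (c : ℕ) (w : List ℤ) (hw : ∀ m < 10, av m + ε * bv m = w.getD m 0)
    (hb : ∀ a < 5, ∀ b < 5, 2 * (a * b) % 5 = c → av b = ε * bv a)
    (hd : ∀ a < 5, 2 * (a * a) % 5 ≠ c) (N : ℕ) (hN : N % 5 = c) :
    LO 0 (tab w) (tab []) N = EA N := by
  have e1 : EA N = DS N (fun n M => if M % 2 = 0 then (if n < M / 2 then av n else 0) else 0)
      + DS N (fun n M => if M % 2 = 0 then (if M / 2 < n then av n else 0) else 0) := by
    rw [EA, ← DS_add]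
    refine DS_congr fun n M h => ?_
    by_cases h1 : M % 2 = 0
    · have h2 : n ≠ M / 2 := by
        rintro rfl
        apply hd (M / 2 % 5) (by omega)
        rw [← hN, ← h]
        conv_rhs => rw [show M / 2 * M = 2 * (M / 2 * (M / 2)) by
          conv_lhs => rw [show M = 2 * (M / 2) by omega, Nat.mul_div_cancel_left _ (by norm_num : 0 < 2)]
          ring]
        simp [Nat.mul_mod]
      rcases lt_or_gt_of_ne h2 with h3 | h3
      · simp [h1, h3, h3.le.not_gt]
      · simp [h1, h3, h3.le.not_gt]
    · simp [h1]
  rw [e1, DS_flip N (fun n m => if m < n then av n else 0), ← DS_add]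
  refine DS_congr fun n M h => ?_
  rw [tab_of w (fun m => av m + ε * bv m) (fun n => by
    rw [av_mod n, bv_mod n, av_mod (n % 10), bv_mod (n % 10), Nat.mod_mod_of_dvd _ (by norm_num)]) hw]
  by_cases h1 : M % 2 = 0
  · have h4 : av (M / 2) = ε * bv n := by
      rw [av_mod, bv_mod]
      apply hb _ (by omega) _ (by omega)
      rw [← hN, ← h]
      conv_rhs => rw [show n * M = 2 * (n * (M / 2)) by
        conv_lhs => rw [show M = 2 * (M / 2) by omega]
        ring]
      simp [Nat.mul_mod]
    have h5 : 2 * n < M ↔ n < M / 2 := by omega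
    simp only [h1, h5, if_true, h4]
    split_ifs <;> simp [tab]
  · simp [h1]

def chkS (p : ℕ) (w r : List ℤ) (σ I : ℕ) (lo : List ℤ) : Bool :=
  (List.range 13).all (fun j => decide (lo.getD j 0 ≤ SSf p w r σ j)) &&
  (decide (0 ≤ SSf p w r σ 13) && Nat.ble 1 (Zr p w r σ (SSf p w r σ 13).toNat I))

lemma chkS_spec (p : ℕ) (hp : p < 2) (w r : List ℤ) (hw : ∀ i < 10, -4 ≤ w.getD i 0) (hr : ∀ i < 10, -4 ≤ r.getD i 0)
    (σ I : ℕ) (lo : List ℤ) (h : chkS p w r σ I lo = true)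
    (hl : ∀ j, 13 + I ≤ j → 1 ≤ SS (LO p (tab w) (tab r)) σ j) :
    (∀ j < 13, lo.getD j 0 ≤ SS (LO p (tab w) (tab r)) σ j) ∧ ∀ j, 13 ≤ j → 1 ≤ SS (LO p (tab w) (tab r)) σ j := by
  simp only [chkS, Bool.and_eq_true, List.all_eq_true, List.mem_range, decide_eq_true_eq] at h
  refine ⟨fun j hj => ?_, fun j hj => ?_⟩
  · rw [SS_SSf p hp w r hw hr]; exact h.1 j hj
  · rcases le_total (13 + I) j with h1 | h1
    · exact hl j h1
    · obtain ⟨i, rfl⟩ := Nat.exists_eq_add_of_le hj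
      refine Zr_spec p hp w r hw hr σ (SSf p w r σ 13).toNat I ?_ ?_ i (by omega)
      · rw [SS_SSf p hp w r hw hr, Int.toNat_of_nonneg h.2.1]
      · have := Nat.le_of_ble_eq_true h.2.2
        omega
end part_P12

section part_P13
open Filter Topology
noncomputable def Ak (k : ℕ) : PowerSeries ℤ := ser (Fs k)

lemma Od_Fs (k : ℕ) : Od (Fs k) := fun N s h => by rw [Fs, PowerSeries.coeff_mk, pF_zero k s N h]

lemma Ak_zero : Ak 0 = 1 := by
  rw [Ak, ser_succ (Od_Fs 0), Fs_zero]
  have : (fun k => Fs 0 (k + 1)) = fun _ => (0 : PowerSeries ℤ) := funext fun s => Fs_zero_succ s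
  rw [this]
  ext n; simp [ser]

lemma Ak_succ (k : ℕ) : Ak (k + 1) = (1 + PowerSeries.X ^ (2 * k + 1)) * Ak k + PowerSeries.X ^ (2 * k + 2) * Ak (k + 1) := by
  have h1 : Ak k = 1 + ser (fun s => Fs k (s + 1)) := by rw [Ak, ser_succ (Od_Fs k), Fs_zero]
  have h2 : Ak (k + 1) = 1 + ser (fun s => Fs (k + 1) (s + 1)) := by rw [Ak, ser_succ (Od_Fs (k + 1)), Fs_zero]
  have h3 : (fun s => Fs (k + 1) (s + 1)) = fun s => (Fs k (s + 1) + PowerSeries.X ^ (2 * k + 1) * Fs k s) + PowerSeries.X ^ (2 * k + 2) * Fs (k + 1) s :=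
    funext fun s => Fs_succ k s
  have h4 : ser (fun s => Fs (k + 1) (s + 1)) = ser (fun s => Fs k (s + 1)) + PowerSeries.X ^ (2 * k + 1) * Ak k + PowerSeries.X ^ (2 * k + 2) * Ak (k + 1) := by
    rw [h3, ser_add, ser_add, ser_mul (Od_Fs k), ser_mul (Od_Fs (k + 1))]; rfl
  linear_combination h2 + h4 - h1

lemma Ak_stable (N k d : ℕ) (h : N ≤ 2 * k) : PowerSeries.coeff N (Ak (k + d)) = PowerSeries.coeff N (Ak k) := by
  induction d with
  | zero => rfl
  | succ d ih =>
    rw [← add_assoc, Ak_succ, add_mul, one_mul, map_add, map_add, PowerSeries.coeff_X_pow_mul', PowerSeries.coeff_X_pow_mul',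
      if_neg (by omega), if_neg (by omega), ih]
    ring

lemma Ps_Ak_self (N : ℕ) : PowerSeries.coeff N Ps = PowerSeries.coeff N (Ak N) := by
  rw [Ps, Sr, PowerSeries.coeff_mk, Ak, ser, PowerSeries.coeff_mk, Finset.sum_comm]
  refine Finset.sum_congr rfl fun s _ => ?_
  rw [← sum_Es, map_sum]
  refine Finset.sum_congr rfl fun k _ => ?_
  rw [one_mul, Es, PowerSeries.coeff_mk]

lemma Ps_Ak (N K : ℕ) (h : N ≤ K) : PowerSeries.coeff N Ps = PowerSeries.coeff N (Ak K) := by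
  obtain ⟨d, rfl⟩ := Nat.exists_eq_add_of_le h
  rw [Ps_Ak_self, Ak_stable N N d (by omega)]

lemma mul_Ps_Ak (g : PowerSeries ℤ) (N K : ℕ) (h : N ≤ K) :
    PowerSeries.coeff N (g * Ps) = PowerSeries.coeff N (g * Ak K) := by
  rw [PowerSeries.coeff_mul, PowerSeries.coeff_mul]
  refine Finset.sum_congr rfl fun x hx => ?_
  rw [Finset.HasAntidiagonal.mem_antidiagonal] at hx
  rw [Ps_Ak x.2 K (by omega)]

lemma grow (U V : PowerSeries ℤ) (a b : ℕ) (ha : 0 < a) (h : V = (1 + PowerSeries.X ^ b) * U + PowerSeries.X ^ a * V)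
    (hU : ∀ n, 0 ≤ PowerSeries.coeff n U) (n : ℕ) : PowerSeries.coeff n U ≤ PowerSeries.coeff n V := by
  induction n using Nat.strong_induction_on with
  | _ n ih =>
    rw [h, add_mul, one_mul, map_add, map_add, PowerSeries.coeff_X_pow_mul', PowerSeries.coeff_X_pow_mul']
    have h1 : 0 ≤ if b ≤ n then PowerSeries.coeff (n - b) U else 0 := by
      split_ifs
      · exact hU _
      · exact le_rfl
    have h2 : 0 ≤ if a ≤ n then PowerSeries.coeff (n - a) V else 0 := by
      split_ifs
      · exact (hU _).trans (ih _ (by omega))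
      · exact le_rfl
    linarith

noncomputable def dP (n : ℕ) : ℤ := PowerSeries.coeff n ((1 - PowerSeries.X) * Ps)

lemma one_add_X_ne (k : ℕ) (hk : 0 < k) : (1 + PowerSeries.X ^ k : PowerSeries ℤ) ≠ 0 := by
  intro h
  have := congrArg (PowerSeries.coeff 0) h
  rw [map_add, PowerSeries.coeff_X_pow, if_neg (by omega)] at this
  simp at this

lemma B1 : (1 - PowerSeries.X) * Ak 1 = 1 := by
  have h := Ak_succ 0
  rw [Ak_zero] at h
  apply mul_left_cancel₀ (one_add_X_ne 1 (by norm_num))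
  norm_num at h ⊢
  linear_combination h

lemma B_grow (k n : ℕ) : 0 ≤ PowerSeries.coeff n ((1 - PowerSeries.X) * Ak (k + 1)) := by
  induction k generalizing n with
  | zero =>
    rw [zero_add, B1, PowerSeries.coeff_one]; split_ifs <;> norm_num
  | succ k ih =>
    refine (ih n).trans (grow _ _ (2 * (k + 1) + 2) (2 * (k + 1) + 1) (by omega) ?_ ih n)
    linear_combination (1 - PowerSeries.X) * Ak_succ (k + 1)

lemma C3 : (1 - PowerSeries.X ^ 3) * ((1 - PowerSeries.X) * Ak 3) =
    (1 + PowerSeries.X ^ 5) * 1 + PowerSeries.X ^ 4 * ((1 - PowerSeries.X ^ 3) * ((1 - PowerSeries.X) * Ak 3)) := by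
  have h1 := B1
  have h2 := Ak_succ 1
  have h3 := Ak_succ 2
  norm_num at h2 h3
  apply mul_left_cancel₀ (one_add_X_ne 3 (by norm_num))
  linear_combination (1 - PowerSeries.X) * (1 - PowerSeries.X ^ 4) * h3 + (1 - PowerSeries.X) * (1 + PowerSeries.X ^ 5) * h2 + (1 + PowerSeries.X ^ 5) * (1 + PowerSeries.X ^ 3) * h1

lemma C3_nonneg (n : ℕ) : 0 ≤ PowerSeries.coeff n ((1 - PowerSeries.X ^ 3) * ((1 - PowerSeries.X) * Ak 3)) := by
  refine le_trans ?_ (grow 1 _ 4 5 (by norm_num) C3 ?_ n) <;> intros <;> rw [PowerSeries.coeff_one] <;> split_ifs <;> norm_num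

lemma C_grow (k n : ℕ) : PowerSeries.coeff n ((1 - PowerSeries.X ^ 3) * ((1 - PowerSeries.X) * Ak 3)) ≤
    PowerSeries.coeff n ((1 - PowerSeries.X ^ 3) * ((1 - PowerSeries.X) * Ak (3 + k))) := by
  induction k generalizing n with
  | zero => exact le_rfl
  | succ k ih =>
    refine (ih n).trans (grow _ _ (2 * (3 + k) + 2) (2 * (3 + k) + 1) (by omega) ?_ (fun m => (C3_nonneg m).trans (ih m)) n)
    rw [← add_assoc]
    linear_combination (1 - PowerSeries.X ^ 3) * (1 - PowerSeries.X) * Ak_succ (3 + k)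

lemma dP_nonneg (n : ℕ) : 0 ≤ dP n := by
  rw [dP, mul_Ps_Ak _ n (n + 1) (by omega)]
  exact B_grow n n

lemma C_le (n : ℕ) : PowerSeries.coeff n ((1 - PowerSeries.X ^ 3) * ((1 - PowerSeries.X) * Ak 3)) ≤ 
    dP n - if 3 ≤ n then dP (n - 3) else 0 := by
  have h := C_grow n n
  rw [← mul_assoc, ← mul_assoc _ _ (Ak (3 + n)), ← mul_Ps_Ak _ n (3 + n) (by omega), mul_assoc, mul_assoc, sub_mul (1 : PowerSeries ℤ) (PowerSeries.X ^ 3) (_ * Ps), one_mul, map_sub,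
    PowerSeries.coeff_X_pow_mul'] at h
  exact h

lemma dP_mono3 (n : ℕ) : dP n ≤ dP (n + 3) := by
  have h := (C3_nonneg (n + 3)).trans (C_le (n + 3))
  rw [if_pos (by omega), Nat.add_sub_cancel] at h
  linarith

lemma C3_val (n : ℕ) (h : n = 0 ∨ n = 4 ∨ n = 5) :
    1 ≤ PowerSeries.coeff n ((1 - PowerSeries.X ^ 3) * ((1 - PowerSeries.X) * Ak 3)) := by
  have h0 := fun m => C3_nonneg m
  have g : ∀ m, PowerSeries.coeff m (1 : PowerSeries ℤ) ≤ PowerSeries.coeff m ((1 - PowerSeries.X ^ 3) * ((1 - PowerSeries.X) * Ak 3)) := by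
    refine grow 1 _ 4 5 (by norm_num) C3 ?_
    intro m; rw [PowerSeries.coeff_one]; split_ifs <;> norm_num
  have g0 := g 0
  rw [PowerSeries.coeff_one, if_pos rfl] at g0
  rcases h with rfl | rfl | rfl
  · exact g0
  · rw [C3, map_add, PowerSeries.coeff_X_pow_mul', if_pos (by norm_num), mul_one, map_add, PowerSeries.coeff_one, PowerSeries.coeff_X_pow]
    norm_num; simpa using g0
  · rw [C3, map_add, PowerSeries.coeff_X_pow_mul', if_pos (by norm_num), mul_one, map_add, PowerSeries.coeff_one, PowerSeries.coeff_X_pow]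
    have := h0 1
    norm_num; exact this

lemma dP_zero : 1 ≤ dP 0 := by
  have := (C3_val 0 (by simp)).trans (C_le 0)
  simpa using this

lemma dP_pos (n : ℕ) (hn : 3 ≤ n) : 1 ≤ dP n := by
  induction n using Nat.strong_induction_on with
  | _ n ih =>
    rcases Nat.lt_or_ge n 6 with h | h
    · obtain rfl | rfl | rfl : n = 3 ∨ n = 4 ∨ n = 5 := by omega
      · exact dP_zero.trans (dP_mono3 0)
      · have := (C3_val 4 (by simp)).trans (C_le 4)
        have := dP_nonneg 1
        norm_num at *; linarith
      · have := (C3_val 5 (by simp)).trans (C_le 5)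
        have := dP_nonneg 2
        norm_num at *; linarith
    · have := ih (n - 3) (by omega) (by omega)
      have h2 := dP_mono3 (n - 3)
      rw [Nat.sub_add_cancel (by omega)] at h2
      linarith

lemma pc_sum (n : ℕ) : pc n = ∑ i ∈ Finset.range (n + 1), dP i := by
  have h0 : dP 0 = pc 0 := by
    rw [dP, sub_mul, one_mul, map_sub, pc]; simp
  have h1 : ∀ n, dP (n + 1) = pc (n + 1) - pc n := by
    intro n
    rw [dP, sub_mul, one_mul, map_sub, PowerSeries.coeff_succ_X_mul, pc, pc]
  induction n with
  | zero => simp [h0]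
  | succ n ih => rw [Finset.sum_range_succ, ← ih, h1]; ring

lemma pE_nonneg (k s n : ℕ) : 0 ≤ pE k s n := by rw [← card_pB]; positivity

lemma Vs_nonneg (m n : ℕ) : 0 ≤ PowerSeries.coeff n (Vs m) := by
  rw [Vs, Sr, PowerSeries.coeff_mk]
  refine Finset.sum_nonneg fun k _ => Finset.sum_nonneg fun s _ => mul_nonneg ?_ (pE_nonneg _ _ _)
  split_ifs <;> norm_num

lemma dP_le (n : ℕ) : dP (n + 3) ≤ pc n := by
  have h1 : (1 - PowerSeries.X) * Ps = 1 + PowerSeries.X ^ 3 * (Ps - Vs 3) - PowerSeries.X * Vs 2 := by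
    have h2 := V_rec 0
    have h3 := V_PZ 0
    have h4 := W_PZ 0
    norm_num at h2 h3 h4
    linear_combination PW_rec + h2 + h4 - h3
  rw [dP, h1, map_sub, map_add, PowerSeries.coeff_X_pow_mul, PowerSeries.coeff_succ_X_mul, map_sub, PowerSeries.coeff_one,
    if_neg (by omega), pc]
  linarith [Vs_nonneg 3 n, Vs_nonneg 2 (n + 2)]
end part_P13

section part_P14
open Filter Topology
lemma abel (L : ℕ → ℤ) (σ K : ℕ) : ∑ k ∈ Finset.range (K + 1), pc k * L (σ + 25 * (K - k)) =
    ∑ j ∈ Finset.range (K + 1), SS L σ j * dP (K - j) := by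
  simp only [pc_sum, Finset.sum_mul]
  rw [Finset.sum_comm' (t' := Finset.range (K + 1)) (s' := fun i => Finset.Ico i (K + 1)) (by
    intro x y; simp only [Finset.mem_range, Finset.mem_Ico]; omega)]
  rw [← Finset.sum_range_reflect]
  refine Finset.sum_congr rfl fun j hj => ?_
  rw [Finset.mem_range] at hj
  have e : K + 1 - 1 - j = K - j := by omega
  rw [e, ← Finset.mul_sum, mul_comm, Finset.sum_Ico_eq_sum_range, SS, ← Finset.sum_range_reflect]
  congr 1
  have e2 : K + 1 - (K - j) = j + 1 := by omega
  rw [e2]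
  refine Finset.sum_congr rfl fun t ht => ?_
  rw [Finset.mem_range] at ht
  congr 2; omega

lemma pos_normal (S : ℕ → ℤ) (hS : ∀ j, 0 ≤ S j) (hp : ∃ j < 4, 1 ≤ S j) (K : ℕ) (hK : 7 ≤ K) :
    0 < ∑ j ∈ Finset.range (K + 1), S j * dP (K - j) := by
  obtain ⟨j, hj, h1⟩ := hp
  refine lt_of_lt_of_le ?_ (Finset.single_le_sum (fun i _ => mul_nonneg (hS i) (dP_nonneg _)) (Finset.mem_range.2 (by omega : j < K + 1)))
  have := dP_pos (K - j) (by omega)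
  positivity

lemma pc_refl (m : ℕ) : ∑ j ∈ Finset.range (m + 1), dP (m - j) = pc m := by
  rw [pc_sum]
  exact Finset.sum_range_reflect dP (m + 1)

lemma pc_succ (m : ℕ) : pc (m + 1) = pc m + dP (m + 1) := by
  rw [pc_sum, pc_sum, Finset.sum_range_succ]

lemma split6 (S : ℕ → ℤ) (m : ℕ) : ∑ j ∈ Finset.range (m + 6 + 1), S j * dP (m + 6 - j) =
    S 0 * dP (m + 6) + S 1 * dP (m + 5) + S 2 * dP (m + 4) + S 3 * dP (m + 3) + S 4 * dP (m + 2) + S 5 * dP (m + 1)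
      + ∑ j ∈ Finset.range (m + 1), S (6 + j) * dP (m - j) := by
  rw [show m + 6 + 1 = 6 + (m + 1) by ring, Finset.sum_range_add]
  congr 1
  · simp [Finset.sum_range_succ]
  · refine Finset.sum_congr rfl fun j _ => ?_
    congr 2; omega

lemma pos_exc5 (S : ℕ → ℤ) (h : ∀ j < 13, [1,-1,1,0,1,0,1,1,1,1,1,1,1].getD j 0 ≤ S j) (h2 : ∀ j, 13 ≤ j → 1 ≤ S j)
    (K : ℕ) (hK : 7 ≤ K) : 0 < ∑ j ∈ Finset.range (K + 1), S j * dP (K - j) := by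
  obtain ⟨m, rfl⟩ : ∃ m, K = m + 6 := ⟨K - 6, by omega⟩
  rw [split6]
  have h6 : ∀ j, 1 ≤ S (6 + j) := by
    intro j
    rcases Nat.lt_or_ge j 7 with hj | hj
    · have := h (6 + j) (by omega)
      interval_cases j <;> simpa using this
    · exact h2 _ (by omega)
  have h7 : pc m ≤ ∑ j ∈ Finset.range (m + 1), S (6 + j) * dP (m - j) := by
    rw [← pc_refl]
    exact Finset.sum_le_sum fun j _ => by nlinarith [h6 j, dP_nonneg (m - j)]
  have a0 := h 0 (by norm_num)
  have a1 := h 1 (by norm_num)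
  have a2 := h 2 (by norm_num)
  have a3 := h 3 (by norm_num)
  have a4 := h 4 (by norm_num)
  have a5 := h 5 (by norm_num)
  simp at a0 a1 a2 a3 a4 a5
  have b0 := mul_le_mul_of_nonneg_right a0 (dP_nonneg (m + 6))
  have b1 := mul_le_mul_of_nonneg_right a1 (dP_nonneg (m + 5))
  have b2 := mul_le_mul_of_nonneg_right a2 (dP_nonneg (m + 4))
  have b3 := mul_le_mul_of_nonneg_right a3 (dP_nonneg (m + 3))
  have b4 := mul_le_mul_of_nonneg_right a4 (dP_nonneg (m + 2))
  have b5 := mul_le_mul_of_nonneg_right a5 (dP_nonneg (m + 1))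
  have c1 : dP (m + 5) ≤ pc (m + 2) := dP_le (m + 2)
  have c2 : pc (m + 2) = pc m + dP (m + 1) + dP (m + 2) := by rw [pc_succ (m + 1), pc_succ]
  have c3 : dP (m + 1) ≤ dP (m + 4) := dP_mono3 (m + 1)
  have c4 := dP_pos (m + 6) (by omega)
  linarith

lemma pick (m a : ℕ) : ∑ j ∈ Finset.range (m + 1), (if j = a then dP (m - j) else 0) = if a ≤ m then dP (m - a) else 0 := by
  rw [Finset.sum_ite_eq']
  simp [Nat.lt_succ_iff]

lemma pos_exc10 (S : ℕ → ℤ) (h : ∀ j < 13, [-1,1,1,3,1,1,0,1,0,1,1,1,0].getD j 0 ≤ S j) (h2 : ∀ j, 13 ≤ j → 1 ≤ S j)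
    (K : ℕ) (hK : 7 ≤ K) : 0 < ∑ j ∈ Finset.range (K + 1), S j * dP (K - j) := by
  obtain ⟨m, rfl⟩ : ∃ m, K = m + 6 := ⟨K - 6, by omega⟩
  rw [split6]
  have h6 : ∀ j, 1 - ((if j = 0 then 1 else 0) + (if j = 2 then 1 else 0) + (if j = 6 then 1 else 0)) ≤ S (6 + j) := by
    intro j
    rcases Nat.lt_or_ge j 7 with hj | hj
    · have := h (6 + j) (by omega)
      interval_cases j <;> simpa using this
    · rw [if_neg (by omega), if_neg (by omega), if_neg (by omega)]
      have := h2 (6 + j) (by omega)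
      linarith
  have h7 : pc m - ((if 0 ≤ m then dP (m - 0) else 0) + (if 2 ≤ m then dP (m - 2) else 0) + (if 6 ≤ m then dP (m - 6) else 0))
      ≤ ∑ j ∈ Finset.range (m + 1), S (6 + j) * dP (m - j) := by
    rw [← pc_refl, ← pick, ← pick, ← pick, ← Finset.sum_add_distrib, ← Finset.sum_add_distrib, ← Finset.sum_sub_distrib]
    refine Finset.sum_le_sum fun j _ => ?_
    refine le_trans (le_of_eq ?_) (mul_le_mul_of_nonneg_right (h6 j) (dP_nonneg (m - j)))
    split_ifs <;> ring
  have a0 := h 0 (by norm_num)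
  have a1 := h 1 (by norm_num)
  have a2 := h 2 (by norm_num)
  have a3 := h 3 (by norm_num)
  have a4 := h 4 (by norm_num)
  have a5 := h 5 (by norm_num)
  simp at a0 a1 a2 a3 a4 a5
  have b0 := mul_le_mul_of_nonneg_right a0 (dP_nonneg (m + 6))
  have b1 := mul_le_mul_of_nonneg_right a1 (dP_nonneg (m + 5))
  have b2 := mul_le_mul_of_nonneg_right a2 (dP_nonneg (m + 4))
  have b3 := mul_le_mul_of_nonneg_right a3 (dP_nonneg (m + 3))
  have b4 := mul_le_mul_of_nonneg_right a4 (dP_nonneg (m + 2))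
  have b5 := mul_le_mul_of_nonneg_right a5 (dP_nonneg (m + 1))
  have c1 : dP (m + 6) ≤ pc (m + 3) := dP_le (m + 3)
  have c2 : pc (m + 3) = pc m + dP (m + 1) + dP (m + 2) + dP (m + 3) := by rw [pc_succ (m + 2), pc_succ (m + 1), pc_succ]
  have c3 : dP m ≤ dP (m + 3) := dP_mono3 m
  have c4 := dP_pos (m + 5) (by omega)
  have c5 : (if 2 ≤ m then dP (m - 2) else 0) ≤ dP (m + 4) := by
    split_ifs with hm
    · have e1 := dP_mono3 (m - 2)
      have e2 := dP_mono3 (m + 1)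
      rw [show m - 2 + 3 = m + 1 by omega] at e1
      exact e1.trans e2
    · exact dP_nonneg _
  have c6 : (if 6 ≤ m then dP (m - 6) else 0) ≤ dP (m + 3) := by
    split_ifs with hm
    · have e1 := dP_mono3 (m - 6)
      have e2 := dP_mono3 (m - 3)
      rw [show m - 6 + 3 = m - 3 by omega] at e1
      rw [show m - 3 + 3 = m by omega] at e2
      linarith
    · exact dP_nonneg _
  rw [if_pos (Nat.zero_le m), Nat.sub_zero] at h7
  linarith

lemma core (i j c : ℕ) (hi : i < 5) (hj : j < 5) (L : ℕ → ℤ)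
    (hL : ∀ N, N % 5 = c → DS N (fun n M => dd i n M - dd j n M) = -5 * L N)
    (idx : ℕ) (hc : (idx + 3) % 5 = c)
    (hpos : 0 < ∑ t ∈ Finset.range ((idx + 3) / 25 + 1), SS L ((idx + 3) % 25) t * dP ((idx + 3) / 25 - t)) :
    N2 (j : ℕ) 5 idx < N2 (i : ℕ) 5 idx := by
  have h := diff_formula idx i j hi hj
  rw [← abel] at hpos
  have e : ∑ k ∈ Finset.range ((idx + 3) / 25 + 1), pc k *
      ∑ x ∈ (idx + 3 - 25 * k).divisorsAntidiagonal, (dd i x.1 x.2 - dd j x.1 x.2) =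
      -5 * ∑ k ∈ Finset.range ((idx + 3) / 25 + 1), pc k * L ((idx + 3) % 25 + 25 * ((idx + 3) / 25 - k)) := by
    rw [Finset.mul_sum]
    refine Finset.sum_congr rfl fun k hk => ?_
    rw [Finset.mem_range] at hk
    have e1 : (idx + 3) % 25 + 25 * ((idx + 3) / 25 - k) = idx + 3 - 25 * k := by omega
    rw [e1]
    have := hL (idx + 3 - 25 * k) (by omega)
    rw [DS] at this
    rw [this]; ring
  rw [e] at h
  have : (0 : ℤ) < N2 i 5 idx - N2 j 5 idx := by linarith
  omega

def chkN (p : ℕ) (w r : List ℤ) (I σ : ℕ) : Bool :=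
  chkS p w r σ I [] && (List.range 4).any (fun j => decide (1 ≤ SSf p w r σ j))

lemma chkN_spec (p : ℕ) (hp : p < 2) (w r : List ℤ) (hw : ∀ i < 10, -4 ≤ w.getD i 0) (hr : ∀ i < 10, -4 ≤ r.getD i 0)
    (σ I : ℕ) (h : chkN p w r I σ = true)
    (hl : ∀ j, 13 + I ≤ j → 1 ≤ SS (LO p (tab w) (tab r)) σ j) (K : ℕ) (hK : 7 ≤ K) :
    0 < ∑ j ∈ Finset.range (K + 1), SS (LO p (tab w) (tab r)) σ j * dP (K - j) := by
  simp only [chkN, Bool.and_eq_true, List.any_eq_true, List.mem_range, decide_eq_true_eq] at h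
  obtain ⟨h1, h2⟩ := chkS_spec p hp w r hw hr σ I [] h.1 hl
  refine pos_normal _ (fun j => ?_) ?_ K hK
  · rcases Nat.lt_or_ge j 13 with hj | hj
    · simpa using h1 j hj
    · linarith [h2 j hj]
  · obtain ⟨j, hj, h3⟩ := h.2
    exact ⟨j, hj, by rw [SS_SSf p hp w r hw hr]; exact h3⟩
end part_P14

section part_P15
open Filter Topology
lemma fin_A (idx : ℕ) (hc : (idx + 3) % 5 = 3) (hK : 7 ≤ (idx + 3) / 25) : N2 (1 : ℕ) 5 idx < N2 (2 : ℕ) 5 idx := by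
  refine core 2 1 3 (by norm_num) (by norm_num) (LO 1 (tab [0,1,-1,-1,1,0,-1,1,1,-1]) (tab [0,0,-1,-1,0,0,0,1,1,0])) ?_ idx hc ?_
  · intro N hN
    rw [L3_21 N hN, LO_comb _ _ 0 (-1) 1 0 (by decide) (by decide)]; ring
  · have h25 : (idx + 3) % 25 < 25 := Nat.mod_lt _ (by norm_num)
    have h5 : (idx + 3) % 25 % 5 = 3 := by omega
    generalize (idx + 3) % 25 = σ at h25 h5
    have hl : ∀ j, 13 + 497 ≤ j → 1 ≤ SS (LO 1 (tab [0,1,-1,-1,1,0,-1,1,1,-1]) (tab [0,0,-1,-1,0,0,0,1,1,0])) σ j :=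
      fun j hj => large_A σ j h25 h5 (by omega)
    have hchk : ∀ k < 5, chkN 1 [0,1,-1,-1,1,0,-1,1,1,-1] [0,0,-1,-1,0,0,0,1,1,0] 497 (3 + 5 * k) = true := by decide +kernel
    refine chkN_spec 1 (by norm_num) _ _ (by decide) (by decide) σ 497 ?_ hl _ hK
    have := hchk (σ / 5) (by omega)
    rwa [show 3 + 5 * (σ / 5) = σ by omega] at this

lemma fin_B (idx : ℕ) (hc : (idx + 3) % 5 = 3) (hK : 7 ≤ (idx + 3) / 25) : N2 (2 : ℕ) 5 idx < N2 (0 : ℕ) 5 idx := by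
  refine core 0 2 3 (by norm_num) (by norm_num) (LO 1 (tab [0,2,-1,-1,2,0,-2,1,1,-2]) (tab [0,0,-1,-1,0,0,0,1,1,0])) ?_ idx hc ?_
  · intro N hN
    rw [L3_02 N hN, LO_comb _ _ 0 (-1) 2 0 (by decide) (by decide)]; ring
  · have h25 : (idx + 3) % 25 < 25 := Nat.mod_lt _ (by norm_num)
    have h5 : (idx + 3) % 25 % 5 = 3 := by omega
    generalize (idx + 3) % 25 = σ at h25 h5
    have hl : ∀ j, 13 + 102 ≤ j → 1 ≤ SS (LO 1 (tab [0,2,-1,-1,2,0,-2,1,1,-2]) (tab [0,0,-1,-1,0,0,0,1,1,0])) σ j :=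
      fun j hj => large_B σ j h25 h5 (by omega)
    have hchk : ∀ k < 5, chkN 1 [0,2,-1,-1,2,0,-2,1,1,-2] [0,0,-1,-1,0,0,0,1,1,0] 102 (3 + 5 * k) = true := by decide +kernel
    refine chkN_spec 1 (by norm_num) _ _ (by decide) (by decide) σ 102 ?_ hl _ hK
    have := hchk (σ / 5) (by omega)
    rwa [show 3 + 5 * (σ / 5) = σ by omega] at this

lemma fin_C (idx : ℕ) (hc : (idx + 3) % 5 = 0) (hK : 7 ≤ (idx + 3) / 25) : N2 (2 : ℕ) 5 idx < N2 (1 : ℕ) 5 idx := by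
  refine core 1 2 0 (by norm_num) (by norm_num) (LO 1 (tab [0,0,1,1,0,0,0,-1,-1,0]) (tab [0,0,1,1,0,0,0,-1,-1,0])) ?_ idx hc ?_
  · intro N hN
    rw [L0_12 N hN, LO_comb _ _ 0 1 0 0 (by decide) (by decide)]; ring
  · have h25 : (idx + 3) % 25 < 25 := Nat.mod_lt _ (by norm_num)
    have h5 : (idx + 3) % 25 % 5 = 0 := by omega
    generalize (idx + 3) % 25 = σ at h25 h5
    have hl : ∀ j, 13 + 102 ≤ j → 1 ≤ SS (LO 1 (tab [0,0,1,1,0,0,0,-1,-1,0]) (tab [0,0,1,1,0,0,0,-1,-1,0])) σ j :=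
      fun j hj => large_C σ j h25 h5 (by omega)
    have hchk : ∀ k < 5, chkN 1 [0,0,1,1,0,0,0,-1,-1,0] [0,0,1,1,0,0,0,-1,-1,0] 102 (0 + 5 * k) = true := by decide +kernel
    refine chkN_spec 1 (by norm_num) _ _ (by decide) (by decide) σ 102 ?_ hl _ hK
    have := hchk (σ / 5) (by omega)
    rwa [show 0 + 5 * (σ / 5) = σ by omega] at this

lemma fin_D (idx : ℕ) (hc : (idx + 3) % 5 = 0) (hK : 7 ≤ (idx + 3) / 25) : N2 (1 : ℕ) 5 idx < N2 (0 : ℕ) 5 idx := by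
  refine core 0 1 0 (by norm_num) (by norm_num) (LO 1 (tab [0,1,-1,-1,1,0,-1,1,1,-1]) (tab [0,1,-1,-1,1,0,-1,1,1,-1])) ?_ idx hc ?_
  · intro N hN
    rw [L0_01 N hN, LO_comb _ _ 1 (-1) 0 0 (by decide) (by decide)]; ring
  · have h25 : (idx + 3) % 25 < 25 := Nat.mod_lt _ (by norm_num)
    have h5 : (idx + 3) % 25 % 5 = 0 := by omega
    generalize (idx + 3) % 25 = σ at h25 h5
    have hl : ∀ j, 13 + 497 ≤ j → 1 ≤ SS (LO 1 (tab [0,1,-1,-1,1,0,-1,1,1,-1]) (tab [0,1,-1,-1,1,0,-1,1,1,-1])) σ j :=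
      fun j hj => large_D σ j h25 h5 (by omega)
    by_cases e5 : σ = 5
    · subst e5
      obtain ⟨h1, h2⟩ := chkS_spec 1 (by norm_num) _ _ (by decide) (by decide) 5 497 [1,-1,1,0,1,0,1,1,1,1,1,1,1] (by decide +kernel) hl
      exact pos_exc5 _ h1 h2 _ hK
    · by_cases e10 : σ = 10
      · subst e10
        obtain ⟨h1, h2⟩ := chkS_spec 1 (by norm_num) _ _ (by decide) (by decide) 10 497 [-1,1,1,3,1,1,0,1,0,1,1,1,0] (by decide +kernel) hl
        exact pos_exc10 _ h1 h2 _ hK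
      · have hchk : ∀ k < 5, k ≠ 1 → k ≠ 2 → chkN 1 [0,1,-1,-1,1,0,-1,1,1,-1] [0,1,-1,-1,1,0,-1,1,1,-1] 497 (5 * k) = true := by decide +kernel
        refine chkN_spec 1 (by norm_num) _ _ (by decide) (by decide) σ 497 ?_ hl _ hK
        have := hchk (σ / 5) (by omega) (by omega) (by omega)
        rwa [show 5 * (σ / 5) = σ by omega] at this

lemma fin_E (idx : ℕ) (hc : (idx + 3) % 5 = 2) (hK : 7 ≤ (idx + 3) / 25) : N2 (2 : ℕ) 5 idx < N2 (0 : ℕ) 5 idx := by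
  refine core 0 2 2 (by norm_num) (by norm_num) (LO 1 (tab [0,1,1,1,1,0,-1,-1,-1,-1]) (tab [0,1,0,0,1,0,-1,0,0,-1])) ?_ idx hc ?_
  · intro N hN
    rw [L2_02 N hN, LO_comb _ _ 1 0 0 1 (by decide) (by decide)]; ring
  · have h25 : (idx + 3) % 25 < 25 := Nat.mod_lt _ (by norm_num)
    have h5 : (idx + 3) % 25 % 5 = 2 := by omega
    generalize (idx + 3) % 25 = σ at h25 h5
    have hl : ∀ j, 13 + 102 ≤ j → 1 ≤ SS (LO 1 (tab [0,1,1,1,1,0,-1,-1,-1,-1]) (tab [0,1,0,0,1,0,-1,0,0,-1])) σ j :=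
      fun j hj => large_E σ j h25 h5 (by omega)
    have hchk : ∀ k < 5, chkN 1 [0,1,1,1,1,0,-1,-1,-1,-1] [0,1,0,0,1,0,-1,0,0,-1] 102 (2 + 5 * k) = true := by decide +kernel
    refine chkN_spec 1 (by norm_num) _ _ (by decide) (by decide) σ 102 ?_ hl _ hK
    have := hchk (σ / 5) (by omega)
    rwa [show 2 + 5 * (σ / 5) = σ by omega] at this

lemma fin_F (idx : ℕ) (hc : (idx + 3) % 5 = 2) (hK : 7 ≤ (idx + 3) / 25) : N2 (0 : ℕ) 5 idx < N2 (1 : ℕ) 5 idx := by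
  refine core 1 0 2 (by norm_num) (by norm_num) (LO 1 (tab [0,0,1,1,0,0,0,-1,-1,0]) (tab [])) ?_ idx hc ?_
  · intro N hN
    rw [L2_10 N hN, LO_comb _ _ 0 0 0 1 (by decide) (by decide)]; ring
  · have h25 : (idx + 3) % 25 < 25 := Nat.mod_lt _ (by norm_num)
    have h5 : (idx + 3) % 25 % 5 = 2 := by omega
    generalize (idx + 3) % 25 = σ at h25 h5
    have hl : ∀ j, 13 + 102 ≤ j → 1 ≤ SS (LO 1 (tab [0,0,1,1,0,0,0,-1,-1,0]) (tab [])) σ j :=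
      fun j hj => large_F σ j h25 (by omega)
    have hchk : ∀ k < 5, chkN 1 [0,0,1,1,0,0,0,-1,-1,0] [] 102 (2 + 5 * k) = true := by decide +kernel
    refine chkN_spec 1 (by norm_num) _ _ (by decide) (by decide) σ 102 ?_ hl _ hK
    have := hchk (σ / 5) (by omega)
    rwa [show 2 + 5 * (σ / 5) = σ by omega] at this

lemma fin_G (idx : ℕ) (hc : (idx + 3) % 5 = 4) (hK : 7 ≤ (idx + 3) / 25) : N2 (1 : ℕ) 5 idx < N2 (0 : ℕ) 5 idx := by
  refine core 0 1 4 (by norm_num) (by norm_num) (LO 0 (tab [0,1,1,-1,-1,0,1,1,-1,-1]) (tab [])) ?_ idx hc ?_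
  · intro N hN
    rw [L4_01 N hN, LO_EA 1 4 _ (by decide) (by decide) (by decide) N hN]
  · have h25 : (idx + 3) % 25 < 25 := Nat.mod_lt _ (by norm_num)
    have h5 : (idx + 3) % 25 % 5 = 4 := by omega
    generalize (idx + 3) % 25 = σ at h25 h5
    have hl : ∀ j, 13 + 102 ≤ j → 1 ≤ SS (LO 0 (tab [0,1,1,-1,-1,0,1,1,-1,-1]) (tab [])) σ j :=
      fun j hj => large_G σ j h25 (by omega)
    have hchk : ∀ k < 5, chkN 0 [0,1,1,-1,-1,0,1,1,-1,-1] [] 102 (4 + 5 * k) = true := by decide +kernel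
    refine chkN_spec 0 (by norm_num) _ _ (by decide) (by decide) σ 102 ?_ hl _ hK
    have := hchk (σ / 5) (by omega)
    rwa [show 4 + 5 * (σ / 5) = σ by omega] at this

lemma fin_H (idx : ℕ) (hc : (idx + 3) % 5 = 1) (hK : 7 ≤ (idx + 3) / 25) : N2 (0 : ℕ) 5 idx < N2 (1 : ℕ) 5 idx := by
  refine core 1 0 1 (by norm_num) (by norm_num) (LO 0 (tab [0,1,-1,1,-1,0,1,-1,1,-1]) (tab [])) ?_ idx hc ?_
  · intro N hN
    rw [L1_10 N hN, LO_EA (-1) 1 _ (by decide) (by decide) (by decide) N hN]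
  · have h25 : (idx + 3) % 25 < 25 := Nat.mod_lt _ (by norm_num)
    have h5 : (idx + 3) % 25 % 5 = 1 := by omega
    generalize (idx + 3) % 25 = σ at h25 h5
    have hl : ∀ j, 13 + 102 ≤ j → 1 ≤ SS (LO 0 (tab [0,1,-1,1,-1,0,1,-1,1,-1]) (tab [])) σ j :=
      fun j hj => large_H σ j h25 (by omega)
    have hchk : ∀ k < 5, chkN 0 [0,1,-1,1,-1,0,1,-1,1,-1] [] 102 (1 + 5 * k) = true := by decide +kernel
    refine chkN_spec 0 (by norm_num) _ _ (by decide) (by decide) σ 102 ?_ hl _ hK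
    have := hchk (σ / 5) (by omega)
    rwa [show 1 + 5 * (σ / 5) = σ by omega] at this
end part_P15

theorem N2_mod5_inequalities (n : ℕ) (hn : 36 ≤ n) :
    (N2 1 5 (5 * n) < N2 2 5 (5 * n) ∧ N2 2 5 (5 * n) < N2 0 5 (5 * n)) ∧
    (N2 1 5 (5 * n + 1) < N2 0 5 (5 * n + 1)) ∧
    (N2 2 5 (5 * n + 2) < N2 1 5 (5 * n + 2) ∧ N2 1 5 (5 * n + 2) < N2 0 5 (5 * n + 2)) ∧
    (N2 0 5 (5 * n + 3) < N2 1 5 (5 * n + 3)) ∧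
    (N2 2 5 (5 * n + 4) < N2 0 5 (5 * n + 4) ∧ N2 0 5 (5 * n + 4) < N2 1 5 (5 * n + 4)) := by
  have hA := fin_A (5 * n) (by omega) (by omega)
  have hB := fin_B (5 * n) (by omega) (by omega)
  have hG := fin_G (5 * n + 1) (by omega) (by omega)
  have hC := fin_C (5 * n + 2) (by omega) (by omega)
  have hD := fin_D (5 * n + 2) (by omega) (by omega)
  have hH := fin_H (5 * n + 3) (by omega) (by omega)
  have hE := fin_E (5 * n + 4) (by omega) (by omega)
  have hF := fin_F (5 * n + 4) (by omega) (by omega)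
  simp only [Nat.cast_ofNat, Nat.cast_zero, Nat.cast_one] at hA hB hC hD hE hF hG hH
  exact ⟨⟨hA, hB⟩, hG, ⟨hC, hD⟩, hH, hE, hF⟩
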